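/- arXiv:1706.04628 — 4 statements merged into one kernel-verified Lean document; each statement's English description precedes it below -/
import Mathlib

section
/- Suppose S is a nonnegative random variable with 0 < E[S] < ∞. Then for all p ≥ 1 and all θ > 0, E[(N_o(1))^p] ≤ exp(θ) (24p / (1 − E[exp(−θS)]))^{p+2}. -/
open MeasureTheory ProbabilityTheory
open scoped ENNReal

/-- The number of renewals in `[0, t]` of a renewal process whose successive renewal
intervals are `ξ 0, ξ 1, ξ 2, ...`. -/
noncomputable def renewalCount (ξ : ℕ → ℝ) (t : ℝ) : ℕ :=
  sSup {n : ℕ | ∑ i ∈ Finset.range n, ξ i ≤ t}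

/-- The count is always a member of the defining set when `t ≥ 0`. -/
lemma renewalCount_sum_le (ξ : ℕ → ℝ) (t : ℝ) (ht : 0 ≤ t) :
    ∑ i ∈ Finset.range (renewalCount ξ t), ξ i ≤ t := by
  have hne : ({n : ℕ | ∑ i ∈ Finset.range n, ξ i ≤ t}).Nonempty := ⟨0, by simpa using ht⟩
  by_cases hb : BddAbove {n : ℕ | ∑ i ∈ Finset.range n, ξ i ≤ t}
  · exact Nat.sSup_mem hne hb
  · have h0 : renewalCount ξ t = 0 := by
      unfold renewalCount
      exact Nat.sSup_of_not_bddAbove hb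
    rw [h0]
    simpa using ht

lemma term_bound (q p : ℝ) (hq : 0 < q) (hq1 : q ≤ 1) (hp : 1 ≤ p) (n : ℕ) :
    (n : ℝ) ^ p * (1 - q) ^ n ≤ (2 * p / q) ^ p * (Real.exp (-(q / 2))) ^ n := by
  have hp0 : 0 < p := by linarith
  have h1 : (n : ℝ) ≤ (2 * p / q) * Real.exp (q * n / (2 * p)) := by
    have h := Real.add_one_le_exp (q * n / (2 * p))
    have h2 : (n : ℝ) = (2 * p / q) * (q * n / (2 * p)) := by field_simp
    have h3 : 0 ≤ 2 * p / q := by positivity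
    calc (n : ℝ) = (2 * p / q) * (q * n / (2 * p)) := h2
      _ ≤ _ := by
        apply mul_le_mul_of_nonneg_left _ h3
        linarith
  have h2 : (n : ℝ) ^ p ≤ (2 * p / q) ^ p * Real.exp (q * n / 2) := by
    calc (n : ℝ) ^ p ≤ ((2 * p / q) * Real.exp (q * n / (2 * p))) ^ p :=
          Real.rpow_le_rpow (by positivity) h1 hp0.le
      _ = _ := by
        rw [Real.mul_rpow (by positivity) (by positivity), ← Real.exp_mul]
        congr 2
        field_simp
  have h3 : (1 - q) ^ n ≤ Real.exp (-q * n) := by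
    calc (1 - q) ^ n ≤ (Real.exp (-q)) ^ n :=
          pow_le_pow_left₀ (by linarith) (by have := Real.add_one_le_exp (-q); linarith) n
      _ = _ := by rw [← Real.exp_nat_mul]; congr 1; ring
  calc (n : ℝ) ^ p * (1 - q) ^ n
      ≤ ((2 * p / q) ^ p * Real.exp (q * n / 2)) * Real.exp (-q * n) :=
        mul_le_mul h2 h3 (pow_nonneg (by linarith) n) (by positivity)
    _ = _ := by
      rw [mul_assoc, ← Real.exp_add, ← Real.exp_nat_mul]
      congr 2
      ring

lemma final_bound (q p : ℝ) (hq : 0 < q) (hq1 : q ≤ 1) (hp : 1 ≤ p) :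
    (2 * p / q) ^ p * (1 - Real.exp (-(q / 2)))⁻¹ ≤ (24 * p / q) ^ (p + 2) := by
  have hp0 : 0 < p := by linarith
  have h1 : q / 3 ≤ 1 - Real.exp (-(q / 2)) := by
    have h := Real.add_one_le_exp (q / 2)
    rw [Real.exp_neg]
    have h2 : (Real.exp (q / 2))⁻¹ ≤ (q / 2 + 1)⁻¹ := inv_anti₀ (by positivity) h
    have h3 : (q / 2 + 1)⁻¹ ≤ 1 - q / 3 := by
      rw [inv_le_iff_one_le_mul₀ (by positivity)]
      nlinarith
    linarith
  have h2 : (1 - Real.exp (-(q / 2)))⁻¹ ≤ (q / 3)⁻¹ := inv_anti₀ (by positivity) h1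
  have hB : 1 ≤ 24 * p / q := by
    rw [le_div_iff₀ hq]; linarith
  have h3 : (q / 3)⁻¹ ≤ 24 * p / q := by
    rw [inv_div]
    gcongr
    linarith
  have h4 : 24 * p / q ≤ (24 * p / q) ^ (2 : ℝ) := Real.self_le_rpow_of_one_le hB (by norm_num)
  have h5 : (2 * p / q) ^ p ≤ (24 * p / q) ^ p := by
    gcongr
    norm_num
  rw [Real.rpow_add (by positivity)]
  exact mul_le_mul h5 (h2.trans (h3.trans h4)) (inv_nonneg.2 (by linarith)) (by positivity)

/-- Explicit bound on the `p`-th moment of `N_o(1)`, the number of renewals in `[0,1]` of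
an ordinary renewal process with i.i.d. renewal intervals `Sseq i` distributed as `S`,
where `S ≥ 0` and `0 < E[S] < ∞`. -/
theorem ordinary_renewal_moment_at_one
    {Ω : Type*} [MeasurableSpace Ω] (μ : Measure Ω) [IsProbabilityMeasure μ]
    (S : Ω → ℝ) (hSmeas : Measurable S) (hSnn : ∀ᵐ ω ∂μ, 0 ≤ S ω)
    (hSint : Integrable S μ) (hES : 0 < ∫ ω, S ω ∂μ)
    (Sseq : ℕ → Ω → ℝ)
    (hmeas : ∀ i, Measurable (Sseq i))
    (hindep : iIndepFun Sseq μ)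
    (hlaw : ∀ i, μ.map (Sseq i) = μ.map S) :
    ∀ p : ℝ, 1 ≤ p → ∀ θ : ℝ, 0 < θ →
      ∫⁻ ω, ENNReal.ofReal ((renewalCount (fun i => Sseq i ω) 1 : ℝ) ^ p) ∂μ
        ≤ ENNReal.ofReal (Real.exp θ
            * (24 * p / (1 - ∫ ω, Real.exp (-θ * S ω) ∂μ)) ^ (p + 2)) := by
  intro p hp θ hθ
  set a : ℝ := ∫ ω, Real.exp (-θ * S ω) ∂μ with ha
  have hSexp : Integrable (fun ω => Real.exp (-θ * S ω)) μ := by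
    refine Integrable.of_bound (by fun_prop) 1 ?_
    filter_upwards [hSnn] with ω hω
    rw [Real.norm_eq_abs, abs_of_pos (Real.exp_pos _), Real.exp_le_one_iff]
    nlinarith
  have ha0 : 0 ≤ a := integral_nonneg fun ω => (Real.exp_pos _).le
  have hdint : Integrable (fun ω => 1 - Real.exp (-θ * S ω)) μ := (integrable_const 1).sub hSexp
  have hdnn : 0 ≤ᵐ[μ] fun ω => 1 - Real.exp (-θ * S ω) := by
    filter_upwards [hSnn] with ω hω
    have : Real.exp (-θ * S ω) ≤ 1 := by
      rw [Real.exp_le_one_iff]; nlinarith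
    simpa using this
  have hdeq : ∫ ω, (1 - Real.exp (-θ * S ω)) ∂μ = 1 - a := by
    rw [integral_sub (integrable_const 1) hSexp]; simp [ha]
  have ha1 : 0 < 1 - a := by
    have h0 : 0 ≤ 1 - a := hdeq ▸ integral_nonneg_of_ae hdnn
    refine lt_of_le_of_ne h0 fun h => ?_
    rw [← hdeq] at h
    have h2 := (integral_eq_zero_iff_of_nonneg_ae hdnn hdint).1 h.symm
    have h3 : S =ᵐ[μ] 0 := by
      filter_upwards [h2] with ω hω
      have h4 : Real.exp (-θ * S ω) = 1 := by
        have : 1 - Real.exp (-θ * S ω) = 0 := hω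
        linarith
      rw [Real.exp_eq_one_iff] at h4
      rcases mul_eq_zero.1 h4 with h5 | h5
      · linarith
      · simpa using h5
    rw [integral_congr_ae h3] at hES
    simp at hES
  have hid : ∀ i, IdentDistrib (Sseq i) S μ μ := fun i =>
    ⟨(hmeas i).aemeasurable, hSmeas.aemeasurable, hlaw i⟩
  have hexpm : Measurable (fun x : ℝ => Real.exp (-θ * x)) := by fun_prop
  have hmgf : ∀ i, mgf (Sseq i) μ (-θ) = a := fun i => ((hid i).comp hexpm).integral_eq
  have hint : ∀ i, Integrable (fun ω => Real.exp (-θ * Sseq i ω)) μ := fun i =>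
    ((hid i).comp hexpm).integrable_iff.2 hSexp
  have hT : ∀ n : ℕ, ∫ ω, Real.exp (-θ * ∑ i ∈ Finset.range n, Sseq i ω) ∂μ = a ^ n := by
    intro n
    have h := hindep.mgf_sum (t := -θ) hmeas (Finset.range n)
    simp only [hmgf, Finset.prod_const, Finset.card_range] at h
    rw [← h]
    simp [mgf]
  have hTint : ∀ n : ℕ,
      Integrable (fun ω => Real.exp (-θ * ∑ i ∈ Finset.range n, Sseq i ω)) μ := by
    intro n
    have h := hindep.integrable_exp_mul_sum (t := -θ) hmeas (s := Finset.range n)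
      (fun i _ => hint i)
    simpa using h
  have hpt : ∀ ω, ENNReal.ofReal ((renewalCount (fun i => Sseq i ω) 1 : ℝ) ^ p) ≤
      ∑' n : ℕ, ENNReal.ofReal (((n : ℝ) ^ p * Real.exp θ) *
        Real.exp (-θ * ∑ i ∈ Finset.range n, Sseq i ω)) := by
    intro ω
    refine le_trans ?_ (ENNReal.le_tsum (renewalCount (fun i => Sseq i ω) 1))
    apply ENNReal.ofReal_le_ofReal
    have h := renewalCount_sum_le (fun i => Sseq i ω) 1 zero_le_one
    rw [mul_assoc, ← Real.exp_add]
    apply le_mul_of_one_le_right (by positivity)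
    rw [Real.one_le_exp_iff]
    nlinarith
  have hr1 : Real.exp (-((1 - a) / 2)) < 1 := by
    rw [Real.exp_lt_one_iff]; linarith
  have hr0 : 0 ≤ Real.exp (-((1 - a) / 2)) := (Real.exp_pos _).le
  have hq1 : 1 - a ≤ 1 := by linarith
  calc ∫⁻ ω, ENNReal.ofReal ((renewalCount (fun i => Sseq i ω) 1 : ℝ) ^ p) ∂μ
      ≤ ∫⁻ ω, ∑' n : ℕ, ENNReal.ofReal (((n : ℝ) ^ p * Real.exp θ) *
        Real.exp (-θ * ∑ i ∈ Finset.range n, Sseq i ω)) ∂μ := lintegral_mono hpt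
    _ = ∑' n : ℕ, ∫⁻ ω, ENNReal.ofReal (((n : ℝ) ^ p * Real.exp θ) *
        Real.exp (-θ * ∑ i ∈ Finset.range n, Sseq i ω)) ∂μ := by
      apply lintegral_tsum
      intro n
      exact (((hTint n).aemeasurable).const_mul _).ennreal_ofReal
    _ = ∑' n : ℕ, ENNReal.ofReal (((n : ℝ) ^ p * Real.exp θ) * a ^ n) := by
      congr 1
      ext n
      rw [← ofReal_integral_eq_lintegral_ofReal ((hTint n).const_mul _)
        (ae_of_all _ fun ω => by positivity), integral_const_mul, hT]
    _ ≤ ∑' n : ℕ, ENNReal.ofReal ((Real.exp θ * (2 * p / (1 - a)) ^ p) *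
          (Real.exp (-((1 - a) / 2))) ^ n) := by
      refine ENNReal.tsum_le_tsum fun n => ENNReal.ofReal_le_ofReal ?_
      have h := term_bound (1 - a) p ha1 hq1 hp n
      rw [sub_sub_cancel] at h
      have h2 := mul_le_mul_of_nonneg_left h (Real.exp_pos θ).le
      linarith
    _ = ENNReal.ofReal ((Real.exp θ * (2 * p / (1 - a)) ^ p) *
          (1 - Real.exp (-((1 - a) / 2)))⁻¹) := by
      rw [← ENNReal.ofReal_tsum_of_nonneg (fun n => by positivity)
        ((summable_geometric_of_lt_one hr0 hr1).mul_left _), tsum_mul_left,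
        tsum_geometric_of_lt_one hr0 hr1]
    _ ≤ _ := by
      apply ENNReal.ofReal_le_ofReal
      rw [mul_assoc]
      exact mul_le_mul_of_nonneg_left (final_bound (1 - a) p ha1 hq1 hp) (Real.exp_pos θ).le
end

section
/- Suppose E[S] = 1 and E[S^r] < ∞ for some r ≥ 2. Then for all t ≥ 1 and all θ > 0, E[|N_1(t) − t|^r] ≤ E[S^r] exp(θ) (10^7 r^2 / (1 − E[exp(−θS)]))^{r+2} t^{r/2}. -/
open MeasureTheory ProbabilityTheory
open scoped ENNReal

lemma erc_exp_neg_le {z k : ℝ} (hz : 0 < z) (hk : 0 < k) : Real.exp (-z) ≤ (k / z) ^ k := by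
  have h1 : z / k ≤ Real.exp (z / k) := by linarith [Real.add_one_le_exp (z / k)]
  have h2 : (z / k) ^ k ≤ Real.exp z := by
    calc (z / k) ^ k ≤ (Real.exp (z / k)) ^ k := by
          apply Real.rpow_le_rpow (by positivity) h1 hk.le
      _ = Real.exp z := by
          rw [← Real.exp_mul]; congr 1; field_simp
  have h3 : (k / z) ^ k = ((z / k) ^ k)⁻¹ := by
    rw [← Real.inv_rpow (by positivity), inv_div]
  rw [Real.exp_neg, h3]
  exact inv_anti₀ (by positivity) h2

lemma erc_rpow_le_exp {z k : ℝ} (hz : 0 < z) (hk : 0 < k) : z ^ k ≤ k ^ k * Real.exp z := by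
  have h := erc_exp_neg_le hz hk
  rw [Real.div_rpow hk.le hz.le, Real.exp_neg, le_div_iff₀ (by positivity), inv_mul_le_iff₀ (Real.exp_pos _)] at h
  linarith

lemma erc_exp_lower {z : ℝ} (hz : 0 ≤ z) : Real.exp (-z) ≤ 1 - z + z ^ 2 := by
  by_cases h : z ≤ 1
  · have := Real.abs_exp_sub_one_sub_id_le (x := -z) (by rw [abs_neg, abs_of_nonneg hz]; exact h)
    have := (abs_le.1 this).2
    nlinarith
  · have : Real.exp (-z) ≤ 1 := Real.exp_le_one_iff.2 (by linarith)
    nlinarith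

lemma erc_exp_upper {z v : ℝ} (hz : 0 ≤ z) (hv : z ≤ v) :
    Real.exp z ≤ 1 + z + z ^ 2 * Real.exp v := by
  have h0 : Real.exp z ≤ Real.exp v := Real.exp_le_exp.2 hv
  have h1 : 1 ≤ Real.exp z := Real.one_le_exp hz
  have hz2 : 0 ≤ z ^ 2 := sq_nonneg z
  by_cases h : z ≤ 1
  · have := Real.abs_exp_sub_one_sub_id_le (x := z) (by rw [abs_of_nonneg hz]; exact h)
    have := (abs_le.1 this).2
    nlinarith
  · have : Real.exp v ≤ z ^ 2 * Real.exp v := by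
      have : 1 ≤ z ^ 2 := by nlinarith
      nlinarith [Real.exp_pos v]
    linarith

lemma erc_chernoff {Ω : Type*} [MeasurableSpace Ω] (μ : Measure Ω) [IsProbabilityMeasure μ]
    (S : Ω → ℝ) (hSmeas : Measurable S)
    (η : ℕ → Ω → ℝ) (hmeas : ∀ j, Measurable (η j)) (hindep : iIndepFun η μ)
    (hlaw : ∀ j, μ.map (η (j + 1)) = μ.map S)
    (f : ℝ → ℝ) (hf : Measurable f) (hint : Integrable (fun ω => Real.exp (f (S ω))) μ)
    (c : ℝ) (hc : ∫ ω, Real.exp (f (S ω)) ∂μ ≤ Real.exp c) (m : ℕ) (a : ℝ) :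
    μ {ω | a ≤ ∑ i ∈ Finset.range m, f (η (i + 1) ω)} ≤ ENNReal.ofReal (Real.exp (-a + m * c)) := by
  have hind : iIndepFun (fun i => f ∘ η (i + 1)) μ :=
    (hindep.precomp (g := fun i : ℕ => i + 1) (add_left_injective 1)).comp (fun _ => f) (fun _ => hf)
  have hmeas' : ∀ i, Measurable ((fun i => f ∘ η (i + 1)) i) := fun i => hf.comp (hmeas _)
  have hid : ∀ i, IdentDistrib (η (i + 1)) S μ μ := fun i =>
    ⟨(hmeas _).aemeasurable, hSmeas.aemeasurable, hlaw i⟩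
  have hid2 : ∀ i, IdentDistrib (fun ω => Real.exp (1 * (f ∘ η (i + 1)) ω))
      (fun ω => Real.exp (f (S ω))) μ μ := fun i => by
    simpa [Function.comp_def] using (hid i).comp (u := fun x => Real.exp (f x)) (Real.measurable_exp.comp hf)
  have hint' : ∀ i, Integrable (fun ω => Real.exp (1 * (f ∘ η (i + 1)) ω)) μ := fun i =>
    (hid2 i).integrable_iff.2 hint
  have h1 := measure_ge_le_exp_mul_mgf (μ := μ) (t := 1)
    (X := ∑ i ∈ Finset.range m, f ∘ η (i + 1)) a zero_le_one
    (hind.integrable_exp_mul_sum hmeas' (fun i _ => hint' i))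
  rw [hind.mgf_sum hmeas'] at h1
  have h2 : ∏ i ∈ Finset.range m, mgf (f ∘ η (i + 1)) μ 1 ≤ Real.exp (m * c) := by
    calc _ ≤ ∏ i ∈ Finset.range m, Real.exp c := by
          apply Finset.prod_le_prod
          · intro i _; exact mgf_nonneg
          · intro i _
            rw [mgf, (hid2 i).integral_eq]
            exact hc
      _ = _ := by rw [Finset.prod_const, Finset.card_range, Real.exp_nat_mul]
  have h3 : μ.real {ω | a ≤ (∑ i ∈ Finset.range m, f ∘ η (i + 1)) ω} ≤ Real.exp (-a + m * c) := by
    refine h1.trans ?_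
    rw [Real.exp_add, neg_one_mul]
    gcongr
  have h4 : {ω | a ≤ ∑ i ∈ Finset.range m, f (η (i + 1) ω)}
      = {ω | a ≤ (∑ i ∈ Finset.range m, f ∘ η (i + 1)) ω} := by
    ext ω; simp [Finset.sum_apply]
  rw [h4, ← ofReal_measureReal]
  exact ENNReal.ofReal_le_ofReal h3

/-- integral of the truncated power tail -/
lemma erc_tail_integral {r s : ℝ} (hr : 2 ≤ r) (hs : 0 < s) :
    ENNReal.ofReal r * ∫⁻ x in Set.Ioi (0:ℝ),
      (min 1 (ENNReal.ofReal ((s ^ 2 / x ^ 2) ^ r))) * ENNReal.ofReal (x ^ (r - 1))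
      ≤ ENNReal.ofReal (2 * s ^ r) := by
  have hsplit : Set.Ioi (0:ℝ) = Set.Ioc 0 s ∪ Set.Ioi s := by
    rw [Set.Ioc_union_Ioi_eq_Ioi hs.le]
  have hA : ∫⁻ x in Set.Ioc (0:ℝ) s,
      (min 1 (ENNReal.ofReal ((s ^ 2 / x ^ 2) ^ r))) * ENNReal.ofReal (x ^ (r - 1))
      ≤ ENNReal.ofReal (s ^ r / r) := by
    calc _ ≤ ∫⁻ x in Set.Ioc (0:ℝ) s, ENNReal.ofReal (x ^ (r - 1)) := by
          apply lintegral_mono; intro x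
          exact (mul_le_mul_left (min_le_left _ _) _).trans (by rw [one_mul])
      _ = ENNReal.ofReal (∫ x in Set.Ioc (0:ℝ) s, x ^ (r - 1)) := by
          rw [ofReal_integral_eq_lintegral_ofReal]
          · exact (intervalIntegral.intervalIntegrable_rpow' (by linarith)).1
          · filter_upwards [ae_restrict_mem measurableSet_Ioc] with x hx
            exact Real.rpow_nonneg hx.1.le _
      _ ≤ _ := by
          apply ENNReal.ofReal_le_ofReal
          rw [← intervalIntegral.integral_of_le hs.le, integral_rpow (by left; linarith)]
          rw [Real.zero_rpow (by linarith)]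
          simp
  have hB : ∫⁻ x in Set.Ioi s,
      (min 1 (ENNReal.ofReal ((s ^ 2 / x ^ 2) ^ r))) * ENNReal.ofReal (x ^ (r - 1))
      ≤ ENNReal.ofReal (s ^ r / r) := by
    calc _ ≤ ∫⁻ x in Set.Ioi s, ENNReal.ofReal (s ^ (2 * r) * x ^ (-r - 1)) := by
          apply setLIntegral_mono' measurableSet_Ioi
          intro x hx
          have hx0 : 0 < x := hs.trans hx
          refine (mul_le_mul_left (min_le_right _ _) _).trans ?_
          rw [← ENNReal.ofReal_mul (by positivity)]
          apply ENNReal.ofReal_le_ofReal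
          apply le_of_eq
          rw [Real.div_rpow (by positivity) (by positivity), ← Real.rpow_natCast, ← Real.rpow_natCast,
            ← Real.rpow_mul hs.le, ← Real.rpow_mul hx0.le, div_mul_eq_mul_div, mul_div_assoc,
            ← Real.rpow_sub hx0]
          push_cast
          congr 2; ring
      _ = ENNReal.ofReal (∫ x in Set.Ioi s, s ^ (2 * r) * x ^ (-r - 1)) := by
          rw [ofReal_integral_eq_lintegral_ofReal]
          · exact (integrableOn_Ioi_rpow_of_lt (by linarith) hs).const_mul _
          · filter_upwards [ae_restrict_mem measurableSet_Ioi] with x hx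
            have hx0 : 0 < x := hs.trans hx
            positivity
      _ ≤ _ := by
          apply ENNReal.ofReal_le_ofReal
          rw [integral_const_mul, integral_Ioi_rpow_of_lt (by linarith) hs]
          apply le_of_eq
          have : s ^ (2 * r) = s ^ r * s ^ r := by rw [← Real.rpow_add hs]; congr 1; ring
          have h2 : s ^ r * s ^ (-r) = 1 := by rw [← Real.rpow_add hs]; simp
          have h3 : -r - 1 + 1 = -r := by ring
          rw [h3, this, neg_div_neg_eq]
          calc _ = s ^ r * (s ^ r * s ^ (-r)) / r := by ring
            _ = _ := by rw [h2, mul_one]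
  calc _ ≤ ENNReal.ofReal r * (ENNReal.ofReal (s ^ r / r) + ENNReal.ofReal (s ^ r / r)) := by
        gcongr
        rw [hsplit]
        exact (lintegral_union_le _ _ _).trans (add_le_add hA hB)
    _ = _ := by
        rw [← ENNReal.ofReal_add (by positivity) (by positivity), ← ENNReal.ofReal_mul (by linarith)]
        congr 1
        field_simp; ring

/-- moment facts -/
lemma erc_moments {Ω : Type*} [MeasurableSpace Ω] (μ : Measure Ω) [IsProbabilityMeasure μ]
    (S : Ω → ℝ) (hSmeas : Measurable S) (hSnn : ∀ᵐ ω ∂μ, 0 ≤ S ω)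
    (hES : ∫ ω, S ω ∂μ = 1)
    (r : ℝ) (hr : 2 ≤ r)
    (hSr : Integrable (fun ω => S ω ^ r) μ) :
    Integrable S μ ∧ Integrable (fun ω => S ω ^ 2) μ ∧ 1 ≤ ∫ ω, S ω ^ 2 ∂μ ∧
      (∫ ω, S ω ^ 2 ∂μ) ^ (r / 2) ≤ ∫ ω, S ω ^ r ∂μ ∧ 1 ≤ ∫ ω, S ω ^ r ∂μ := by
  have hS1 : Integrable S μ := by
    by_contra h
    rw [integral_undef h] at hES
    exact zero_ne_one hES
  have hS2 : Integrable (fun ω => S ω ^ 2) μ := by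
    refine Integrable.mono' ((integrable_const (1:ℝ)).add hSr) (by fun_prop) ?_
    filter_upwards [hSnn] with ω hω
    rw [Real.norm_of_nonneg (by positivity)]
    simp only [Pi.add_apply]
    rcases le_total (S ω) 1 with h | h
    · have : 0 ≤ S ω ^ r := Real.rpow_nonneg hω _
      nlinarith
    · have : S ω ^ (2:ℝ) ≤ S ω ^ r := Real.rpow_le_rpow_of_exponent_le h hr
      rw [Real.rpow_two] at this
      linarith
  have hm2 : 1 ≤ ∫ ω, S ω ^ 2 ∂μ := by
    have : ∫ ω, (2 * S ω - 1) ∂μ ≤ ∫ ω, S ω ^ 2 ∂μ := by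
      apply integral_mono ((hS1.const_mul 2).sub (integrable_const 1)) hS2
      intro ω
      simp only [Pi.sub_apply]
      nlinarith [sq_nonneg (S ω - 1)]
    rw [integral_sub (hS1.const_mul 2) (integrable_const 1), integral_const_mul, hES] at this
    simp at this
    linarith
  have hae : (fun ω => (S ω ^ 2) ^ (r / 2)) =ᵐ[μ] fun ω => S ω ^ r := by
    filter_upwards [hSnn] with ω hω
    rw [← Real.rpow_two, ← Real.rpow_mul hω]
    congr 1; ring
  have hJ : (∫ ω, S ω ^ 2 ∂μ) ^ (r / 2) ≤ ∫ ω, S ω ^ r ∂μ := by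
    rw [← integral_congr_ae hae]
    exact (convexOn_rpow (p := r / 2) (by linarith)).map_integral_le
      (Real.continuous_rpow_const (by linarith)).continuousOn isClosed_Ici
      (Filter.Eventually.of_forall fun ω => by simp only [Set.mem_Ici]; positivity) hS2
      ((integrable_congr hae).2 hSr)
  exact ⟨hS1, hS2, hm2, hJ, le_trans (Real.one_le_rpow hm2 (by linarith)) hJ⟩

lemma erc_exp_integrable {Ω : Type*} [MeasurableSpace Ω] (μ : Measure Ω) [IsProbabilityMeasure μ]
    (S : Ω → ℝ) (hSmeas : Measurable S) (hSnn : ∀ᵐ ω ∂μ, 0 ≤ S ω) (θ : ℝ) (hθ : 0 ≤ θ) :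
    Integrable (fun ω => Real.exp (-θ * S ω)) μ := by
  refine Integrable.mono' (integrable_const (1:ℝ)) (by fun_prop) ?_
  filter_upwards [hSnn] with ω hω
  rw [Real.norm_of_nonneg (Real.exp_pos _).le]
  apply Real.exp_le_one_iff.2
  nlinarith [mul_nonneg hθ hω]

lemma erc_p {Ω : Type*} [MeasurableSpace Ω] (μ : Measure Ω) [IsProbabilityMeasure μ]
    (S : Ω → ℝ) (hSmeas : Measurable S) (hSnn : ∀ᵐ ω ∂μ, 0 ≤ S ω)
    (hES : ∫ ω, S ω ∂μ = 1) (hS1 : Integrable S μ) (θ : ℝ) (hθ : 0 < θ) :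
    0 < 1 - ∫ ω, Real.exp (-θ * S ω) ∂μ ∧ 1 - ∫ ω, Real.exp (-θ * S ω) ∂μ ≤ 1 ∧
    1 - ∫ ω, Real.exp (-θ * S ω) ∂μ ≤ θ := by
  have hI := erc_exp_integrable μ S hSmeas hSnn θ hθ.le
  have h0 : 0 ≤ ∫ ω, Real.exp (-θ * S ω) ∂μ := integral_nonneg fun ω => (Real.exp_pos _).le
  have heq : 1 - ∫ ω, Real.exp (-θ * S ω) ∂μ = ∫ ω, (1 - Real.exp (-θ * S ω)) ∂μ := by
    rw [integral_sub (integrable_const 1) hI]; simp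
  refine ⟨?_, by linarith, ?_⟩
  · rw [heq]
    have hnn : 0 ≤ᵐ[μ] fun ω => 1 - Real.exp (-θ * S ω) := by
      filter_upwards [hSnn] with ω hω
      have : Real.exp (-θ * S ω) ≤ 1 := Real.exp_le_one_iff.2 (by nlinarith [mul_nonneg hθ.le hω])
      simpa using this
    refine lt_of_le_of_ne (integral_nonneg_of_ae hnn) (fun h => ?_)
    have h2 := (integral_eq_zero_iff_of_nonneg_ae hnn ((integrable_const 1).sub hI)).1 h.symm
    have h3 : S =ᵐ[μ] fun _ => (0:ℝ) := by
      filter_upwards [h2] with ω hω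
      simp only [Pi.zero_apply] at hω
      have : Real.exp (-θ * S ω) = 1 := by linarith
      rw [Real.exp_eq_one_iff] at this
      have := mul_eq_zero.1 this
      rcases this with h | h
      · linarith
      · exact h
    rw [integral_congr_ae h3] at hES
    simp at hES
  · rw [heq]
    calc _ ≤ ∫ ω, θ * S ω ∂μ := by
          apply integral_mono ((integrable_const 1).sub hI) (hS1.const_mul _)
          intro ω
          have := Real.add_one_le_exp (-θ * S ω)
          simp only [Pi.sub_apply]; linarith
      _ = θ := by rw [integral_const_mul, hES, mul_one]

/-- bound on the equilibrium tail -/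
lemma erc_eq_tail {Ω : Type*} [MeasurableSpace Ω] (μ : Measure Ω) [IsProbabilityMeasure μ]
    (S : Ω → ℝ) (hSmeas : Measurable S) (hSnn : ∀ᵐ ω ∂μ, 0 ≤ S ω)
    (r : ℝ) (hr : 2 ≤ r)
    (hSr : Integrable (fun ω => S ω ^ r) μ) (η0 : Ω → ℝ)
    (heq : ∀ y : ℝ, 0 ≤ y →
      (μ {ω | y < η0 ω}).toReal = ∫ z in Set.Ioi y, (μ {ω | z < S ω}).toReal)
    (y : ℝ) (hy : 0 < y) :
    μ {ω | y < η0 ω} ≤ ENNReal.ofReal ((∫ ω, S ω ^ r ∂μ) * y ^ (1 - r)) := by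
  have hM : ∫⁻ ω, ENNReal.ofReal (S ω ^ r) ∂μ = ENNReal.ofReal (∫ ω, S ω ^ r ∂μ) := by
    rw [ofReal_integral_eq_lintegral_ofReal hSr]
    filter_upwards [hSnn] with ω hω using Real.rpow_nonneg hω _
  have hlc := lintegral_rpow_eq_lintegral_meas_lt_mul μ (f := S) hSnn hSmeas.aemeasurable
    (p := r) (by linarith)
  rw [hM] at hlc
  have hanti : Antitone (fun z : ℝ => μ {ω | z < S ω}) := fun a b hab =>
    measure_mono fun ω (h : b < S ω) => lt_of_le_of_lt hab h
  have h1 : ∫⁻ z in Set.Ioi y, μ {ω | z < S ω}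
      ≤ ENNReal.ofReal ((∫ ω, S ω ^ r ∂μ) * y ^ (1 - r)) := by
    calc _ ≤ ∫⁻ z in Set.Ioi y, ENNReal.ofReal (y ^ (1 - r)) *
            (μ {ω | z < S ω} * ENNReal.ofReal (z ^ (r - 1))) := by
          apply setLIntegral_mono' measurableSet_Ioi
          intro z hz
          have hz0 : 0 < z := hy.trans hz
          have h : 1 ≤ ENNReal.ofReal (y ^ (1 - r)) * ENNReal.ofReal (z ^ (r - 1)) := by
            rw [← ENNReal.ofReal_mul (by positivity), ← ENNReal.ofReal_one]
            apply ENNReal.ofReal_le_ofReal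
            have : y ^ (1 - r) = (y ^ (r - 1))⁻¹ := by
              rw [← Real.rpow_neg hy.le]; congr 1; ring
            rw [this, inv_mul_eq_div, one_le_div (by positivity)]
            exact Real.rpow_le_rpow hy.le (le_of_lt hz) (by linarith)
          calc μ {ω | z < S ω} = μ {ω | z < S ω} * 1 := by rw [mul_one]
            _ ≤ μ {ω | z < S ω} * (ENNReal.ofReal (y ^ (1 - r)) * ENNReal.ofReal (z ^ (r - 1))) := by
              gcongr
            _ = _ := by ring
      _ = ENNReal.ofReal (y ^ (1 - r)) * ∫⁻ z in Set.Ioi y,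
            (μ {ω | z < S ω} * ENNReal.ofReal (z ^ (r - 1))) := by
          rw [lintegral_const_mul' _ _ ENNReal.ofReal_ne_top]
      _ ≤ ENNReal.ofReal (y ^ (1 - r)) * ∫⁻ z in Set.Ioi 0,
            (μ {ω | z < S ω} * ENNReal.ofReal (z ^ (r - 1))) := by
          gcongr
      _ ≤ ENNReal.ofReal (y ^ (1 - r)) * (ENNReal.ofReal r * ∫⁻ z in Set.Ioi 0,
            (μ {ω | z < S ω} * ENNReal.ofReal (z ^ (r - 1)))) := by
          gcongr
          nth_rewrite 1 [← one_mul (∫⁻ z in Set.Ioi 0, _)]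
          gcongr
          rw [← ENNReal.ofReal_one]
          exact ENNReal.ofReal_le_ofReal (by linarith)
      _ = _ := by
          rw [← hlc, ← ENNReal.ofReal_mul (by positivity), mul_comm]
  have h2 := heq y hy.le
  rw [integral_toReal hanti.measurable.aemeasurable
    (Filter.Eventually.of_forall fun z => measure_lt_top _ _)] at h2
  have h3 : ∫⁻ z in Set.Ioi y, μ {ω | z < S ω} ≠ ⊤ := ne_top_of_le_ne_top ENNReal.ofReal_ne_top h1
  rw [(ENNReal.toReal_eq_toReal_iff' (measure_ne_top _ _) h3).1 h2]
  exact h1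

lemma erc_int_quad {Ω : Type*} [MeasurableSpace Ω] (μ : Measure Ω) [IsProbabilityMeasure μ]
    (S : Ω → ℝ) (hES : ∫ ω, S ω ∂μ = 1) (hS1 : Integrable S μ)
    (hS2 : Integrable (fun ω => S ω ^ 2) μ) (a b : ℝ) :
    ∫ ω, (1 + a * S ω + b * S ω ^ 2) ∂μ = 1 + a + b * ∫ ω, S ω ^ 2 ∂μ := by
  have h1 : Integrable (fun ω => 1 + a * S ω) μ := (integrable_const 1).add (hS1.const_mul a)
  rw [integral_add h1 (hS2.const_mul b), integral_add (integrable_const 1) (hS1.const_mul a),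
    integral_const_mul, integral_const_mul, hES]
  simp

lemma erc_upper1 {Ω : Type*} [MeasurableSpace Ω] (μ : Measure Ω) [IsProbabilityMeasure μ]
    (S : Ω → ℝ) (hSmeas : Measurable S) (hSnn : ∀ᵐ ω ∂μ, 0 ≤ S ω)
    (hES : ∫ ω, S ω ∂μ = 1) (hS1 : Integrable S μ) (hS2 : Integrable (fun ω => S ω ^ 2) μ)
    (η : ℕ → Ω → ℝ) (hmeas : ∀ j, Measurable (η j)) (hindep : iIndepFun η μ)
    (hlaw : ∀ j, μ.map (η (j + 1)) = μ.map S)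
    (m : ℕ) (u B : ℝ) (hu : 0 ≤ u) (hB : 0 < B) (hmB : m * (∫ ω, S ω ^ 2 ∂μ) ≤ B) :
    μ {ω | ∑ i ∈ Finset.range m, η (i + 1) ω ≤ m - u}
      ≤ ENNReal.ofReal (Real.exp (-(u ^ 2 / (4 * B)))) := by
  set m2 := ∫ ω, S ω ^ 2 ∂μ with hm2
  set l := u / (2 * B) with hl
  have hl0 : 0 ≤ l := by positivity
  have hI := erc_exp_integrable μ S hSmeas hSnn l hl0
  have hc : ∫ ω, Real.exp (-l * S ω) ∂μ ≤ Real.exp (-l + l ^ 2 * m2) := by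
    calc _ ≤ ∫ ω, (1 - l * S ω + l ^ 2 * S ω ^ 2) ∂μ := by
          apply integral_mono_ae hI
            (((integrable_const 1).sub (hS1.const_mul l)).add (hS2.const_mul (l ^ 2)))
          filter_upwards [hSnn] with ω hω
          have := erc_exp_lower (mul_nonneg hl0 hω)
          rw [mul_pow] at this
          simpa [neg_mul] using this
      _ = 1 - l + l ^ 2 * m2 := by
          have h := erc_int_quad μ S hES hS1 hS2 (-l) (l ^ 2)
          simp only [neg_mul, ← sub_eq_add_neg] at h
          exact h
      _ ≤ _ := by linarith [Real.add_one_le_exp (-l + l ^ 2 * m2)]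
  have h := erc_chernoff μ S hSmeas η hmeas hindep hlaw (fun s => -l * s) (by fun_prop) hI _ hc m
    (-l * (m - u))
  refine (measure_mono ?_).trans (h.trans (ENNReal.ofReal_le_ofReal (Real.exp_le_exp.2 ?_)))
  · intro ω hω
    simp only [Set.mem_ofPred_eq] at hω ⊢
    rw [← Finset.mul_sum]
    nlinarith
  · have h1 : l ^ 2 * (m * m2) ≤ l ^ 2 * B := by gcongr
    have h2 : l ^ 2 * B - l * u = -(u ^ 2 / (4 * B)) := by
      rw [hl]; field_simp; ring
    nlinarith

lemma erc_upper2 {Ω : Type*} [MeasurableSpace Ω] (μ : Measure Ω) [IsProbabilityMeasure μ]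
    (S : Ω → ℝ) (hSmeas : Measurable S) (hSnn : ∀ᵐ ω ∂μ, 0 ≤ S ω)
    (η : ℕ → Ω → ℝ) (hmeas : ∀ j, Measurable (η j)) (hindep : iIndepFun η μ)
    (hlaw : ∀ j, μ.map (η (j + 1)) = μ.map S)
    (m : ℕ) (t θ : ℝ) (hθ : 0 < θ) :
    μ {ω | ∑ i ∈ Finset.range m, η (i + 1) ω ≤ t}
      ≤ ENNReal.ofReal (Real.exp (θ * t - m * (1 - ∫ ω, Real.exp (-θ * S ω) ∂μ))) := by
  have hI := erc_exp_integrable μ S hSmeas hSnn θ hθ.le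
  have h := erc_chernoff μ S hSmeas η hmeas hindep hlaw (fun s => -θ * s) (by fun_prop) hI
    (-(1 - ∫ ω, Real.exp (-θ * S ω) ∂μ))
    (by linarith [Real.add_one_le_exp (-(1 - ∫ ω, Real.exp (-θ * S ω) ∂μ))]) m (-θ * t)
  refine (measure_mono ?_).trans (h.trans (ENNReal.ofReal_le_ofReal (Real.exp_le_exp.2 ?_)))
  · intro ω hω
    simp only [Set.mem_ofPred_eq] at hω ⊢
    rw [← Finset.mul_sum]
    nlinarith
  · linarith

lemma erc_upper {Ω : Type*} [MeasurableSpace Ω] (μ : Measure Ω) [IsProbabilityMeasure μ]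
    (S : Ω → ℝ) (hSmeas : Measurable S) (hSnn : ∀ᵐ ω ∂μ, 0 ≤ S ω)
    (hES : ∫ ω, S ω ∂μ = 1) (hS1 : Integrable S μ) (hS2 : Integrable (fun ω => S ω ^ 2) μ)
    (η : ℕ → Ω → ℝ) (hmeas : ∀ j, Measurable (η j)) (hindep : iIndepFun η μ)
    (hlaw : ∀ j, μ.map (η (j + 1)) = μ.map S)
    (r : ℝ) (hr : 2 ≤ r) (t θ p m2 : ℝ) (ht : 1 ≤ t) (hθ : 0 < θ)
    (hp : p = 1 - ∫ ω, Real.exp (-θ * S ω) ∂μ) (hp0 : 0 < p) (hpθ : p ≤ θ)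
    (hm2 : m2 = ∫ ω, S ω ^ 2 ∂μ) (hm21 : 1 ≤ m2) (x : ℝ) (hx : 0 < x) :
    μ {ω | ∑ i ∈ Finset.range ⌊t + x⌋₊, η (i + 1) ω ≤ t}
      ≤ min 1 (ENNReal.ofReal (((64 * θ * r * t * m2 / p) / x ^ 2) ^ r))
        + min 1 (ENNReal.ofReal (((16 * r ^ 2 / p ^ 2) / x ^ 2) ^ r)) := by
  set m := ⌊t + x⌋₊ with hm
  have hmle : (m:ℝ) ≤ t + x := Nat.floor_le (by linarith)
  have hmgt : t + x < m + 1 := Nat.lt_floor_add_one _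
  have hA : 1 ≤ θ / p := by rw [one_le_div hp0]; exact hpθ
  by_cases hxt : x ≤ 2 * θ / p * t
  · refine le_trans ?_ le_self_add
    refine le_min prob_le_one ?_
    have hD : 64 * θ * r * t * m2 / p = 64 * r * (θ / p) * (t * m2) := by field_simp
    have htm : 1 ≤ t * m2 := by nlinarith
    have hD128 : 128 ≤ 64 * θ * r * t * m2 / p := by
      rw [hD]
      have : 2 ≤ r * (θ / p) := by nlinarith
      nlinarith
    by_cases hx2 : x ≤ 2
    · refine prob_le_one.trans ?_
      rw [← ENNReal.ofReal_one]
      apply ENNReal.ofReal_le_ofReal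
      apply Real.one_le_rpow _ (by linarith)
      rw [one_le_div (by positivity)]
      nlinarith
    · push Not at hx2
      set B := 4 * (θ / p) * (t * m2) with hB
      have hB0 : 0 < B := by positivity
      have hmB : m * (∫ ω, S ω ^ 2 ∂μ) ≤ B := by
        rw [← hm2]
        have : (m:ℝ) ≤ 4 * (θ / p) * t := by
          have h2 : 2 * θ / p * t = 2 * ((θ / p) * t) := by ring
          have h3 : t ≤ (θ / p) * t := by nlinarith
          nlinarith
        rw [hB, ← mul_assoc]
        gcongr
      have h := erc_upper1 μ S hSmeas hSnn hES hS1 hS2 η hmeas hindep hlaw m (x / 2) B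
        (by positivity) hB0 hmB
      refine (measure_mono ?_).trans (h.trans (ENNReal.ofReal_le_ofReal ?_))
      · intro ω hω
        simp only [Set.mem_ofPred_eq] at hω ⊢
        linarith
      · refine (erc_exp_neg_le (k := r) (by positivity) (by linarith)).trans (le_of_eq ?_)
        congr 1
        rw [hB, hD]
        field_simp
        ring
  · push Not at hxt
    refine le_trans ?_ le_add_self
    refine le_min prob_le_one ?_
    have h := erc_upper2 μ S hSmeas hSnn η hmeas hindep hlaw m t θ hθ
    refine h.trans (ENNReal.ofReal_le_ofReal ?_)
    rw [← hp]
    have h1 : θ * t - m * p ≤ -(p * x / 2) := by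
      have : 2 * θ * t < p * x := by
        have := mul_lt_mul_of_pos_left hxt hp0
        have h2 : p * (2 * θ / p * t) = 2 * θ * t := by field_simp
        linarith
      have : x * p ≤ m * p := by gcongr; linarith
      nlinarith
    refine (Real.exp_le_exp.2 h1).trans ?_
    refine (erc_exp_neg_le (k := 2 * r) (by positivity) (by linarith)).trans (le_of_eq ?_)
    rw [Real.rpow_mul (by positivity), Real.rpow_two]
    congr 1
    field_simp
    ring

lemma erc_lower {Ω : Type*} [MeasurableSpace Ω] (μ : Measure Ω) [IsProbabilityMeasure μ]
    (S : Ω → ℝ) (hSmeas : Measurable S) (hSnn : ∀ᵐ ω ∂μ, 0 ≤ S ω)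
    (hES : ∫ ω, S ω ∂μ = 1) (hS1 : Integrable S μ) (hS2 : Integrable (fun ω => S ω ^ 2) μ)
    (η : ℕ → Ω → ℝ) (hmeas : ∀ j, Measurable (η j)) (hindep : iIndepFun η μ)
    (hlaw : ∀ j, μ.map (η (j + 1)) = μ.map S)
    (r : ℝ) (hr : 2 ≤ r) (t m2 : ℝ) (ht : 1 ≤ t)
    (hm2 : m2 = ∫ ω, S ω ^ 2 ∂μ) (hm21 : 1 ≤ m2) (x : ℝ) (hx : 0 < x) (n : ℕ) (hn : n ≤ t) :
    μ {ω | n + x / 2 < ∑ i ∈ Finset.range n, η (i + 1) ω}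
      ≤ ENNReal.ofReal t * μ {ω | x < 4 * r * S ω}
        + min 1 (ENNReal.ofReal (((48 * r ^ 2 * t * m2) / x ^ 2) ^ r)) := by
  set y := x / (4 * r) with hy
  have hy0 : 0 < y := by positivity
  set q := t * m2 / y ^ 2 with hq
  have hq0 : 0 < q := by positivity
  have hDq : (48 * r ^ 2 * t * m2) / x ^ 2 = 3 * q := by
    rw [hq, hy]; field_simp; ring
  rw [hDq]
  by_cases hq1 : 1 ≤ q
  · have : min 1 (ENNReal.ofReal ((3 * q) ^ r)) = 1 := by
      apply min_eq_left
      rw [← ENNReal.ofReal_one]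
      apply ENNReal.ofReal_le_ofReal
      exact Real.one_le_rpow (by linarith) (by linarith)
    rw [this]
    exact prob_le_one.trans le_add_self
  push Not at hq1
  set v := -(Real.log q) / 2 with hv
  have hv0 : 0 < v := by
    have := Real.log_neg hq0 hq1
    rw [hv]; linarith
  have hqv : q = Real.exp (-2 * v) := by
    rw [hv]; ring_nf; rw [Real.exp_log hq0]
  set l := v / y with hl
  have hl0 : 0 < l := by positivity
  have hly : l * y = v := by rw [hl]; field_simp
  have hIb : ∀ ω, Real.exp (l * min (S ω) y) ≤ Real.exp v := fun ω => by
    apply Real.exp_le_exp.2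
    rw [← hly]
    gcongr
    exact min_le_right _ _
  have hI : Integrable (fun ω => Real.exp (l * min (S ω) y)) μ := by
    refine Integrable.mono' (integrable_const (Real.exp v)) (by fun_prop) ?_
    filter_upwards with ω
    rw [Real.norm_of_nonneg (Real.exp_pos _).le]
    exact hIb ω
  have hc : ∫ ω, Real.exp (l * min (S ω) y) ∂μ ≤ Real.exp (l + l ^ 2 * Real.exp v * m2) := by
    calc _ ≤ ∫ ω, (1 + l * S ω + l ^ 2 * Real.exp v * S ω ^ 2) ∂μ := by
          apply integral_mono_ae hI
            (((integrable_const 1).add (hS1.const_mul l)).add (hS2.const_mul (l ^ 2 * Real.exp v)))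
          filter_upwards [hSnn] with ω hω
          have hmin0 : 0 ≤ min (S ω) y := le_min hω hy0.le
          have hmv : l * min (S ω) y ≤ v := by
            rw [← hly]
            gcongr
            exact min_le_right _ _
          have h1 := erc_exp_upper (mul_nonneg hl0.le hmin0) hmv
          have h2 : l * min (S ω) y ≤ l * S ω := by
            gcongr
            exact min_le_left _ _
          have h3 : (l * min (S ω) y) ^ 2 * Real.exp v ≤ l ^ 2 * Real.exp v * S ω ^ 2 := by
            calc _ ≤ (l * S ω) ^ 2 * Real.exp v := by gcongr
              _ = _ := by ring
          simp only [Pi.add_apply]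
          linarith
      _ = 1 + l + l ^ 2 * Real.exp v * m2 := by
          rw [hm2]
          exact erc_int_quad μ S hES hS1 hS2 l _
      _ ≤ _ := by linarith [Real.add_one_le_exp (l + l ^ 2 * Real.exp v * m2)]
  have h := erc_chernoff μ S hSmeas η hmeas hindep hlaw (fun s => l * min s y) (by fun_prop) hI _ hc n
    (l * (n + x / 2))
  have hsub : {ω | n + x / 2 < ∑ i ∈ Finset.range n, η (i + 1) ω} ⊆
      (⋃ i ∈ Finset.range n, {ω | y < η (i + 1) ω}) ∪
        {ω | l * (n + x / 2) ≤ ∑ i ∈ Finset.range n, l * min (η (i + 1) ω) y} := by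
    intro ω hω
    by_cases hex : ∃ i ∈ Finset.range n, y < η (i + 1) ω
    · left
      simpa using hex
    · right
      push Not at hex
      simp only [Set.mem_ofPred_eq] at hω ⊢
      rw [← Finset.mul_sum]
      gcongr
      refine hω.le.trans (le_of_eq ?_)
      exact Finset.sum_congr rfl fun i hi => (min_eq_left (hex i hi)).symm
  refine (measure_mono hsub).trans ((measure_union_le _ _).trans (add_le_add ?_ ?_))
  · refine (measure_biUnion_finset_le _ _).trans ?_
    have hS : ∀ i, μ {ω | y < η (i + 1) ω} = μ {ω | x < 4 * r * S ω} := fun i => by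
      have h1 : μ {ω | y < η (i + 1) ω} = μ.map (η (i + 1)) (Set.Ioi y) := by
        rw [Measure.map_apply (hmeas _) measurableSet_Ioi]; rfl
      rw [h1, hlaw, Measure.map_apply hSmeas measurableSet_Ioi]
      congr 1
      ext ω
      simp only [Set.mem_preimage, Set.mem_Ioi, Set.mem_ofPred_eq]
      rw [hy, div_lt_iff₀ (by positivity), mul_comm]
    simp only [hS, Finset.sum_const, Finset.card_range, nsmul_eq_mul]
    gcongr
    rw [← ENNReal.ofReal_natCast]
    exact ENNReal.ofReal_le_ofReal hn
  · refine le_min prob_le_one (h.trans (ENNReal.ofReal_le_ofReal ?_))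
    have h1 : l * (x / 2) = 2 * r * v := by
      rw [hl, hy]; field_simp; ring
    have h2 : n * (l ^ 2 * Real.exp v * m2) ≤ 2 := by
      calc n * (l ^ 2 * Real.exp v * m2) ≤ t * (l ^ 2 * Real.exp v * m2) := by gcongr
        _ = q * v ^ 2 * Real.exp v := by rw [hl, hq]; field_simp
        _ = v ^ 2 * Real.exp (-v) := by
            rw [hqv]
            have : Real.exp (-2 * v) * Real.exp v = Real.exp (-v) := by
              rw [← Real.exp_add]; congr 1; ring
            rw [← this]; ring
        _ ≤ 2 := by
            have := Real.quadratic_le_exp_of_nonneg hv0.le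
            rw [Real.exp_neg, ← div_eq_mul_inv, div_le_iff₀ (Real.exp_pos _)]
            nlinarith
    have h3 : -(l * (n + x / 2)) + n * (l + l ^ 2 * Real.exp v * m2) ≤ r + (-2 * v) * r := by
      nlinarith
    refine (Real.exp_le_exp.2 h3).trans ?_
    rw [Real.exp_add, Real.exp_mul, ← hqv, Real.mul_rpow (by norm_num) hq0.le]
    gcongr
    rw [← Real.exp_one_rpow]
    apply Real.rpow_le_rpow (Real.exp_pos _).le _ (by linarith)
    linarith [Real.exp_one_lt_d9]

lemma erc_det_upper (ξ : ℕ → ℝ) (hξ : ∀ j, 0 ≤ ξ j) (t x : ℝ) (ht : 1 ≤ t) (hx : 0 < x)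
    (h : t + x < renewalCount ξ t) :
    ∑ i ∈ Finset.range ⌊t + x⌋₊, ξ (i + 1) ≤ t := by
  have hne : {n : ℕ | ∑ i ∈ Finset.range n, ξ i ≤ t}.Nonempty := ⟨0, by simp; linarith⟩
  have hbdd : BddAbove {n : ℕ | ∑ i ∈ Finset.range n, ξ i ≤ t} := by
    by_contra hb
    have : renewalCount ξ t = 0 := by
      unfold renewalCount
      rw [csSup_of_not_bddAbove hb]; simp
    rw [this] at h
    push_cast at h
    linarith
  have hmem : ∑ i ∈ Finset.range (renewalCount ξ t), ξ i ≤ t := Nat.sSup_mem hne hbdd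
  have hlt : ⌊t + x⌋₊ < renewalCount ξ t := (Nat.floor_lt (by linarith)).2 h
  have h1 : ∑ i ∈ Finset.range (⌊t + x⌋₊ + 1), ξ i ≤ ∑ i ∈ Finset.range (renewalCount ξ t), ξ i :=
    Finset.sum_le_sum_of_subset_of_nonneg (Finset.range_mono hlt) (fun i _ _ => hξ i)
  rw [Finset.sum_range_succ'] at h1
  linarith [hξ 0]

lemma erc_det_lower (ξ : ℕ → ℝ) (t x : ℝ)
    (hbdd : BddAbove {n : ℕ | ∑ i ∈ Finset.range n, ξ i ≤ t})
    (h : (renewalCount ξ t : ℝ) < t - x) :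
    t < ∑ i ∈ Finset.range ⌊t - x⌋₊, ξ (i + 1) + ξ 0 := by
  by_contra hcon
  push Not at hcon
  rw [← Finset.sum_range_succ'] at hcon
  have h1 : ⌊t - x⌋₊ + 1 ≤ renewalCount ξ t := le_csSup hbdd hcon
  have h2 : (⌊t - x⌋₊ + 1 : ℝ) ≤ renewalCount ξ t := by exact_mod_cast h1
  linarith [Nat.lt_floor_add_one (t - x)]

lemma erc_ae_bdd {Ω : Type*} [MeasurableSpace Ω] (μ : Measure Ω) [IsProbabilityMeasure μ]
    (S : Ω → ℝ) (hSmeas : Measurable S) (hSnn : ∀ᵐ ω ∂μ, 0 ≤ S ω)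
    (hES : ∫ ω, S ω ∂μ = 1) (hS1 : Integrable S μ)
    (η : ℕ → Ω → ℝ) (hmeas : ∀ j, Measurable (η j)) (hnn : ∀ j, ∀ᵐ ω ∂μ, 0 ≤ η j ω)
    (hindep : iIndepFun η μ)
    (hlaw : ∀ j, μ.map (η (j + 1)) = μ.map S) (t : ℝ) :
    ∀ᵐ ω ∂μ, BddAbove {n : ℕ | ∑ i ∈ Finset.range n, η i ω ≤ t} := by
  obtain ⟨hp0, -, -⟩ := erc_p μ S hSmeas hSnn hES hS1 1 one_pos
  set p := 1 - ∫ ω, Real.exp (-1 * S ω) ∂μ with hp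
  have h0 : μ {ω | ∀ n : ℕ, ∑ i ∈ Finset.range n, η (i + 1) ω ≤ t} = 0 := by
    have hle : ∀ n : ℕ, μ {ω | ∀ n : ℕ, ∑ i ∈ Finset.range n, η (i + 1) ω ≤ t}
        ≤ ENNReal.ofReal (Real.exp (1 * t - n * p)) := fun n =>
      (measure_mono (Set.ofPred_subset_ofPred.2 fun ω hω => hω n)).trans
        (erc_upper2 μ S hSmeas hSnn η hmeas hindep hlaw n t 1 one_pos)
    have hlim : Filter.Tendsto (fun n : ℕ => ENNReal.ofReal (Real.exp (1 * t - n * p)))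
        Filter.atTop (nhds 0) := by
      rw [← ENNReal.ofReal_zero]
      apply (ENNReal.continuous_ofReal.tendsto 0).comp
      apply Real.tendsto_exp_atBot.comp
      apply Filter.tendsto_atBot_add_const_left
      apply Filter.tendsto_neg_atTop_atBot.comp
      exact tendsto_natCast_atTop_atTop.atTop_mul_const hp0
    exact le_antisymm (ge_of_tendsto' hlim hle) (zero_le)
  have h1 : ∀ᵐ ω ∂μ, ¬ ∀ n : ℕ, ∑ i ∈ Finset.range n, η (i + 1) ω ≤ t := by
    rw [ae_iff]; simpa only [not_not] using h0
  filter_upwards [h1, ae_all_iff.2 hnn] with ω hω hnnω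
  push Not at hω
  obtain ⟨n, hn⟩ := hω
  refine ⟨n + 1, fun k hk => ?_⟩
  by_contra hkn
  push Not at hkn
  have h2 : ∑ i ∈ Finset.range (n + 1), η i ω ≤ ∑ i ∈ Finset.range k, η i ω :=
    Finset.sum_le_sum_of_subset_of_nonneg (Finset.range_mono hkn.le) (fun i _ _ => hnnω i)
  rw [Finset.sum_range_succ'] at h2
  have h3 : ∑ i ∈ Finset.range k, η i ω ≤ t := hk
  linarith [hnnω 0]

lemma erc_measurable {Ω : Type*} [MeasurableSpace Ω] (η : ℕ → Ω → ℝ) (hmeas : ∀ j, Measurable (η j))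
    (t : ℝ) (ht : 1 ≤ t) : Measurable (fun ω => renewalCount (fun j => η j ω) t) := by
  have h : (fun ω => renewalCount (fun j => η j ω) t) =
      fun ω => ⨆ n : ℕ, (if ∑ i ∈ Finset.range n, η i ω ≤ t then n else 0) := by
    funext ω
    unfold renewalCount
    rw [iSup]
    congr 1
    ext k
    simp only [Set.mem_ofPred_eq, Set.mem_range]
    constructor
    · intro hk
      exact ⟨k, if_pos hk⟩
    · rintro ⟨n, hn⟩
      split_ifs at hn with h
      · rw [← hn]; exact h
      · rw [← hn]; simp; linarith
  rw [h]
  apply Measurable.iSup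
  intro n
  apply Measurable.ite _ measurable_const measurable_const
  exact measurableSet_le (by fun_prop) measurable_const

lemma erc_tail {Ω : Type*} [MeasurableSpace Ω] (μ : Measure Ω) [IsProbabilityMeasure μ]
    (S : Ω → ℝ) (hSmeas : Measurable S) (hSnn : ∀ᵐ ω ∂μ, 0 ≤ S ω)
    (hES : ∫ ω, S ω ∂μ = 1) (hS1 : Integrable S μ) (hS2 : Integrable (fun ω => S ω ^ 2) μ)
    (η : ℕ → Ω → ℝ) (hmeas : ∀ j, Measurable (η j)) (hnn : ∀ j, ∀ᵐ ω ∂μ, 0 ≤ η j ω)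
    (hindep : iIndepFun η μ)
    (hlaw : ∀ j, μ.map (η (j + 1)) = μ.map S)
    (r : ℝ) (hr : 2 ≤ r) (hSr : Integrable (fun ω => S ω ^ r) μ)
    (heq : ∀ y : ℝ, 0 ≤ y →
      (μ {ω | y < η 0 ω}).toReal = ∫ z in Set.Ioi y, (μ {ω | z < S ω}).toReal)
    (t θ p m2 : ℝ) (ht : 1 ≤ t) (hθ : 0 < θ)
    (hp : p = 1 - ∫ ω, Real.exp (-θ * S ω) ∂μ) (hp0 : 0 < p) (hpθ : p ≤ θ)
    (hm2 : m2 = ∫ ω, S ω ^ 2 ∂μ) (hm21 : 1 ≤ m2) (x : ℝ) (hx : 0 < x) :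
    μ {ω | x < |(renewalCount (fun j => η j ω) t : ℝ) - t|}
      ≤ (Set.Ioc 0 t).indicator
          (fun x => ENNReal.ofReal ((∫ ω, S ω ^ r ∂μ) * (x / 2) ^ (1 - r))) x
        + ENNReal.ofReal t * μ {ω | x < 4 * r * S ω}
        + min 1 (ENNReal.ofReal (((48 * r ^ 2 * t * m2) / x ^ 2) ^ r))
        + min 1 (ENNReal.ofReal (((64 * θ * r * t * m2 / p) / x ^ 2) ^ r))
        + min 1 (ENNReal.ofReal (((16 * r ^ 2 / p ^ 2) / x ^ 2) ^ r)) := by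
  have hU := erc_upper μ S hSmeas hSnn hES hS1 hS2 η hmeas hindep hlaw r hr t θ p m2 ht hθ hp hp0 hpθ
    hm2 hm21 x hx
  have hbdd := erc_ae_bdd μ S hSmeas hSnn hES hS1 η hmeas hnn hindep hlaw t
  by_cases hxt : x < t
  · have hn : (⌊t - x⌋₊ : ℝ) ≤ t - x := Nat.floor_le (by linarith)
    have hL := erc_lower μ S hSmeas hSnn hES hS1 hS2 η hmeas hindep hlaw r hr t m2 ht hm2 hm21 x hx
      ⌊t - x⌋₊ (by linarith)
    have hE := erc_eq_tail μ S hSmeas hSnn r hr hSr (η 0) heq (x / 2) (by linarith)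
    rw [Set.indicator_of_mem (show x ∈ Set.Ioc 0 t from ⟨hx, hxt.le⟩)]
    have hsub : {ω | x < |(renewalCount (fun j => η j ω) t : ℝ) - t|} ≤ᵐ[μ]
        ({ω | x / 2 < η 0 ω} ∪ {ω | ⌊t - x⌋₊ + x / 2 < ∑ i ∈ Finset.range ⌊t - x⌋₊, η (i + 1) ω} ∪
        {ω | ∑ i ∈ Finset.range ⌊t + x⌋₊, η (i + 1) ω ≤ t} : Set Ω) := by
      filter_upwards [hbdd, ae_all_iff.2 hnn] with ω hb hω hmem
      have hmem' : x < |(renewalCount (fun j => η j ω) t : ℝ) - t| := hmem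
      rcases lt_abs.1 hmem' with h | h
      · right
        exact erc_det_upper (fun j => η j ω) hω t x ht hx (by linarith)
      · left
        have h2 := erc_det_lower (fun j => η j ω) t x hb (by linarith)
        by_cases h3 : x / 2 < η 0 ω
        · left; exact h3
        · right
          show ⌊t - x⌋₊ + x / 2 < ∑ i ∈ Finset.range ⌊t - x⌋₊, η (i + 1) ω
          linarith
    refine (measure_mono_ae hsub).trans ((measure_union_le _ _).trans ?_)
    refine (add_le_add ((measure_union_le _ _).trans (add_le_add hE hL)) hU).trans (le_of_eq ?_)
    ring
  · have hsub : {ω | x < |(renewalCount (fun j => η j ω) t : ℝ) - t|} ≤ᵐ[μ]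
        ({ω | ∑ i ∈ Finset.range ⌊t + x⌋₊, η (i + 1) ω ≤ t} : Set Ω) := by
      filter_upwards [ae_all_iff.2 hnn] with ω hω hmem
      have hmem' : x < |(renewalCount (fun j => η j ω) t : ℝ) - t| := hmem
      rcases lt_abs.1 hmem' with h | h
      · exact erc_det_upper (fun j => η j ω) hω t x ht hx (by linarith)
      · exfalso
        have : (0:ℝ) ≤ renewalCount (fun j => η j ω) t := Nat.cast_nonneg _
        linarith
    refine (measure_mono_ae hsub).trans (hU.trans ?_)
    rw [add_assoc _ (min _ _) (min _ _)]
    exact le_add_self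

lemma erc_tail_integral' {r D : ℝ} (hr : 2 ≤ r) (hD : 0 < D) :
    ENNReal.ofReal r * ∫⁻ x in Set.Ioi (0:ℝ),
      (min 1 (ENNReal.ofReal ((D / x ^ 2) ^ r))) * ENNReal.ofReal (x ^ (r - 1))
      ≤ ENNReal.ofReal (2 * D ^ (r / 2)) := by
  have h := erc_tail_integral hr (Real.sqrt_pos.2 hD)
  rw [Real.sq_sqrt hD.le] at h
  have h2 : (√D) ^ r = D ^ (r / 2) := by
    rw [Real.sqrt_eq_rpow, ← Real.rpow_mul hD.le]; congr 1; ring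
  rwa [h2] at h

lemma erc_final {r t θ p m2 M : ℝ} (hr : 2 ≤ r) (ht : 1 ≤ t) (hθ : 0 < θ) (hp0 : 0 < p)
    (hp1 : p ≤ 1) (hm21 : 1 ≤ m2) (hm2M : m2 ^ (r / 2) ≤ M) (hM : 1 ≤ M) :
    r * (M * 2 ^ r * t) + t * ((4 * r) ^ r * M) + 2 * (48 * r ^ 2 * t * m2) ^ (r / 2)
      + 2 * (64 * θ * r * t * m2 / p) ^ (r / 2) + 2 * (16 * r ^ 2 / p ^ 2) ^ (r / 2)
    ≤ M * Real.exp θ * (10 ^ 7 * r ^ 2 / p) ^ (r + 2) * t ^ (r / 2) := by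
  set b := r ^ 2 / p with hb
  have hr0 : 0 < r := by linarith
  have hrb : r / p ≤ b := by rw [hb]; gcongr; nlinarith
  have hrp : r ≤ r / p := by rw [le_div_iff₀ hp0]; nlinarith
  have hrb' : r ≤ b := hrp.trans hrb
  have hb0 : 0 < b := by positivity
  have hE : 1 ≤ Real.exp θ := Real.one_le_exp hθ.le
  have hT : 1 ≤ t ^ (r / 2) := Real.one_le_rpow ht (by linarith)
  have htT : t ≤ t ^ (r / 2) := by
    calc t = t ^ (1:ℝ) := (Real.rpow_one t).symm
      _ ≤ _ := Real.rpow_le_rpow_of_exponent_le ht (by linarith)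
  set T := t ^ (r / 2) with hTdef
  set E := Real.exp θ with hEdef
  have hMT : M * T ≤ M * E * T := by
    have : 0 ≤ M * T := by positivity
    nlinarith
  set Q := (8 * b) ^ r with hQ
  have hQ0 : 0 < Q := by positivity
  have hsq : ∀ z : ℝ, 0 ≤ z → (z ^ 2) ^ (r / 2) = z ^ r := fun z hz => by
    rw [← Real.rpow_two, ← Real.rpow_mul hz]; congr 1; ring
  have hpow : ∀ z : ℝ, 0 ≤ z → z ≤ 8 * b → z ^ r ≤ Q := fun z hz hzb =>
    Real.rpow_le_rpow hz hzb hr0.le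
  -- term 1
  have t1 : r * (M * 2 ^ r * t) ≤ Q * (M * E * T) := by
    have h1 : r * 2 ^ r ≤ Q := by
      calc r * 2 ^ r = r ^ (1:ℝ) * 2 ^ r := by rw [Real.rpow_one]
        _ ≤ r ^ r * 2 ^ r := by
            gcongr
            · linarith
            · linarith
        _ = (r * 2) ^ r := by rw [Real.mul_rpow (by positivity) (by positivity)]
        _ ≤ Q := hpow _ (by positivity) (by linarith)
    calc r * (M * 2 ^ r * t) = (r * 2 ^ r) * (M * t) := by ring
      _ ≤ Q * (M * E * T) := by
          apply mul_le_mul h1 _ (by positivity) hQ0.le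
          refine le_trans ?_ hMT
          gcongr
  have t2 : t * ((4 * r) ^ r * M) ≤ Q * (M * E * T) := by
    calc t * ((4 * r) ^ r * M) = (4 * r) ^ r * (M * t) := by ring
      _ ≤ Q * (M * E * T) := by
          apply mul_le_mul (hpow _ (by positivity) (by linarith)) _ (by positivity) hQ0.le
          refine le_trans ?_ hMT
          gcongr
  have t3 : (48 * r ^ 2 * t * m2) ^ (r / 2) ≤ Q * (M * E * T) := by
    calc (48 * r ^ 2 * t * m2) ^ (r / 2) ≤ ((8 * r) ^ 2 * t * m2) ^ (r / 2) := by
          apply Real.rpow_le_rpow (by positivity) _ (by linarith)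
          have : 48 * r ^ 2 ≤ (8 * r) ^ 2 := by nlinarith
          gcongr
      _ = (8 * r) ^ r * (m2 ^ (r / 2) * T) := by
          rw [Real.mul_rpow (by positivity) (by positivity),
            Real.mul_rpow (by positivity) (by positivity), hsq _ (by positivity)]
          ring
      _ ≤ Q * (M * E * T) := by
          apply mul_le_mul (hpow _ (by positivity) (by linarith)) _ (by positivity) hQ0.le
          refine le_trans ?_ hMT
          gcongr
  have t4 : (64 * θ * r * t * m2 / p) ^ (r / 2) ≤ Q * (M * E * T) := by
    have hθr : θ ^ (r / 2) ≤ r ^ (r / 2) * E := by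
      refine (erc_rpow_le_exp hθ (k := r / 2) (by linarith)).trans ?_
      gcongr
      linarith
    calc (64 * θ * r * t * m2 / p) ^ (r / 2)
        = (θ * (8 ^ 2 * (r / p)) * m2 * t) ^ (r / 2) := by
          congr 1; ring
      _ = θ ^ (r / 2) * (8 ^ 2 * (r / p)) ^ (r / 2) * m2 ^ (r / 2) * T := by
          rw [Real.mul_rpow (by positivity) (by positivity),
            Real.mul_rpow (by positivity) (by positivity),
            Real.mul_rpow (by positivity) (by positivity)]
      _ ≤ (r ^ (r / 2) * E) * (8 ^ 2 * (r / p)) ^ (r / 2) * M * T := by gcongr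
      _ = (r * (8 ^ 2 * (r / p))) ^ (r / 2) * (M * E * T) := by
          rw [Real.mul_rpow (x := r) (by positivity) (by positivity)]; ring
      _ ≤ ((8 * b) ^ 2) ^ (r / 2) * (M * E * T) := by
          gcongr ?_ ^ (r / 2) * _
          have : r * (r / p) ≤ b * b := by gcongr
          nlinarith
      _ = Q * (M * E * T) := by rw [hsq _ (by positivity)]
  have t5 : (16 * r ^ 2 / p ^ 2) ^ (r / 2) ≤ Q * (M * E * T) := by
    calc (16 * r ^ 2 / p ^ 2) ^ (r / 2) = ((4 * (r / p)) ^ 2) ^ (r / 2) := by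
          congr 1; field_simp; ring
      _ = (4 * (r / p)) ^ r := hsq _ (by positivity)
      _ ≤ Q := hpow _ (by positivity) (by nlinarith)
      _ ≤ Q * (M * E * T) := by
          have : 1 ≤ M * E * T := by
            have : 1 ≤ M * E := by nlinarith
            nlinarith
          nlinarith
  have hfin : 8 * Q ≤ (10 ^ 7 * r ^ 2 / p) ^ (r + 2) := by
    have h1 : 10 ^ 7 * r ^ 2 / p = 10 ^ 7 * b := by rw [hb]; ring
    rw [h1, Real.rpow_add (by positivity), Real.rpow_two, mul_comm]
    apply mul_le_mul
    · apply Real.rpow_le_rpow (by positivity) _ hr0.le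
      nlinarith
    · nlinarith
    · norm_num
    · positivity
  have hX : 0 ≤ M * E * T := by positivity
  calc _ ≤ (8 * Q) * (M * E * T) := by linarith
    _ ≤ (10 ^ 7 * r ^ 2 / p) ^ (r + 2) * (M * E * T) := by gcongr
    _ = _ := by ring

theorem equilibrium_renewal_central_moment
    {Ω : Type*} [MeasurableSpace Ω] (μ : Measure Ω) [IsProbabilityMeasure μ]
    (S : Ω → ℝ) (hSmeas : Measurable S) (hSnn : ∀ᵐ ω ∂μ, 0 ≤ S ω)
    (hES : ∫ ω, S ω ∂μ = 1)
    (r : ℝ) (hr : 2 ≤ r)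
    (hSr : Integrable (fun ω => S ω ^ r) μ)
    (η : ℕ → Ω → ℝ)
    (hmeas : ∀ j, Measurable (η j))
    (hnn : ∀ j, ∀ᵐ ω ∂μ, 0 ≤ η j ω)
    (hindep : iIndepFun η μ)
    (hlaw : ∀ j, μ.map (η (j + 1)) = μ.map S)
    (heq : ∀ y : ℝ, 0 ≤ y →
      (μ {ω | y < η 0 ω}).toReal = ∫ z in Set.Ioi y, (μ {ω | z < S ω}).toReal) :
    ∀ t : ℝ, 1 ≤ t → ∀ θ : ℝ, 0 < θ →
      ∫⁻ ω, ENNReal.ofReal (|(renewalCount (fun j => η j ω) t : ℝ) - t| ^ r) ∂μ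
        ≤ ENNReal.ofReal ((∫ ω, S ω ^ r ∂μ) * Real.exp θ
            * (10 ^ 7 * r ^ 2 / (1 - ∫ ω, Real.exp (-θ * S ω) ∂μ)) ^ (r + 2) * t ^ (r / 2)) := by
  intro t ht θ hθ
  have hr0 : 0 < r := by linarith
  obtain ⟨hS1, hS2, hm21, hm2M, hM1⟩ := erc_moments μ S hSmeas hSnn hES r hr hSr
  obtain ⟨hp0, hp1, hpθ⟩ := erc_p μ S hSmeas hSnn hES hS1 θ hθ
  have htail := erc_tail μ S hSmeas hSnn hES hS1 hS2 η hmeas hnn hindep hlaw r hr hSr heq t θ _ _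
    ht hθ rfl hp0 hpθ rfl hm21
  have hM : ∫⁻ ω, ENNReal.ofReal (S ω ^ r) ∂μ = ENNReal.ofReal (∫ ω, S ω ^ r ∂μ) := by
    rw [ofReal_integral_eq_lintegral_ofReal hSr]
    filter_upwards [hSnn] with ω hω using Real.rpow_nonneg hω _
  set M := ∫ ω, S ω ^ r ∂μ with hMdef
  set m2 := ∫ ω, S ω ^ 2 ∂μ with hm2def
  set p := 1 - ∫ ω, Real.exp (-θ * S ω) ∂μ with hpdef
  have hfinal := erc_final hr ht hθ hp0 hp1 hm21 hm2M hM1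
  refine le_trans ?_ (ENNReal.ofReal_le_ofReal hfinal)
  have hNm := erc_measurable η hmeas t ht
  have hNm' : Measurable (fun ω => |(renewalCount (fun j => η j ω) t : ℝ) - t|) := by
    have : Measurable (fun ω => (renewalCount (fun j => η j ω) t : ℝ)) :=
      measurable_from_top.comp hNm
    exact (this.sub_const t).abs
  rw [lintegral_rpow_eq_lintegral_meas_lt_mul μ (Filter.Eventually.of_forall fun ω => abs_nonneg _)
    hNm'.aemeasurable hr0]
  set w : ℝ → ℝ≥0∞ := fun x => ENNReal.ofReal (x ^ (r - 1)) with hw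
  have hwm : Measurable w := by rw [hw]; fun_prop
  set A1 : ℝ → ℝ≥0∞ := (Set.Ioc 0 t).indicator
          (fun x => ENNReal.ofReal (M * (x / 2) ^ (1 - r))) with hA1
  set A2 : ℝ → ℝ≥0∞ := fun x => μ {ω | x < 4 * r * S ω} with hA2
  set G : ℝ → ℝ → ℝ≥0∞ := fun D x => min 1 (ENNReal.ofReal ((D / x ^ 2) ^ r)) with hG
  have hGm : ∀ D, Measurable (G D) := fun D => by
    apply Measurable.min measurable_const
    fun_prop
  have hA2m : Measurable A2 := by
    have : Antitone A2 := fun a b hab =>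
      measure_mono (Set.ofPred_subset_ofPred.2 fun ω (h : b < _) => lt_of_le_of_lt hab h)
    exact this.measurable
  set D0 := 48 * r ^ 2 * t * m2 with hD0
  set D1 := 64 * θ * r * t * m2 / p with hD1
  set D2 := 16 * r ^ 2 / p ^ 2 with hD2
  have hI1 : ENNReal.ofReal r * ∫⁻ x in Set.Ioi (0:ℝ), A1 x * w x
      ≤ ENNReal.ofReal (r * (M * 2 ^ r * t)) := by
    rw [ENNReal.ofReal_mul hr0.le]
    gcongr
    calc ∫⁻ x in Set.Ioi (0:ℝ), A1 x * w x
        ≤ ∫⁻ x in Set.Ioi (0:ℝ), (Set.Ioc 0 t).indicator (fun _ => ENNReal.ofReal (M * 2 ^ r)) x := by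
          apply lintegral_mono
          intro x
          by_cases hx : x ∈ Set.Ioc 0 t
          · simp only [hA1, hw, Set.indicator_of_mem hx]
            have hx0 : 0 < x := hx.1
            rw [← ENNReal.ofReal_mul (by positivity)]
            apply ENNReal.ofReal_le_ofReal
            rw [mul_assoc]
            gcongr
            have h1 : (x / 2) ^ (1 - r) = x ^ (1 - r) * 2 ^ (r - 1) := by
              rw [Real.div_rpow hx0.le (by norm_num), div_eq_mul_inv,
                ← Real.rpow_neg (by norm_num)]
              congr 2; ring
            have h2 : x ^ (1 - r) * x ^ (r - 1) = 1 := by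
              rw [← Real.rpow_add hx0]; simp
            calc (x / 2) ^ (1 - r) * x ^ (r - 1) = 2 ^ (r - 1) * (x ^ (1 - r) * x ^ (r - 1)) := by
                  rw [h1]; ring
              _ = 2 ^ (r - 1) := by rw [h2, mul_one]
              _ ≤ 2 ^ r := Real.rpow_le_rpow_of_exponent_le (by norm_num) (by linarith)
          · simp [hA1, Set.indicator_of_notMem hx]
      _ ≤ ∫⁻ x, (Set.Ioc 0 t).indicator (fun _ => ENNReal.ofReal (M * 2 ^ r)) x :=
          setLIntegral_le_lintegral _ _
      _ = ENNReal.ofReal (M * 2 ^ r * t) := by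
          rw [lintegral_indicator_const measurableSet_Ioc, Real.volume_Ioc, sub_zero,
            ← ENNReal.ofReal_mul (by positivity)]
  have hI2 : ENNReal.ofReal r * ∫⁻ x in Set.Ioi (0:ℝ), (ENNReal.ofReal t * A2 x) * w x
      = ENNReal.ofReal (t * ((4 * r) ^ r * M)) := by
    have hlc := lintegral_rpow_eq_lintegral_meas_lt_mul μ (f := fun ω => 4 * r * S ω)
      (by filter_upwards [hSnn] with ω hω; simp only [Pi.zero_apply]; positivity)
      (by fun_prop) (p := r) hr0
    have h1 : ∫⁻ ω, ENNReal.ofReal ((4 * r * S ω) ^ r) ∂μ = ENNReal.ofReal ((4 * r) ^ r * M) := by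
      rw [ENNReal.ofReal_mul (by positivity), ← hM, ← lintegral_const_mul' _ _ ENNReal.ofReal_ne_top]
      apply lintegral_congr_ae
      filter_upwards [hSnn] with ω hω
      rw [Real.mul_rpow (by positivity) hω, ENNReal.ofReal_mul (by positivity)]
    rw [ENNReal.ofReal_mul (by linarith), ← h1, hlc]
    simp only [mul_assoc]
    rw [lintegral_const_mul' _ _ ENNReal.ofReal_ne_top]
    simp only [hA2, hw, mul_assoc]
    ring
  have hI3 := erc_tail_integral' hr (D := D0) (by positivity)
  have hI4 := erc_tail_integral' hr (D := D1) (by positivity)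
  have hI5 := erc_tail_integral' hr (D := D2) (by positivity)
  calc ENNReal.ofReal r * ∫⁻ x in Set.Ioi (0:ℝ),
        μ {ω | x < |(renewalCount (fun j => η j ω) t : ℝ) - t|} * w x
      ≤ ENNReal.ofReal r * ∫⁻ x in Set.Ioi (0:ℝ),
        (A1 x * w x + (ENNReal.ofReal t * A2 x) * w x + G D0 x * w x + G D1 x * w x + G D2 x * w x) := by
        gcongr ENNReal.ofReal r * ?_
        apply setLIntegral_mono' measurableSet_Ioi
        intro x hx
        simp only [← add_mul]
        gcongr
        exact htail x hx
    _ = (ENNReal.ofReal r * ∫⁻ x in Set.Ioi (0:ℝ), A1 x * w x)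
        + (ENNReal.ofReal r * ∫⁻ x in Set.Ioi (0:ℝ), (ENNReal.ofReal t * A2 x) * w x)
        + (ENNReal.ofReal r * ∫⁻ x in Set.Ioi (0:ℝ), G D0 x * w x)
        + (ENNReal.ofReal r * ∫⁻ x in Set.Ioi (0:ℝ), G D1 x * w x)
        + (ENNReal.ofReal r * ∫⁻ x in Set.Ioi (0:ℝ), G D2 x * w x) := by
        have hm : ∀ D, Measurable (fun x => G D x * w x) := fun D => (hGm D).mul hwm
        have hm' : Measurable (fun x => (ENNReal.ofReal t * A2 x) * w x) :=
          (hA2m.const_mul _).mul hwm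
        rw [lintegral_add_right _ (hm D2), lintegral_add_right _ (hm D1),
          lintegral_add_right _ (hm D0), lintegral_add_right _ hm']
        ring
    _ ≤ ENNReal.ofReal (r * (M * 2 ^ r * t)) + ENNReal.ofReal (t * ((4 * r) ^ r * M))
        + ENNReal.ofReal (2 * D0 ^ (r / 2)) + ENNReal.ofReal (2 * D1 ^ (r / 2))
        + ENNReal.ofReal (2 * D2 ^ (r / 2)) :=
        add_le_add (add_le_add (add_le_add (add_le_add hI1 hI2.le) hI3) hI4) hI5
    _ = _ := by
        rw [← ENNReal.ofReal_add (by positivity) (by positivity),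
          ← ENNReal.ofReal_add (by positivity) (by positivity),
          ← ENNReal.ofReal_add (by positivity) (by positivity),
          ← ENNReal.ofReal_add (by positivity) (by positivity)]
end

section
/- Suppose E[S] = 1 and E[S^r] < ∞ for some r ≥ 2. Then for all integers k ≥ 1, all t ≥ 1, and all θ > 0, E[|∑_{i=1}^k N_i(t) − k t|^r] ≤ E[S^r] exp(θ) (10^8 r^3 / (1 − E[exp(−θS)]))^{r+2} k^{r/2} t^{r/2}. -/
open MeasureTheory ProbabilityTheory
open scoped ENNReal

lemma rp_tangent (p : ℝ) (hp : 1 ≤ p) (X Y : ℝ) (hX : 0 ≤ X) (hY : 0 ≤ Y) :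
    Y ^ p + p * Y ^ (p - 1) * (X - Y) ≤ X ^ p := by
  rcases hY.eq_or_lt with h | h
  · subst h
    rw [Real.zero_rpow (by linarith)]
    rcases hp.eq_or_lt with h1 | h1
    · subst h1; simp
    · rw [Real.zero_rpow (by linarith)]
      simpa using Real.rpow_nonneg hX p
  · have hb := one_add_mul_self_le_rpow_one_add (s := X / Y - 1)
      (by have := div_nonneg hX hY; linarith) hp
    have h2 : (1 + (X / Y - 1)) = X / Y := by ring
    rw [h2, Real.div_rpow hX hY] at hb
    have hYp : 0 < Y ^ p := Real.rpow_pos_of_pos h p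
    rw [le_div_iff₀ hYp] at hb
    have h3 : Y ^ p = Y ^ (p - 1) * Y := by
      rw [← Real.rpow_add_one h.ne']; ring_nf
    have h4 : (1 + p * (X / Y - 1)) * Y ^ p = Y ^ p + p * Y ^ (p - 1) * (X - Y) := by
      rw [h3]; field_simp
    linarith

lemma phi_mono_aux (s : ℝ) (hs : 0 ≤ s) (x y m : ℝ) (hx : 0 ≤ x) (hxy : x ≤ y) (hm : y ≤ m) :
    y ^ s * y - x ^ s * x ≤ (s + 1) * m ^ s * (y - x) := by
  have hy : 0 ≤ y := hx.trans hxy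
  have h := rp_tangent (s + 1) (by linarith) x y hx hy
  have e : ∀ z : ℝ, 0 ≤ z → z ^ (s + 1) = z ^ s * z := by
    intro z hz
    rcases hz.eq_or_lt with h | h
    · subst h; rw [Real.zero_rpow (by linarith)]; simp
    · rw [Real.rpow_add_one h.ne']
  rw [e x hx, e y hy] at h
  have h2 : y ^ s ≤ m ^ s := Real.rpow_le_rpow hy hm hs
  have h3 : (s + 1) * y ^ s * (y - x) ≤ (s + 1) * m ^ s * (y - x) := by
    gcongr
  have : s + 1 - 1 = s := by ring
  rw [this] at h
  nlinarith

lemma phi_mono (s : ℝ) (hs : 0 ≤ s) (x y m : ℝ) (hxy : x ≤ y) (hx : |x| ≤ m) (hy : |y| ≤ m) :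
    |y| ^ s * y - |x| ^ s * x ≤ (s + 1) * m ^ s * (y - x) := by
  rcases le_total 0 x with h0 | h0
  · rw [abs_of_nonneg h0, abs_of_nonneg (h0.trans hxy)]
    exact phi_mono_aux s hs x y m h0 hxy (by rwa [abs_of_nonneg (h0.trans hxy)] at hy)
  · rcases le_total 0 y with h1 | h1
    · have a1 : |y| ^ s * y ≤ m ^ s * y :=
        mul_le_mul_of_nonneg_right (Real.rpow_le_rpow (abs_nonneg _) hy hs) h1
      have a2 : |x| ^ s * (-x) ≤ m ^ s * (-x) :=
        mul_le_mul_of_nonneg_right (Real.rpow_le_rpow (abs_nonneg _) hx hs) (by linarith)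
      have a3 : 0 ≤ s * (m ^ s * (y - x)) := by
        have : 0 ≤ m ^ s := Real.rpow_nonneg ((abs_nonneg _).trans hx) s
        have : 0 ≤ y - x := by linarith
        positivity
      nlinarith
    · rw [abs_of_nonpos h0, abs_of_nonpos h1]
      have := phi_mono_aux s hs (-y) (-x) m (by linarith) (by linarith)
        (by rwa [abs_of_nonpos h0] at hx)
      nlinarith

lemma taylor_abs (r : ℝ) (hr : 2 ≤ r) (x d : ℝ) :
    |x + d| ^ r ≤ |x| ^ r + r * (|x| ^ (r - 2) * x * d)
      + r * (r - 1) * ((|x| + |d|) ^ (r - 2) * d ^ 2) := by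
  set y := x + d with hy
  have hm : |y| ≤ |x| + |d| := abs_add_le x d
  have hx : |x| ≤ |x| + |d| := by linarith [abs_nonneg d]
  have h1 := rp_tangent r (by linarith) |x| |y| (abs_nonneg _) (abs_nonneg _)
  have e : |y| ^ (r - 1) = |y| ^ (r - 2) * |y| := by
    rcases (abs_nonneg y).eq_or_lt with h | h
    · rw [← h, Real.zero_rpow (by linarith)]; simp
    · rw [← Real.rpow_add_one h.ne']; ring_nf
  have hp : 0 ≤ |y| ^ (r - 2) := Real.rpow_nonneg (abs_nonneg _) _
  have h2 : y * (x - y) ≤ |y| * (|x| - |y|) := by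
    have : y * x ≤ |y| * |x| := by rw [← abs_mul]; exact le_abs_self _
    nlinarith [abs_mul_abs_self y]
  have h3 : r * (|y| ^ (r - 2) * (y * (x - y))) ≤ r * (|y| ^ (r - 2) * (|y| * (|x| - |y|))) := by
    gcongr
  have h4 : |y| ^ r ≤ |x| ^ r + r * (|y| ^ (r - 2) * y * d) := by
    rw [e] at h1
    have : x - y = -d := by rw [hy]; ring
    rw [this] at h3
    nlinarith
  have h5 : (|y| ^ (r - 2) * y - |x| ^ (r - 2) * x) * d
      ≤ (r - 1) * ((|x| + |d|) ^ (r - 2) * d ^ 2) := by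
    have e2 : r - 2 + 1 = r - 1 := by ring
    rcases le_total 0 d with hd | hd
    · have := phi_mono (r - 2) (by linarith) x y (|x| + |d|) (by linarith) hx hm
      rw [e2, show y - x = d by rw [hy]; ring] at this
      nlinarith
    · have := phi_mono (r - 2) (by linarith) y x (|x| + |d|) (by linarith) hm hx
      rw [e2, show x - y = -d by rw [hy]; ring] at this
      nlinarith
  nlinarith

lemma u_bound (a σ x d : ℝ) (ha : 0 < a) (hσ : 0 < σ) :
    |x| + |d| ≤ (a + σ) * max (|x| / a) (|d| / σ) := by
  have h1 : |x| ≤ a * max (|x| / a) (|d| / σ) := by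
    rw [← div_le_iff₀' ha]; exact le_max_left _ _
  have h2 : |d| ≤ σ * max (|x| / a) (|d| / σ) := by
    rw [← div_le_iff₀' hσ]; exact le_max_right _ _
  linarith

lemma max_rpow (r a σ x d : ℝ) (hr : 2 ≤ r) (ha : 0 < a) (hσ : 0 < σ) :
    (max (|x| / a) (|d| / σ)) ^ r ≤ |x| ^ r / a ^ r + |d| ^ r / σ ^ r := by
  rw [← Real.div_rpow (abs_nonneg _) ha.le, ← Real.div_rpow (abs_nonneg _) hσ.le]
  have h1 : 0 ≤ (|x| / a) ^ r := by positivity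
  have h2 : 0 ≤ (|d| / σ) ^ r := by positivity
  rcases max_cases (|x| / a) (|d| / σ) with h | h <;> rw [h.1] <;> linarith

lemma crude_abs (r a σ x d : ℝ) (hr : 2 ≤ r) (ha : 0 < a) (hσ : 0 < σ) :
    |x + d| ^ r ≤ (a + σ) ^ r * (|x| ^ r / a ^ r + |d| ^ r / σ ^ r) := by
  have h := u_bound a σ x d ha hσ
  have hm : 0 ≤ max (|x| / a) (|d| / σ) := le_max_of_le_left (by positivity)
  calc |x + d| ^ r ≤ ((a + σ) * max (|x| / a) (|d| / σ)) ^ r :=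
        Real.rpow_le_rpow (abs_nonneg _) ((abs_add_le x d).trans h) (by linarith)
    _ = (a + σ) ^ r * (max (|x| / a) (|d| / σ)) ^ r := Real.mul_rpow (by linarith) hm
    _ ≤ _ := by
        gcongr
        exact max_rpow r a σ x d hr ha hσ

lemma second_abs (r a σ x d : ℝ) (hr : 2 ≤ r) (ha : 0 < a) (hσ : 0 < σ) :
    (|x| + |d|) ^ (r - 2) * d ^ 2
      ≤ (a + σ) ^ (r - 2) * σ ^ 2 * (|x| ^ r / a ^ r + |d| ^ r / σ ^ r) := by
  have h := u_bound a σ x d ha hσ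
  set M := max (|x| / a) (|d| / σ) with hM
  have hm : 0 ≤ M := le_max_of_le_left (by positivity)
  have h1 : (|x| + |d|) ^ (r - 2) ≤ (a + σ) ^ (r - 2) * M ^ (r - 2) := by
    rw [← Real.mul_rpow (by linarith) hm]
    exact Real.rpow_le_rpow (by positivity) h (by linarith)
  have h2 : d ^ 2 ≤ σ ^ 2 * M ^ 2 := by
    rw [← sq_abs d, ← mul_pow]
    gcongr
    rw [← div_le_iff₀' hσ]; exact le_max_right _ _
  have h3 : M ^ (r - 2) * M ^ 2 = M ^ r := by
    rw [← Real.rpow_two, ← Real.rpow_add_of_nonneg hm (by linarith) (by norm_num)]; ring_nf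
  calc _ ≤ ((a + σ) ^ (r - 2) * M ^ (r - 2)) * (σ ^ 2 * M ^ 2) := by gcongr
    _ = (a + σ) ^ (r - 2) * σ ^ 2 * M ^ r := by rw [← h3]; ring
    _ ≤ _ := by
        gcongr
        exact max_rpow r a σ x d hr ha hσ

lemma const_small (r a σ : ℝ) (hr : 2 ≤ r) (ha : 0 < a) (hσ : 0 < σ) (h : r * σ ≤ a) :
    a ^ r + r * (r - 1) * ((a + σ) ^ (r - 2) * σ ^ 2 * 2) ≤ (a ^ 2 + 6 * r ^ 2 * σ ^ 2) ^ (r / 2) := by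
  have h1 : (a + σ) ^ (r - 2) ≤ 3 * a ^ (r - 2) := by
    have : a + σ ≤ a * Real.exp (1 / r) := by
      have := Real.add_one_le_exp (1 / r)
      have h2 : σ ≤ a * (1 / r) := by
        rw [mul_one_div, le_div_iff₀ (by linarith)]; linarith
      nlinarith
    calc (a + σ) ^ (r - 2) ≤ (a * Real.exp (1 / r)) ^ (r - 2) :=
          Real.rpow_le_rpow (by positivity) this (by linarith)
      _ = Real.exp (1 / r) ^ (r - 2) * a ^ (r - 2) := by
          rw [Real.mul_rpow ha.le (Real.exp_pos _).le, mul_comm]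
      _ ≤ 3 * a ^ (r - 2) := by
          gcongr
          rw [← Real.exp_mul]
          have : 1 / r * (r - 2) ≤ 1 := by
            rw [one_div_mul_eq_div, div_le_one (by linarith)]; linarith
          exact (Real.exp_le_exp.2 this).trans Real.exp_one_lt_three.le
  have hb := one_add_mul_self_le_rpow_one_add (s := 6 * r ^ 2 * σ ^ 2 / a ^ 2) (p := r / 2)
    (by have : 0 ≤ 6 * r ^ 2 * σ ^ 2 / a ^ 2 := by positivity
        linarith) (by linarith)
  have e1 : a ^ 2 + 6 * r ^ 2 * σ ^ 2 = a ^ 2 * (1 + 6 * r ^ 2 * σ ^ 2 / a ^ 2) := by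
    field_simp
  have e2 : (a ^ 2) ^ (r / 2) = a ^ r := by
    rw [← Real.rpow_two, ← Real.rpow_mul ha.le]; ring_nf
  have e3 : a ^ r = a ^ (r - 2) * a ^ 2 := by
    rw [← Real.rpow_two, ← Real.rpow_add ha]; ring_nf
  rw [e1, Real.mul_rpow (by positivity) (by positivity), e2]
  have hap : 0 < a ^ (r - 2) := Real.rpow_pos_of_pos ha _
  calc a ^ r + r * (r - 1) * ((a + σ) ^ (r - 2) * σ ^ 2 * 2)
      ≤ a ^ r + r * (r - 1) * ((3 * a ^ (r - 2)) * σ ^ 2 * 2) := by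
        have : 0 ≤ r - 1 := by linarith
        gcongr
    _ ≤ a ^ r * (1 + r / 2 * (6 * r ^ 2 * σ ^ 2 / a ^ 2)) := by
        rw [e3]
        have : a ^ (r - 2) * a ^ 2 * (1 + r / 2 * (6 * r ^ 2 * σ ^ 2 / a ^ 2))
          = a ^ (r - 2) * a ^ 2 + a ^ (r - 2) * σ ^ 2 * (3 * r ^ 3) := by field_simp; ring
        rw [this]
        have h9 : 6 * (r * (r - 1)) ≤ 3 * r ^ 3 := by nlinarith [mul_nonneg (by linarith : 0 ≤ r) (by linarith : 0 ≤ r - 2)]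
        have : 0 ≤ a ^ (r - 2) * σ ^ 2 := by positivity
        nlinarith
    _ ≤ _ := by gcongr

lemma const_large (r a σ : ℝ) (hr : 2 ≤ r) (ha : 0 < a) (hσ : 0 < σ) (h : a ≤ r * σ) :
    (a + σ) ^ r * 2 ≤ (a ^ 2 + 6 * r ^ 2 * σ ^ 2) ^ (r / 2) := by
  have e2 : (a + σ) ^ r = ((a + σ) ^ 2) ^ (r / 2) := by
    rw [← Real.rpow_two, ← Real.rpow_mul (by positivity)]; ring_nf
  have h2 : (2 : ℝ) ≤ 2 ^ (r / 2) := by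
    have := Real.rpow_le_rpow_of_exponent_le (x := 2) (by norm_num) (by linarith : (1 : ℝ) ≤ r / 2)
    simpa using this
  calc (a + σ) ^ r * 2 ≤ ((a + σ) ^ 2) ^ (r / 2) * 2 ^ (r / 2) := by rw [e2]; gcongr
    _ = ((a + σ) ^ 2 * 2) ^ (r / 2) := by rw [Real.mul_rpow (by positivity) (by norm_num)]
    _ ≤ _ := by
        apply Real.rpow_le_rpow (by positivity) _ (by linarith)
        have h3 : a ^ 2 ≤ r ^ 2 * σ ^ 2 := by
          rw [← mul_pow]; gcongr
        have h4 : 4 * σ ^ 2 ≤ r ^ 2 * σ ^ 2 := by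
          gcongr; nlinarith
        nlinarith [sq_nonneg (a - σ)]

lemma step_moment {Ω : Type*} [MeasurableSpace Ω] (μ : Measure Ω)
    (r a σ : ℝ) (hr : 2 ≤ r) (ha : 0 < a) (hσ : 0 < σ) (X D : Ω → ℝ)
    (hX : Measurable X) (hD : Measurable D)
    (iX : Integrable (fun ω => |X ω| ^ r) μ) (iD : Integrable (fun ω => |D ω| ^ r) μ)
    (iXD : Integrable (fun ω => |X ω| ^ (r - 2) * X ω * D ω) μ)
    (h0 : ∫ ω, |X ω| ^ (r - 2) * X ω * D ω ∂μ = 0)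
    (hXa : ∫ ω, |X ω| ^ r ∂μ ≤ a ^ r) (hDσ : ∫ ω, |D ω| ^ r ∂μ ≤ σ ^ r) :
    Integrable (fun ω => |X ω + D ω| ^ r) μ ∧
      ∫ ω, |X ω + D ω| ^ r ∂μ ≤ (a ^ 2 + 6 * r ^ 2 * σ ^ 2) ^ (r / 2) := by
  have har : 0 < a ^ r := Real.rpow_pos_of_pos ha _
  have hσr : 0 < σ ^ r := Real.rpow_pos_of_pos hσ _
  have iu : Integrable (fun ω => |X ω| ^ r / a ^ r + |D ω| ^ r / σ ^ r) μ :=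
    (iX.div_const _).add (iD.div_const _)
  have hu : ∫ ω, (|X ω| ^ r / a ^ r + |D ω| ^ r / σ ^ r) ∂μ ≤ 2 := by
    rw [integral_add (iX.div_const _) (iD.div_const _), integral_div, integral_div]
    have h1 := (div_le_one har).2 hXa
    have h2 := (div_le_one hσr).2 hDσ
    linarith
  have iXpD : Integrable (fun ω => |X ω + D ω| ^ r) μ := by
    refine (iu.const_mul ((a + σ) ^ r)).mono' ?_ ?_
    · exact ((hX.add hD).abs.pow_const r).aestronglyMeasurable
    · filter_upwards with ω
      rw [Real.norm_of_nonneg (by positivity)]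
      exact crude_abs r a σ _ _ hr ha hσ
  refine ⟨iXpD, ?_⟩
  rcases le_total (r * σ) a with h | h
  · refine le_trans ?_ (const_small r a σ hr ha hσ h)
    have hr1 : 0 ≤ r - 1 := by linarith
    calc ∫ ω, |X ω + D ω| ^ r ∂μ
        ≤ ∫ ω, (|X ω| ^ r + r * (|X ω| ^ (r - 2) * X ω * D ω)
          + r * (r - 1) * ((a + σ) ^ (r - 2) * σ ^ 2 * (|X ω| ^ r / a ^ r + |D ω| ^ r / σ ^ r))) ∂μ := by
          apply integral_mono iXpD ((iX.add (iXD.const_mul r)).add ((iu.const_mul _).const_mul _))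
          intro ω
          refine (taylor_abs r hr (X ω) (D ω)).trans ?_
          exact add_le_add le_rfl (mul_le_mul_of_nonneg_left
            (second_abs r a σ _ _ hr ha hσ) (by positivity))
      _ = ∫ ω, |X ω| ^ r ∂μ + r * (r - 1) * ((a + σ) ^ (r - 2) * σ ^ 2 *
            ∫ ω, (|X ω| ^ r / a ^ r + |D ω| ^ r / σ ^ r) ∂μ) := by
          have e1 := integral_add (iX.add (iXD.const_mul r))
            ((iu.const_mul ((a + σ) ^ (r - 2) * σ ^ 2)).const_mul (r * (r - 1)))
          simp only [Pi.add_apply] at e1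
          rw [e1, integral_add iX (iXD.const_mul r), integral_const_mul, h0, integral_const_mul,
            integral_const_mul]
          ring
      _ ≤ _ := by gcongr
  · refine le_trans ?_ (const_large r a σ hr ha hσ h)
    calc ∫ ω, |X ω + D ω| ^ r ∂μ
        ≤ ∫ ω, (a + σ) ^ r * (|X ω| ^ r / a ^ r + |D ω| ^ r / σ ^ r) ∂μ := by
          apply integral_mono iXpD (iu.const_mul _)
          intro ω
          exact crude_abs r a σ _ _ hr ha hσ
      _ ≤ _ := by rw [integral_const_mul]; gcongr

lemma mart_moment {Ω : Type*} [MeasurableSpace Ω] (μ : Measure Ω)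
    [IsProbabilityMeasure μ]
    (r ε : ℝ) (hr : 2 ≤ r) (hε : 0 < ε) (σ : ℕ → ℝ) (hσ : ∀ n, 0 < σ n) (D : ℕ → Ω → ℝ)
    (hD : ∀ n, Measurable (D n))
    (iD : ∀ n, Integrable (fun ω => |D n ω| ^ r) μ)
    (hDσ : ∀ n, ∫ ω, |D n ω| ^ r ∂μ ≤ σ n ^ r)
    (h0 : ∀ n, Integrable (fun ω => |∑ j ∈ Finset.range n, D j ω| ^ r) μ →
      Integrable (fun ω => |∑ j ∈ Finset.range n, D j ω| ^ (r - 2) * (∑ j ∈ Finset.range n, D j ω) * D n ω) μ ∧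
      ∫ ω, |∑ j ∈ Finset.range n, D j ω| ^ (r - 2) * (∑ j ∈ Finset.range n, D j ω) * D n ω ∂μ = 0)
    (n : ℕ) :
    Integrable (fun ω => |∑ j ∈ Finset.range n, D j ω| ^ r) μ ∧
      ∫ ω, |∑ j ∈ Finset.range n, D j ω| ^ r ∂μ
        ≤ (ε + 6 * r ^ 2 * ∑ j ∈ Finset.range n, σ j ^ 2) ^ (r / 2) := by
  induction n with
  | zero =>
    have : (0 : ℝ) ^ r = 0 := Real.zero_rpow (by linarith)
    simp only [Finset.range_zero, Finset.sum_empty, abs_zero, this]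
    simp
    positivity
  | succ n ih =>
    obtain ⟨i1, i2⟩ := ih
    obtain ⟨j1, j2⟩ := h0 n i1
    have hs : 0 ≤ ∑ j ∈ Finset.range n, σ j ^ 2 := Finset.sum_nonneg fun _ _ => sq_nonneg _
    have hA : 0 < ε + 6 * r ^ 2 * ∑ j ∈ Finset.range n, σ j ^ 2 := by positivity
    have := step_moment μ r (Real.sqrt (ε + 6 * r ^ 2 * ∑ j ∈ Finset.range n, σ j ^ 2)) (σ n) hr
      (Real.sqrt_pos.2 hA) (hσ n) (fun ω => ∑ j ∈ Finset.range n, D j ω) (D n)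
      (Finset.measurable_sum _ fun j _ => hD j) (hD n) i1 (iD n) j1 j2
      (by
        rw [Real.sqrt_eq_rpow, ← Real.rpow_mul hA.le]
        convert i2 using 2
        ring) (hDσ n)
    rw [Real.sq_sqrt hA.le] at this
    simp only [Finset.sum_range_succ]
    rwa [mul_add, ← add_assoc]

def sigOf {Ω ι : Type*} (ξ : ι → Ω → ℝ) (I : Set ι) : MeasurableSpace Ω :=
  ⨆ i ∈ I, MeasurableSpace.comap (ξ i) inferInstance

lemma sigOf_le {Ω ι : Type*} [m : MeasurableSpace Ω] (ξ : ι → Ω → ℝ) (hξ : ∀ i, Measurable (ξ i))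
    (I : Set ι) : sigOf ξ I ≤ m :=
  iSup₂_le fun i _ => measurable_iff_comap_le.1 (hξ i)

lemma meas_sigOf {Ω ι : Type*} (ξ : ι → Ω → ℝ) (I : Set ι) (i : ι) (hi : i ∈ I) :
    Measurable[sigOf ξ I] (ξ i) := by
  apply measurable_iff_comap_le.2
  exact le_iSup₂ (f := fun i (_ : i ∈ I) => MeasurableSpace.comap (ξ i) inferInstance) i hi

lemma indep_sigOf {Ω ι β γ : Type*} [MeasurableSpace Ω] [MeasurableSpace β] [MeasurableSpace γ]
    {μ : Measure Ω} {ξ : ι → Ω → ℝ} (hξ : ∀ i, Measurable (ξ i))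
    (hind : iIndepFun ξ μ) {I J : Set ι} (hIJ : Disjoint I J) {X : Ω → β} {Y : Ω → γ}
    (hX : Measurable[sigOf ξ I] X) (hY : Measurable[sigOf ξ J] Y) : IndepFun X Y μ := by
  rw [IndepFun_iff_Indep]
  have h : Indep (sigOf ξ I) (sigOf ξ J) μ :=
    indep_iSup_of_disjoint (fun i => measurable_iff_comap_le.1 (hξ i)) hind hIJ
  exact indep_of_indep_of_le_left (indep_of_indep_of_le_right h (measurable_iff_comap_le.1 hY))
    (measurable_iff_comap_le.1 hX)

lemma orth_moment {Ω : Type*} [MeasurableSpace Ω] {μ : Measure Ω} [IsProbabilityMeasure μ]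
    (r : ℝ) (hr : 2 ≤ r) (X A Z : Ω → ℝ) (hX : Measurable X) (hA : Measurable A)
    (hA1 : ∀ ω, |A ω| ≤ 1)
    (iX : Integrable (fun ω => |X ω| ^ r) μ) (iZ : Integrable Z μ) (h0 : ∫ ω, Z ω ∂μ = 0)
    (hind : IndepFun (fun ω => |X ω| ^ (r - 2) * X ω * A ω) Z μ) :
    Integrable (fun ω => |X ω| ^ (r - 2) * X ω * (A ω * Z ω)) μ ∧
      ∫ ω, |X ω| ^ (r - 2) * X ω * (A ω * Z ω) ∂μ = 0 := by
  have mW : Measurable (fun ω => |X ω| ^ (r - 2) * X ω * A ω) :=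
    ((hX.abs.pow_const (r - 2)).mul hX).mul hA
  have iW : Integrable (fun ω => |X ω| ^ (r - 2) * X ω * A ω) μ := by
    refine ((integrable_const (1 : ℝ)).add iX).mono' mW.aestronglyMeasurable ?_
    filter_upwards with ω
    simp only [Real.norm_eq_abs, abs_mul, Pi.add_apply]
    have h1 : |(|X ω| ^ (r - 2))| = |X ω| ^ (r - 2) := abs_of_nonneg (by positivity)
    rw [h1]
    have h2 : |X ω| ^ (r - 2) * |X ω| ≤ 1 + |X ω| ^ r := by
      rcases le_total |X ω| 1 with h | h
      · have : |X ω| ^ (r - 2) ≤ 1 := Real.rpow_le_one (abs_nonneg _) h (by linarith)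
        have : 0 ≤ |X ω| ^ r := by positivity
        nlinarith [abs_nonneg (X ω)]
      · rw [← Real.rpow_add_one (by linarith)]
        have := Real.rpow_le_rpow_of_exponent_le h (by linarith : r - 2 + 1 ≤ r)
        linarith
    calc _ ≤ |X ω| ^ (r - 2) * |X ω| * 1 := by gcongr; exact hA1 ω
      _ ≤ _ := by rw [mul_one]; exact h2
  have e : (fun ω => |X ω| ^ (r - 2) * X ω * (A ω * Z ω))
      = (fun ω => |X ω| ^ (r - 2) * X ω * A ω) * Z := by
    funext ω; simp only [Pi.mul_apply]; ring
  rw [e]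
  refine ⟨hind.integrable_mul iW iZ, ?_⟩
  rw [hind.integral_mul_eq_mul_integral iW.1 iZ.1, h0, mul_zero]

lemma indep_lint {Ω : Type*} [MeasurableSpace Ω] {μ : Measure Ω} [IsProbabilityMeasure μ]
    {X Y : Ω → ℝ} (hX : Measurable X) (hY : Measurable Y) (h : IndepFun X Y μ)
    (g : ℝ × ℝ → ℝ≥0∞) (hg : Measurable g) :
    ∫⁻ ω, g (X ω, Y ω) ∂μ = ∫⁻ ω, ∫⁻ ω', g (X ω', Y ω) ∂μ ∂μ := by
  have h1 := (indepFun_iff_map_prod_eq_prod_map_map hX.aemeasurable hY.aemeasurable).1 h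
  rw [← lintegral_map (μ := μ) (f := g) (g := fun ω => (X ω, Y ω)) hg (hX.prodMk hY), h1,
    lintegral_prod_symm _ hg.aemeasurable, lintegral_map _ hY]
  · apply lintegral_congr
    intro ω
    rw [lintegral_map (f := fun x => g (x, Y ω)) (by fun_prop) hX]
  · exact Measurable.lintegral_prod_left' hg

structure RowHyp {Ω : Type*} [MeasurableSpace Ω] (μ : Measure Ω) (S : Ω → ℝ) (r : ℝ)
    (x : ℕ → Ω → ℝ) : Prop where
  mS : Measurable S
  nS : ∀ᵐ ω ∂μ, 0 ≤ S ω
  eS : ∫ ω, S ω ∂μ = 1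
  hr : 2 ≤ r
  iS : Integrable (fun ω => S ω ^ r) μ
  mx : ∀ j, Measurable (x j)
  nx : ∀ j, ∀ᵐ ω ∂μ, 0 ≤ x j ω
  ind : iIndepFun x μ
  law : ∀ j, μ.map (x (j + 1)) = μ.map S
  heq : ∀ y : ℝ, 0 ≤ y →
      (μ {ω | y < x 0 ω}).toReal = ∫ z in Set.Ioi y, (μ {ω | z < S ω}).toReal

lemma iS1 {Ω : Type*} [MeasurableSpace Ω] {μ : Measure Ω} {S : Ω → ℝ}
    (eS : ∫ ω, S ω ∂μ = 1) : Integrable S μ := by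
  by_contra h
  rw [integral_undef h] at eS
  norm_num at eS

lemma exp_int {Ω : Type*} [MeasurableSpace Ω] {μ : Measure Ω} [IsProbabilityMeasure μ] {S : Ω → ℝ}
    (mS : Measurable S) (nS : ∀ᵐ ω ∂μ, 0 ≤ S ω) (θ : ℝ) (hθ : 0 ≤ θ) :
    Integrable (fun ω => Real.exp (-θ * S ω)) μ := by
  refine (integrable_const (1 : ℝ)).mono' (by fun_prop) ?_
  filter_upwards [nS] with ω h
  rw [Real.norm_of_nonneg (Real.exp_pos _).le]
  apply Real.exp_le_one_iff.2
  nlinarith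

lemma p_pos {Ω : Type*} [MeasurableSpace Ω] {μ : Measure Ω} [IsProbabilityMeasure μ] {S : Ω → ℝ}
    (mS : Measurable S) (nS : ∀ᵐ ω ∂μ, 0 ≤ S ω) (eS : ∫ ω, S ω ∂μ = 1) (θ : ℝ) (hθ : 0 < θ) :
    0 < 1 - ∫ ω, Real.exp (-θ * S ω) ∂μ ∧ 1 - ∫ ω, Real.exp (-θ * S ω) ∂μ < 1 := by
  have i1 := exp_int mS nS θ hθ.le
  constructor
  · have e : 1 - ∫ ω, Real.exp (-θ * S ω) ∂μ = ∫ ω, (1 - Real.exp (-θ * S ω)) ∂μ := by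
      rw [integral_sub (integrable_const _) i1]; simp
    rw [e]
    have hnn : 0 ≤ᵐ[μ] fun ω => (1 - Real.exp (-θ * S ω)) := by
      filter_upwards [nS] with ω h
      have : Real.exp (-θ * S ω) ≤ 1 := Real.exp_le_one_iff.2 (by nlinarith)
      simpa using this
    refine lt_of_le_of_ne (integral_nonneg_of_ae hnn) fun h => ?_
    have h2 := (integral_eq_zero_iff_of_nonneg_ae hnn ((integrable_const _).sub i1)).1 h.symm
    have : S =ᵐ[μ] 0 := by
      filter_upwards [h2] with ω h
      simp only [Pi.zero_apply] at h ⊢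
      have h3 : Real.exp (-θ * S ω) = 1 := by linarith
      rw [Real.exp_eq_one_iff] at h3
      rcases mul_eq_zero.1 h3 with h4 | h4
      · linarith
      · exact h4
    rw [integral_congr_ae this] at eS
    simp at eS
  · have : 0 < ∫ ω, Real.exp (-θ * S ω) ∂μ := integral_exp_pos i1
    linarith

lemma laplace_t {Ω : Type*} [MeasurableSpace Ω] {μ : Measure Ω} [IsProbabilityMeasure μ] {S : Ω → ℝ}
    (mS : Measurable S) (nS : ∀ᵐ ω ∂μ, 0 ≤ S ω) (θ t : ℝ) (hθ : 0 < θ) (ht : 1 ≤ t) :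
    ∫ ω, Real.exp (-(θ / t) * S ω) ∂μ ≤ 1 - (1 - ∫ ω, Real.exp (-θ * S ω) ∂μ) / t := by
  have i1 := exp_int mS nS θ hθ.le
  have i2 := exp_int mS nS (θ / t) (by positivity)
  have e : 1 - (1 - ∫ ω, Real.exp (-θ * S ω) ∂μ) / t
      = ∫ ω, ((1 - 1 / t) + 1 / t * Real.exp (-θ * S ω)) ∂μ := by
    rw [integral_add (integrable_const _) (i1.const_mul _), integral_const_mul]
    simp; ring
  rw [e]
  refine integral_mono i2 ((integrable_const _).add (i1.const_mul _)) fun ω => ?_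
  have h1 : 1 / t ≤ 1 := by rw [div_le_one (by linarith)]; exact ht
  have := convexOn_exp.2 (Set.mem_univ (0 : ℝ)) (Set.mem_univ (-θ * S ω))
    (by linarith : 0 ≤ 1 - 1 / t) (by positivity : 0 ≤ 1 / t) (by ring)
  simp only [smul_eq_mul, mul_zero, zero_add, Real.exp_zero, mul_one] at this
  have e3 : -(θ / t) * S ω = 1 / t * (-θ * S ω) := by ring
  simp only [e3]
  exact this

section row
variable {Ω : Type*} [MeasurableSpace Ω] {μ : Measure Ω} [IsProbabilityMeasure μ] {S : Ω → ℝ}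
  {r : ℝ} {x : ℕ → Ω → ℝ}

lemma RowHyp.tail (H : RowHyp μ S r x) (θ t : ℝ) (hθ : 0 < θ) (ht : 1 ≤ t) (n : ℕ) :
    μ.real {ω | ∑ j ∈ Finset.range n, x (j + 1) ω ≤ t}
      ≤ Real.exp θ * (1 - (1 - ∫ ω, Real.exp (-θ * S ω) ∂μ) / t) ^ n := by
  have hU : Measurable (fun ω => ∑ j ∈ Finset.range n, x (j + 1) ω) :=
    Finset.measurable_sum _ fun j _ => H.mx (j + 1)
  have hUn : ∀ᵐ ω ∂μ, 0 ≤ ∑ j ∈ Finset.range n, x (j + 1) ω := by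
    filter_upwards [ae_all_iff.2 H.nx] with ω h
    exact Finset.sum_nonneg fun j _ => h _
  have h1 := measure_le_le_exp_mul_mgf (μ := μ) (X := fun ω => ∑ j ∈ Finset.range n, x (j + 1) ω)
    (t := -(θ / t)) t (by have : 0 ≤ θ / t := by positivity
                          linarith)
    (exp_int hU hUn (θ / t) (by positivity))
  have e1 : - -(θ / t) * t = θ := by field_simp
  rw [e1] at h1
  refine h1.trans ?_
  gcongr
  have hi : iIndepFun (fun j => x (j + 1)) μ := H.ind.precomp (add_left_injective 1)
  have h2 := hi.mgf_sum (t := -(θ / t)) (fun j => H.mx (j + 1)) (Finset.range n)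
  have e2 : (∑ i ∈ Finset.range n, x (i + 1)) = fun ω => ∑ j ∈ Finset.range n, x (j + 1) ω := by
    funext ω; simp
  rw [e2] at h2
  rw [h2]
  have h3 : ∀ j, mgf (x (j + 1)) μ (-(θ / t)) = ∫ ω, Real.exp (-(θ / t) * S ω) ∂μ := by
    intro j
    rw [mgf_congr_identDistrib (Y := S) (μ' := μ)
      ⟨(H.mx _).aemeasurable, H.mS.aemeasurable, H.law j⟩]
    rfl
  simp only [h3, Finset.prod_const, Finset.card_range]
  have := laplace_t H.mS H.nS θ t hθ ht
  have h0 : 0 ≤ ∫ ω, Real.exp (-(θ / t) * S ω) ∂μ := integral_nonneg fun _ => (Real.exp_pos _).le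
  gcongr

lemma RowHyp.unbdd (H : RowHyp μ S r x) (y : ℝ) :
    ∀ᵐ ω ∂μ, ∃ n, y < ∑ j ∈ Finset.range n, x (j + 1) ω := by
  set t := max y 1
  have ht : 1 ≤ t := le_max_right _ _
  obtain ⟨p0, p1⟩ := p_pos H.mS H.nS H.eS 1 one_pos
  set p := 1 - ∫ ω, Real.exp (-1 * S ω) ∂μ
  have hq0 : 0 ≤ 1 - p / t := by
    have : p / t ≤ 1 := by rw [div_le_one (by linarith)]; linarith
    linarith
  have hq1 : 1 - p / t < 1 := by
    have : 0 < p / t := by positivity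
    linarith
  have hlim : Filter.Tendsto (fun n : ℕ => Real.exp 1 * (1 - p / t) ^ n) Filter.atTop (nhds 0) := by
    simpa using (tendsto_pow_atTop_nhds_zero_of_lt_one hq0 hq1).const_mul (Real.exp 1)
  rw [ae_iff]
  have hle : ∀ n, μ.real {ω | ¬ ∃ n, y < ∑ j ∈ Finset.range n, x (j + 1) ω}
      ≤ Real.exp 1 * (1 - p / t) ^ n := by
    intro n
    refine le_trans ?_ (H.tail 1 t one_pos ht n)
    refine measureReal_mono ?_ (measure_ne_top _ _)
    intro ω h
    simp only [Set.mem_ofPred_eq, not_exists, not_lt] at h ⊢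
    exact (h n).trans (le_max_left _ _)
  have h0 : μ.real {ω | ¬ ∃ n, y < ∑ j ∈ Finset.range n, x (j + 1) ω} ≤ 0 :=
    ge_of_tendsto' hlim hle
  have := le_antisymm h0 measureReal_nonneg
  rwa [measureReal_eq_zero_iff] at this

lemma meas_tail (S : Ω → ℝ) : Measurable (fun z : ℝ => μ {ω | z < S ω}) := by
  apply Antitone.measurable
  intro a b hab
  apply measure_mono
  intro ω h
  exact lt_of_le_of_lt hab h

lemma RowHyp.dens_total (H : RowHyp μ S r x) : ∫⁻ z in Set.Ioi (0 : ℝ), μ {ω | z < S ω} = 1 := by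
  rw [← lintegral_eq_lintegral_meas_lt μ H.nS H.mS.aemeasurable,
    ← ofReal_integral_eq_lintegral_ofReal (iS1 H.eS) H.nS, H.eS, ENNReal.ofReal_one]

lemma RowHyp.lawR (H : RowHyp μ S r x) :
    μ.map (x 0) = (volume.restrict (Set.Ioi (0 : ℝ))).withDensity (fun z => μ {ω | z < S ω}) := by
  have : IsProbabilityMeasure (μ.map (x 0)) := Measure.isProbabilityMeasure_map (H.mx 0).aemeasurable
  set ν := (volume.restrict (Set.Ioi (0 : ℝ))).withDensity (fun z => μ {ω | z < S ω}) with hν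
  have : IsProbabilityMeasure ν := ⟨by
    rw [hν, withDensity_apply _ MeasurableSet.univ, Measure.restrict_univ]; exact H.dens_total⟩
  have key : ∀ y, (μ.map (x 0)) (Set.Ioi y) = ν (Set.Ioi y) := by
    intro y
    rw [Measure.map_apply (H.mx 0) measurableSet_Ioi, hν, withDensity_apply _ measurableSet_Ioi,
      Measure.restrict_restrict measurableSet_Ioi]
    rcases lt_or_ge y 0 with h | h
    · rw [Set.inter_eq_right.2 (Set.Ioi_subset_Ioi h.le), H.dens_total]
      rw [prob_compl_eq_zero_iff₀ ?_ |>.symm]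
      · rw [← mem_ae_iff]
        filter_upwards [H.nx 0] with ω hω
        exact lt_of_lt_of_le h hω
      · exact (H.mx 0 measurableSet_Ioi).nullMeasurableSet
    · rw [Set.inter_eq_left.2 (Set.Ioi_subset_Ioi h)]
      have h1 := H.heq y h
      rw [integral_toReal (meas_tail S).aemeasurable (by
        filter_upwards with z; exact measure_lt_top _ _)] at h1
      have h2 : ∫⁻ z in Set.Ioi y, μ {ω | z < S ω} ≤ 1 := by
        rw [← H.dens_total]
        exact lintegral_mono_set (Set.Ioi_subset_Ioi h)
      exact (ENNReal.toReal_eq_toReal_iff' (measure_ne_top _ _)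
        (ne_top_of_le_ne_top ENNReal.one_ne_top h2)).1 h1
  refine Measure.ext_of_Iic _ _ fun y => ?_
  rw [← Set.compl_Ioi, prob_compl_eq_one_sub measurableSet_Ioi, prob_compl_eq_one_sub measurableSet_Ioi,
    key]

lemma RowHyp.lintR (H : RowHyp μ S r x) (f : ℝ → ℝ≥0∞) (hf : Measurable f) :
    ∫⁻ ω, f (x 0 ω) ∂μ = ∫⁻ z in Set.Ici (0 : ℝ), μ {ω | z < S ω} * f z := by
  rw [← lintegral_map hf (H.mx 0), H.lawR, lintegral_withDensity_eq_lintegral_mul _ (meas_tail S) hf,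
    restrict_Ioi_eq_restrict_Ici]
  rfl

end row

lemma lint_ite {Ω : Type*} [MeasurableSpace Ω] {μ : Measure Ω} (p : Ω → Prop) [DecidablePred p]
    (hp : MeasurableSet {ω | p ω}) :
    ∫⁻ ω, (if p ω then (1 : ℝ≥0∞) else 0) ∂μ = μ {ω | p ω} := by
  rw [← lintegral_indicator_one hp]
  apply lintegral_congr
  intro ω
  simp [Set.indicator_apply]

lemma tsum_level (u : ℕ → ℝ) (h0 : u 0 = 0) (hu : Monotone u) (y : ℝ) (hy : ∃ n, y < u n) :
    ∑' n, (if u n ≤ y ∧ y < u (n + 1) then (1 : ℝ≥0∞) else 0) = if 0 ≤ y then 1 else 0 := by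
  classical
  by_cases h : 0 ≤ y
  · rw [if_pos h]
    obtain ⟨m, hm⟩ : ∃ m, Nat.find hy = m + 1 := by
      refine Nat.exists_eq_succ_of_ne_zero fun h1 => ?_
      have := Nat.find_spec hy
      rw [h1, h0] at this
      linarith
    rw [tsum_eq_single m]
    · rw [if_pos]
      refine ⟨not_lt.1 (Nat.find_min hy (m := m) (by omega)), ?_⟩
      rw [← hm]; exact Nat.find_spec hy
    · intro n hn
      rw [if_neg]
      rintro ⟨h1, h2⟩
      have h3 := Nat.find_spec hy
      rw [hm] at h3
      rcases lt_or_gt_of_ne hn with h4 | h4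
      · exact Nat.find_min hy (m := n + 1) (by omega) h2
      · have := hu (show m + 1 ≤ n by omega)
        linarith
  · rw [if_neg h]
    rw [ENNReal.tsum_eq_zero]
    intro n
    rw [if_neg]
    rintro ⟨h1, -⟩
    have := hu (Nat.zero_le n)
    rw [h0] at this
    linarith

section row
variable {Ω : Type*} [MeasurableSpace Ω] {μ : Measure Ω} [IsProbabilityMeasure μ] {S : Ω → ℝ}
  {r : ℝ} {x : ℕ → Ω → ℝ}

lemma RowHyp.mU (H : RowHyp μ S r x) (n : ℕ) :
    Measurable (fun ω => ∑ j ∈ Finset.range n, x (j + 1) ω) :=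
  Finset.measurable_sum _ fun j _ => H.mx (j + 1)

lemma RowHyp.mT (H : RowHyp μ S r x) (n : ℕ) :
    Measurable (fun ω => ∑ j ∈ Finset.range n, x j ω) :=
  Finset.measurable_sum _ fun j _ => H.mx j

lemma RowHyp.sT (n : ℕ) :
    Measurable[sigOf x (Set.Iio n)] (fun ω => ∑ j ∈ Finset.range n, x j ω) :=
  Finset.measurable_sum _ fun j hj => meas_sigOf x _ j (by simpa using hj)

lemma RowHyp.sU (n : ℕ) :
    Measurable[sigOf x (Set.Ioc 0 n)] (fun ω => ∑ j ∈ Finset.range n, x (j + 1) ω) :=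
  Finset.measurable_sum _ fun j hj => meas_sigOf x _ (j + 1) (by
    have := Finset.mem_range.1 hj
    simp; omega)

lemma RowHyp.tail_eq (H : RowHyp μ S r x) (n : ℕ) (z : ℝ) :
    μ {ω | z < S ω} = μ {ω | z < x (n + 1) ω} := by
  have h1 := Measure.map_apply (μ := μ) H.mS (measurableSet_Ioi (a := z))
  have h2 := Measure.map_apply (μ := μ) (H.mx (n + 1)) (measurableSet_Ioi (a := z))
  rw [H.law n] at h2
  exact h1.symm.trans h2

lemma RowHyp.renew_each (H : RowHyp μ S r x) (t : ℝ) (n : ℕ) :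
    μ {ω | ∑ j ∈ Finset.range (n + 1), x j ω ≤ t}
      = ∫⁻ y, (if y ≤ t then 1 else 0) *
        ∫⁻ ω, (if ∑ j ∈ Finset.range n, x (j + 1) ω ≤ y ∧
          y < ∑ j ∈ Finset.range (n + 1), x (j + 1) ω then (1 : ℝ≥0∞) else 0) ∂μ := by
  set U : ℕ → Ω → ℝ := fun n ω => ∑ j ∈ Finset.range n, x (j + 1) ω with hU
  have mU : ∀ n, Measurable (U n) := H.mU
  have mf : Measurable (fun z : ℝ => μ {ω | z < S ω}) := meas_tail S
  have e0 : ∀ ω, ∑ j ∈ Finset.range (n + 1), x j ω = x 0 ω + U n ω := by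
    intro ω; rw [Finset.sum_range_succ', add_comm]
  have i0 : IndepFun (x 0) (U n) μ := by
    refine indep_sigOf H.mx H.ind (I := {0}) (J := Set.Ioc 0 n) ?_
      (meas_sigOf x _ 0 rfl) (RowHyp.sU n)
    simp
  have i1 : IndepFun (x (n + 1)) (U n) μ := by
    refine indep_sigOf H.mx H.ind (I := {n + 1}) (J := Set.Ioc 0 n) ?_
      (meas_sigOf x _ (n + 1) rfl) (RowHyp.sU n)
    simp
  have s1 : μ {ω | ∑ j ∈ Finset.range (n + 1), x j ω ≤ t}
      = ∫⁻ ω, ∫⁻ ω', (if x 0 ω' + U n ω ≤ t then (1 : ℝ≥0∞) else 0) ∂μ ∂μ := by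
    have m1 : Measurable (fun q : ℝ × ℝ => if q.1 + q.2 ≤ t then (1 : ℝ≥0∞) else 0) :=
      Measurable.ite (measurableSet_le (by fun_prop) (by fun_prop)) measurable_const measurable_const
    rw [← indep_lint (H.mx 0) (mU n) i0 (fun q => if q.1 + q.2 ≤ t then (1 : ℝ≥0∞) else 0) m1]
    simp only [e0]
    rw [lint_ite]
    exact measurableSet_le ((H.mx 0).add (mU n)) measurable_const
  have s2 : ∀ ω, ∫⁻ ω', (if x 0 ω' + U n ω ≤ t then (1 : ℝ≥0∞) else 0) ∂μ
      = ∫⁻ y, (if y ≤ t then 1 else 0) *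
        ((if U n ω ≤ y then 1 else 0) * μ {ω' | y - U n ω < S ω'}) := by
    intro ω
    have m2 : Measurable (fun z : ℝ => if z + U n ω ≤ t then (1 : ℝ≥0∞) else 0) :=
      Measurable.ite (measurableSet_le (by fun_prop) (by fun_prop)) measurable_const measurable_const
    rw [H.lintR (fun z => if z + U n ω ≤ t then (1 : ℝ≥0∞) else 0) m2,
      ← lintegral_indicator measurableSet_Ici, ← lintegral_sub_right_eq_self _ (U n ω)]
    apply lintegral_congr
    intro y
    simp only [Set.indicator_apply, Set.mem_Ici, sub_nonneg, sub_add_cancel]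
    by_cases h1 : U n ω ≤ y <;> by_cases h2 : y ≤ t <;> simp [h1, h2]
  rw [s1]
  simp_rw [s2]
  rw [lintegral_lintegral_swap]
  · apply lintegral_congr
    intro y
    rw [lintegral_const_mul']
    · congr 1
      have m3 : Measurable (fun q : ℝ × ℝ =>
          if q.2 ≤ y ∧ y < q.2 + q.1 then (1 : ℝ≥0∞) else 0) := by
        refine Measurable.ite ?_ measurable_const measurable_const
        have a1 : MeasurableSet {q : ℝ × ℝ | q.2 ≤ y} := measurableSet_le (by fun_prop) (by fun_prop)
        have a2 : MeasurableSet {q : ℝ × ℝ | y < q.2 + q.1} :=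
          measurableSet_lt (by fun_prop) (by fun_prop)
        exact a1.inter a2
      have := indep_lint (H.mx (n + 1)) (mU n) i1 _ m3
      have e3 : ∀ ω, U (n + 1) ω = U n ω + x (n + 1) ω := by
        intro ω; simp only [hU]; rw [Finset.sum_range_succ]
      change _ = ∫⁻ ω, (if U n ω ≤ y ∧ y < U (n + 1) ω then (1 : ℝ≥0∞) else 0) ∂μ
      simp only [e3]
      rw [this]
      apply lintegral_congr
      intro ω
      rw [H.tail_eq n]
      by_cases h1 : U n ω ≤ y
      · simp only [h1, true_and, if_true, one_mul]
        rw [lint_ite]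
        · congr 1
          ext ω'
          simp only [Set.mem_ofPred_eq]
          constructor <;> intro h <;> linarith
        · exact measurableSet_lt measurable_const ((H.mx _).const_add _)
      · simp [h1]
    · split_ifs <;> simp
  · apply Measurable.aemeasurable
    refine Measurable.mul ?_ (Measurable.mul ?_ ?_)
    · exact Measurable.ite (measurableSet_le (by fun_prop) (by fun_prop)) measurable_const
        measurable_const
    · exact Measurable.ite (measurableSet_le (by fun_prop) (by fun_prop)) measurable_const
        measurable_const
    · exact mf.comp (measurable_snd.sub ((mU n).comp measurable_fst))

lemma RowHyp.renew (H : RowHyp μ S r x) (t : ℝ) :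
    ∑' n, μ {ω | ∑ j ∈ Finset.range (n + 1), x j ω ≤ t} = ENNReal.ofReal t := by
  simp_rw [H.renew_each t]
  set U : ℕ → Ω → ℝ := fun n ω => ∑ j ∈ Finset.range n, x (j + 1) ω with hU
  have mU : ∀ n, Measurable (U n) := H.mU
  have mI : ∀ n, Measurable (fun q : ℝ × Ω =>
      if U n q.2 ≤ q.1 ∧ q.1 < U (n + 1) q.2 then (1 : ℝ≥0∞) else 0) := by
    intro n
    refine Measurable.ite ?_ measurable_const measurable_const
    have a1 : MeasurableSet {q : ℝ × Ω | U n q.2 ≤ q.1} := measurableSet_le (by fun_prop) (by fun_prop)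
    have a2 : MeasurableSet {q : ℝ × Ω | q.1 < U (n + 1) q.2} :=
      measurableSet_lt (by fun_prop) (by fun_prop)
    exact a1.inter a2
  rw [← lintegral_tsum]
  · have : ∀ y : ℝ, ∑' n, (if y ≤ t then 1 else 0) * ∫⁻ ω, (if U n ω ≤ y ∧
          y < U (n + 1) ω then (1 : ℝ≥0∞) else 0) ∂μ
        = (Set.Icc 0 t).indicator (fun _ => 1) y := by
      intro y
      rw [ENNReal.tsum_mul_left, ← lintegral_tsum]
      · have : ∫⁻ ω, ∑' n, (if U n ω ≤ y ∧ y < U (n + 1) ω then (1 : ℝ≥0∞) else 0) ∂μ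
            = ∫⁻ ω, (if 0 ≤ y then 1 else 0) ∂μ := by
          apply lintegral_congr_ae
          filter_upwards [ae_all_iff.2 H.nx, H.unbdd y] with ω h1 h2
          refine tsum_level (fun n => U n ω) (by simp [hU]) ?_ y h2
          refine monotone_nat_of_le_succ fun n => ?_
          simp only [hU]
          rw [Finset.sum_range_succ]
          linarith [h1 (n + 1)]
        rw [this]
        by_cases h1 : 0 ≤ y <;> by_cases h2 : y ≤ t <;> simp [h1, h2, Set.indicator_apply]
      · intro n
        exact ((mI n).comp (measurable_const.prodMk measurable_id)).aemeasurable
    simp_rw [hU] at this ⊢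
    simp_rw [this]
    rw [lintegral_indicator measurableSet_Icc]
    simp
  · intro n
    apply Measurable.aemeasurable
    refine Measurable.mul ?_ ?_
    · exact Measurable.ite (measurableSet_le (by fun_prop) (by fun_prop)) measurable_const
        measurable_const
    · exact Measurable.lintegral_prod_right' (mI n)

lemma RowHyp.minR (H : RowHyp μ S r x) (t : ℝ) (ht : 1 ≤ t) :
    ∫⁻ ω, ENNReal.ofReal (min (x 0 ω) t ^ r) ∂μ ≤ ENNReal.ofReal (t * ∫ ω, S ω ^ r ∂μ) := by
  have hr := H.hr
  have m1 : Measurable (fun z : ℝ => ENNReal.ofReal (min z t ^ r)) :=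
    ((measurable_id.min measurable_const).pow_const r).ennreal_ofReal
  rw [H.lintR (fun z => ENNReal.ofReal (min z t ^ r)) m1]
  have e1 : ∀ z : ℝ, μ {ω | z < S ω} = ∫⁻ ω, (if z < S ω then (1 : ℝ≥0∞) else 0) ∂μ := by
    intro z
    rw [lint_ite]
    exact measurableSet_lt measurable_const H.mS
  simp_rw [e1]
  have mI : Measurable (fun q : ℝ × Ω => if q.1 < S q.2 then (1 : ℝ≥0∞) else 0) :=
    have := H.mS
    Measurable.ite (measurableSet_lt (by fun_prop) (by fun_prop)) measurable_const measurable_const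
  calc ∫⁻ z in Set.Ici (0 : ℝ), (∫⁻ ω, (if z < S ω then (1 : ℝ≥0∞) else 0) ∂μ)
          * ENNReal.ofReal (min z t ^ r)
      = ∫⁻ z in Set.Ici (0 : ℝ), ∫⁻ ω, (if z < S ω then (1 : ℝ≥0∞) else 0)
          * ENNReal.ofReal (min z t ^ r) ∂μ := by
        apply lintegral_congr
        intro z
        rw [lintegral_mul_const' _ _ ENNReal.ofReal_ne_top]
    _ = ∫⁻ ω, (∫⁻ z in Set.Ici (0 : ℝ), (if z < S ω then (1 : ℝ≥0∞) else 0)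
          * ENNReal.ofReal (min z t ^ r)) ∂μ := by
        rw [lintegral_lintegral_swap]
        exact (mI.mul (m1.comp measurable_fst)).aemeasurable
    _ ≤ ∫⁻ ω, ENNReal.ofReal (t * S ω ^ r) ∂μ := by
        apply lintegral_mono_ae
        filter_upwards [H.nS] with ω hS
        calc ∫⁻ z in Set.Ici (0 : ℝ), (if z < S ω then (1 : ℝ≥0∞) else 0)
                * ENNReal.ofReal (min z t ^ r)
            ≤ ∫⁻ z in Set.Ici (0 : ℝ), (Set.Icc 0 (S ω)).indicator
                (fun _ => ENNReal.ofReal (t * S ω ^ (r - 1))) z := by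
              apply setLIntegral_mono' measurableSet_Ici
              intro z hz
              have hz : 0 ≤ z := hz
              by_cases h : z < S ω
              · rw [Set.indicator_of_mem (show z ∈ Set.Icc 0 (S ω) from ⟨hz, h.le⟩), if_pos h, one_mul]
                apply ENNReal.ofReal_le_ofReal
                have hm : 0 ≤ min z t := le_min hz (by linarith)
                have e : min z t ^ r = min z t * min z t ^ (r - 1) := by
                  rw [mul_comm, ← Real.rpow_add_one' hm (by linarith)]; ring_nf
                rw [e]
                gcongr
                · exact min_le_right _ _
                · linarith
                · exact (min_le_left _ _).trans h.le
              · simp [h]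
          _ ≤ ∫⁻ z, (Set.Icc 0 (S ω)).indicator
                (fun _ => ENNReal.ofReal (t * S ω ^ (r - 1))) z := setLIntegral_le_lintegral _ _
          _ = ENNReal.ofReal (t * S ω ^ r) := by
              rw [lintegral_indicator measurableSet_Icc, setLIntegral_const, Real.volume_Icc, sub_zero,
                ← ENNReal.ofReal_mul (by positivity), mul_assoc,
                ← Real.rpow_add_one' hS (by linarith)]
              ring_nf
    _ = ENNReal.ofReal (t * ∫ ω, S ω ^ r ∂μ) := by
        rw [← integral_const_mul, ofReal_integral_eq_lintegral_ofReal (H.iS.const_mul t)]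
        filter_upwards [H.nS] with ω hS
        positivity

lemma RowHyp.lint_x (H : RowHyp μ S r x) (n : ℕ) (f : ℝ → ℝ≥0∞) (hf : Measurable f) :
    ∫⁻ ω, f (x (n + 1) ω) ∂μ = ∫⁻ ω, f (S ω) ∂μ := by
  rw [← lintegral_map hf (H.mx _), H.law n, lintegral_map hf H.mS]

lemma RowHyp.overshoot (H : RowHyp μ S r x) (t : ℝ) (ht : 1 ≤ t) :
    ∫⁻ ω, ∑' n, (if ∑ j ∈ Finset.range (n + 1), x j ω ≤ t then (1 : ℝ≥0∞) else 0)
      * ENNReal.ofReal (x (n + 1) ω ^ r) ∂μ = ENNReal.ofReal (t * ∫ ω, S ω ^ r ∂μ) := by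
  have mA : ∀ n, Measurable (fun ω => if ∑ j ∈ Finset.range (n + 1), x j ω ≤ t then (1 : ℝ≥0∞) else 0) :=
    fun n => Measurable.ite (measurableSet_le (H.mT _) measurable_const) measurable_const
      measurable_const
  have mB : ∀ n, Measurable (fun ω => ENNReal.ofReal (x (n + 1) ω ^ r)) :=
    fun n => ((H.mx _).pow_const r).ennreal_ofReal
  rw [lintegral_tsum (f := fun n ω => (if ∑ j ∈ Finset.range (n + 1), x j ω ≤ t then (1 : ℝ≥0∞) else 0)
      * ENNReal.ofReal (x (n + 1) ω ^ r)) (fun n => ((mA n).mul (mB n)).aemeasurable)]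
  have key : ∀ n, ∫⁻ ω, (if ∑ j ∈ Finset.range (n + 1), x j ω ≤ t then (1 : ℝ≥0∞) else 0)
      * ENNReal.ofReal (x (n + 1) ω ^ r) ∂μ
      = μ {ω | ∑ j ∈ Finset.range (n + 1), x j ω ≤ t} * ENNReal.ofReal (∫ ω, S ω ^ r ∂μ) := by
    intro n
    have hi : IndepFun (fun ω => if ∑ j ∈ Finset.range (n + 1), x j ω ≤ t then (1 : ℝ≥0∞) else 0)
        (fun ω => ENNReal.ofReal (x (n + 1) ω ^ r)) μ := by
      refine indep_sigOf H.mx H.ind (I := Set.Iio (n + 1)) (J := {n + 1}) (by simp) ?_ ?_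
      · refine Measurable.ite ?_ measurable_const measurable_const
        exact (RowHyp.sT (n + 1)) measurableSet_Iic
      · exact ((meas_sigOf x {n + 1} (n + 1) rfl).pow_const r).ennreal_ofReal
    have := lintegral_mul_eq_lintegral_mul_lintegral_of_indepFun (mA n) (mB n) hi
    simp only [Pi.mul_apply] at this
    rw [this, lint_ite _ (measurableSet_le (H.mT _) measurable_const)]
    congr 1
    rw [H.lint_x n (fun z => ENNReal.ofReal (z ^ r)) (measurable_id.pow_const r).ennreal_ofReal,
      ofReal_integral_eq_lintegral_ofReal H.iS]
    filter_upwards [H.nS] with ω h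
    positivity
  simp_rw [key]
  rw [ENNReal.tsum_mul_right, H.renew, ENNReal.ofReal_mul (by linarith)]

end row

set_option linter.unusedSectionVars false
section row4
variable {Ω : Type*} [MeasurableSpace Ω] {μ : Measure Ω} [IsProbabilityMeasure μ] {S : Ω → ℝ}
  {r : ℝ} {x : ℕ → Ω → ℝ}

lemma RowHyp.idd (H : RowHyp μ S r x) (n : ℕ) : IdentDistrib (x (n + 1)) S μ μ :=
  ⟨(H.mx _).aemeasurable, H.mS.aemeasurable, H.law n⟩

lemma RowHyp.rho_ge (H : RowHyp μ S r x) : 1 ≤ ∫ ω, S ω ^ r ∂μ := by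
  have hr := H.hr
  have i1 : Integrable (fun ω => 1 + r * (S ω - 1)) μ :=
    (integrable_const 1).add (((iS1 H.eS).sub (integrable_const 1)).const_mul r)
  have h : ∫ ω, (1 + r * (S ω - 1)) ∂μ ≤ ∫ ω, S ω ^ r ∂μ := by
    apply integral_mono_ae i1 H.iS
    filter_upwards [H.nS] with ω h
    have := rp_tangent r (by linarith) (S ω) 1 h zero_le_one
    simpa using this
  have e : ∫ ω, (1 + r * (S ω - 1)) ∂μ = 1 := by
    have i2 : Integrable (fun ω => r * (S ω - 1)) μ :=
      ((iS1 H.eS).sub (integrable_const 1)).const_mul r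
    rw [integral_add (integrable_const 1) i2,
      integral_const_mul, integral_sub (iS1 H.eS) (integrable_const 1), H.eS]
    simp
  linarith

lemma RowHyp.centered (H : RowHyp μ S r x) :
    Integrable (fun ω => |S ω - 1| ^ r) μ ∧ ∫ ω, |S ω - 1| ^ r ∂μ ≤ 2 * ∫ ω, S ω ^ r ∂μ := by
  have hr := H.hr
  have i1 : Integrable (fun ω => S ω ^ r + 1) μ := H.iS.add (integrable_const 1)
  have hb : ∀ᵐ ω ∂μ, |S ω - 1| ^ r ≤ S ω ^ r + 1 := by
    filter_upwards [H.nS] with ω h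
    rcases le_total 1 (S ω) with h1 | h1
    · have : |S ω - 1| ^ r ≤ S ω ^ r := by
        apply Real.rpow_le_rpow (abs_nonneg _) _ (by linarith)
        rw [abs_of_nonneg (by linarith)]; linarith
      linarith
    · have : |S ω - 1| ^ r ≤ 1 := by
        apply Real.rpow_le_one (abs_nonneg _) _ (by linarith)
        rw [abs_of_nonpos (by linarith)]; linarith
      have := Real.rpow_nonneg h r
      linarith
  have mm : Measurable (fun ω => |S ω - 1| ^ r) := ((H.mS.sub_const 1).abs.pow_const r)
  have i2 : Integrable (fun ω => |S ω - 1| ^ r) μ := by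
    refine i1.mono' mm.aestronglyMeasurable ?_
    filter_upwards [hb] with ω h
    rwa [Real.norm_of_nonneg (by positivity)]
  refine ⟨i2, ?_⟩
  have h := integral_mono_ae i2 i1 hb
  rw [integral_add H.iS (integrable_const 1)] at h
  have := H.rho_ge
  simp at h
  linarith

lemma RowHyp.incr (H : RowHyp μ S r x) (n : ℕ) :
    Integrable (fun ω => |x (n + 1) ω - 1| ^ r) μ ∧
      ∫ ω, |x (n + 1) ω - 1| ^ r ∂μ ≤ 2 * ∫ ω, S ω ^ r ∂μ ∧
      Integrable (fun ω => x (n + 1) ω - 1) μ ∧ ∫ ω, (x (n + 1) ω - 1) ∂μ = 0 := by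
  have h1 := (H.idd n).comp (u := fun z : ℝ => |z - 1| ^ r)
    ((measurable_id.sub_const 1).abs.pow_const r)
  have h2 := (H.idd n).comp (u := fun z : ℝ => z - 1) (measurable_id.sub_const 1)
  refine ⟨h1.integrable_iff.2 H.centered.1, ?_, h2.integrable_iff.2 ?_, ?_⟩
  · exact h1.integral_eq.trans_le H.centered.2
  · exact (iS1 H.eS).sub (integrable_const 1)
  · refine h2.integral_eq.trans ?_
    simp only [Function.comp_def]
    rw [integral_sub (iS1 H.eS) (integrable_const 1), H.eS]
    simp

noncomputable def mD (x : ℕ → Ω → ℝ) (t : ℝ) (n : ℕ) (ω : Ω) : ℝ :=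
  (if ∑ j ∈ Finset.range (n + 1), x j ω ≤ t then 1 else 0) * (x (n + 1) ω - 1)

lemma RowHyp.sI (t : ℝ) (n : ℕ) : Measurable[sigOf x (Set.Iio (n + 1))]
    (fun ω => if ∑ j ∈ Finset.range (n + 1), x j ω ≤ t then (1 : ℝ) else 0) := by
  let _ := sigOf x (Set.Iio (n + 1))
  exact Measurable.ite (measurableSet_le (RowHyp.sT (n + 1)) measurable_const) measurable_const
    measurable_const

lemma sigOf_mono {ι : Type*} (ξ : ι → Ω → ℝ) {I J : Set ι} (h : I ⊆ J) : sigOf ξ I ≤ sigOf ξ J :=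
  biSup_mono fun _ hi => h hi

lemma RowHyp.sD (t : ℝ) (n : ℕ) : Measurable[sigOf x (Set.Iio (n + 2))] (mD x t n) := by
  have h1 := (RowHyp.sI (x := x) t n).mono (sigOf_mono x (J := Set.Iio (n + 2))
    (Set.Iio_subset_Iio (by omega))) le_rfl
  have h2 := meas_sigOf x (Set.Iio (n + 2)) (n + 1) (by simp)
  let _ := sigOf x (Set.Iio (n + 2))
  have h3 : Measurable (x (n + 1)) := h2
  exact Measurable.mul h1 (h3.sub_const 1)

lemma RowHyp.sM (t : ℝ) (n : ℕ) : Measurable[sigOf x (Set.Iio (n + 1))]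
    (fun ω => ∑ j ∈ Finset.range n, mD x t j ω) :=
  Finset.measurable_sum _ fun j hj => (RowHyp.sD t j).mono (sigOf_mono x
    (Set.Iio_subset_Iio (by have := Finset.mem_range.1 hj; omega))) le_rfl

lemma RowHyp.mart_h0 (H : RowHyp μ S r x) (t : ℝ) (n : ℕ)
    (hi : Integrable (fun ω => |∑ j ∈ Finset.range n, mD x t j ω| ^ r) μ) :
    Integrable (fun ω => |∑ j ∈ Finset.range n, mD x t j ω| ^ (r - 2) *
        (∑ j ∈ Finset.range n, mD x t j ω) * mD x t n ω) μ ∧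
      ∫ ω, |∑ j ∈ Finset.range n, mD x t j ω| ^ (r - 2) *
        (∑ j ∈ Finset.range n, mD x t j ω) * mD x t n ω ∂μ = 0 := by
  have hle := sigOf_le x H.mx (Set.Iio (n + 1))
  apply orth_moment r H.hr (fun ω => ∑ j ∈ Finset.range n, mD x t j ω)
    (fun ω => if ∑ j ∈ Finset.range (n + 1), x j ω ≤ t then (1 : ℝ) else 0)
    (fun ω => x (n + 1) ω - 1) ((RowHyp.sM t n).mono hle le_rfl)
    ((RowHyp.sI t n).mono hle le_rfl) (fun ω => by split_ifs <;> simp) hi (H.incr n).2.2.1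
    (H.incr n).2.2.2
  refine indep_sigOf H.mx H.ind (I := Set.Iio (n + 1)) (J := {n + 1}) (by simp) ?_ ?_
  · let _ := sigOf x (Set.Iio (n + 1))
    have h1 : Measurable (fun ω => ∑ j ∈ Finset.range n, mD x t j ω) := RowHyp.sM t n
    exact ((h1.abs.pow_const _).mul h1).mul (RowHyp.sI t n)
  · let _ := sigOf x {n + 1}
    have h1 : Measurable (x (n + 1)) := meas_sigOf x {n + 1} (n + 1) rfl
    exact h1.sub_const 1

lemma RowHyp.tailT (H : RowHyp μ S r x) (θ t : ℝ) (hθ : 0 < θ) (ht : 1 ≤ t) (n : ℕ) :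
    μ.real {ω | ∑ j ∈ Finset.range (n + 1), x j ω ≤ t}
      ≤ Real.exp θ * (1 - (1 - ∫ ω, Real.exp (-θ * S ω) ∂μ) / t) ^ n := by
  refine le_trans ?_ (H.tail θ t hθ ht n)
  apply ENNReal.toReal_mono (measure_ne_top _ _)
  apply measure_mono_ae
  filter_upwards [H.nx 0] with ω h h1
  have h1 : ∑ j ∈ Finset.range (n + 1), x j ω ≤ t := h1
  rw [Finset.sum_range_succ'] at h1
  show ∑ j ∈ Finset.range n, x (j + 1) ω ≤ t
  linarith

lemma RowHyp.mD_moment (H : RowHyp μ S r x) (θ t : ℝ) (hθ : 0 < θ) (ht : 1 ≤ t) (n : ℕ) :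
    Integrable (fun ω => |mD x t n ω| ^ r) μ ∧ ∫ ω, |mD x t n ω| ^ r ∂μ ≤
      Real.exp θ * (1 - (1 - ∫ ω, Real.exp (-θ * S ω) ∂μ) / t) ^ n * (2 * ∫ ω, S ω ^ r ∂μ) := by
  have hr := H.hr
  set A : Ω → ℝ := fun ω => if ∑ j ∈ Finset.range (n + 1), x j ω ≤ t then (1 : ℝ) else 0 with hA
  have e : (fun ω => |mD x t n ω| ^ r) = fun ω => A ω * |x (n + 1) ω - 1| ^ r := by
    ext ω
    simp only [mD, hA]
    split_ifs
    · simp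
    · simp [Real.zero_rpow (show r ≠ 0 by linarith)]
  have hle := sigOf_le x H.mx (Set.Iio (n + 1))
  have mA : Measurable A := (RowHyp.sI t n).mono hle le_rfl
  have hind : IndepFun A (fun ω => |x (n + 1) ω - 1| ^ r) μ := by
    refine indep_sigOf H.mx H.ind (I := Set.Iio (n + 1)) (J := {n + 1}) (by simp)
      (RowHyp.sI t n) ?_
    let _ := sigOf x {n + 1}
    have h1 : Measurable (x (n + 1)) := meas_sigOf x {n + 1} (n + 1) rfl
    exact (h1.sub_const 1).abs.pow_const r
  have ms : MeasurableSet {ω | ∑ j ∈ Finset.range (n + 1), x j ω ≤ t} :=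
    measurableSet_le (H.mT _) measurable_const
  have eA : A = Set.indicator {ω | ∑ j ∈ Finset.range (n + 1), x j ω ≤ t} 1 := by
    ext ω; simp [hA, Set.indicator_apply]
  have iA : Integrable A μ := by
    rw [eA]; exact (integrable_const (1 : ℝ)).indicator ms
  have vA : ∫ ω, A ω ∂μ = μ.real {ω | ∑ j ∈ Finset.range (n + 1), x j ω ≤ t} := by
    rw [eA, integral_indicator_one ms]
  rw [e]
  refine ⟨hind.integrable_mul iA (H.incr n).1, ?_⟩
  have := hind.integral_mul_eq_mul_integral iA.aestronglyMeasurable (H.incr n).1.aestronglyMeasurable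
  refine (le_of_eq this).trans ?_
  rw [vA]
  have h2 := H.tailT θ t hθ ht n
  have h3 := (H.incr n).2.1
  have h4 : 0 ≤ ∫ ω, |x (n + 1) ω - 1| ^ r ∂μ := integral_nonneg fun ω => by positivity
  exact mul_le_mul h2 h3 h4 (measureReal_nonneg.trans h2)

lemma geo_bound (r q c : ℝ) (hr : 2 ≤ r) (q0 : 0 < q) (q1 : q < 1) (hc : 0 < c) (n : ℕ) :
    ∑ j ∈ Finset.range n, ((c * (1 - q) ^ j) ^ (1 / r)) ^ 2 ≤ c ^ (2 / r) * (r / (2 * q)) := by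
  set b := (1 - q) ^ (2 / r) with hb
  have hq : 0 < 1 - q := by linarith
  have hb0 : 0 ≤ b := by positivity
  have hb1 : b ≤ 1 - 2 / r * q := by
    have := rpow_one_add_le_one_add_mul_self (s := -q) (by linarith) (p := 2 / r)
      (by positivity) (by rw [div_le_one (by linarith)]; linarith)
    rw [hb]
    calc (1 - q) ^ (2 / r) = (1 + -q) ^ (2 / r) := by ring_nf
      _ ≤ _ := this
      _ = _ := by ring
  have h2 : 0 < 2 / r * q := by positivity
  have e : ∀ j, ((c * (1 - q) ^ j) ^ (1 / r)) ^ 2 = c ^ (2 / r) * b ^ j := by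
    intro j
    rw [← Real.rpow_natCast _ 2, ← Real.rpow_mul (by positivity), Real.mul_rpow hc.le (by positivity),
      hb, ← Real.rpow_natCast, ← Real.rpow_natCast, ← Real.rpow_mul hq.le, ← Real.rpow_mul hq.le]
    congr 2 <;> push_cast <;> ring
  simp_rw [e]
  rw [← Finset.mul_sum]
  gcongr
  have hs : ∑ j ∈ Finset.range n, b ^ j ≤ (1 - b)⁻¹ := by
    have hb2 : b < 1 := by linarith
    rw [← tsum_geometric_of_lt_one hb0 hb2]
    exact (summable_geometric_of_lt_one hb0 hb2).sum_le_tsum _ fun j _ => by positivity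
  refine hs.trans ?_
  calc (1 - b)⁻¹ ≤ (2 / r * q)⁻¹ := by
        apply inv_anti₀ h2; linarith
    _ = _ := by field_simp

lemma RowHyp.mart (H : RowHyp μ S r x) (θ t : ℝ) (hθ : 0 < θ) (ht : 1 ≤ t) (n : ℕ) :
    Integrable (fun ω => |∑ j ∈ Finset.range n, mD x t j ω| ^ r) μ ∧
    ∫ ω, |∑ j ∈ Finset.range n, mD x t j ω| ^ r ∂μ ≤
      (4 * r ^ 3 * t / (1 - ∫ ω, Real.exp (-θ * S ω) ∂μ)) ^ (r / 2) *
        (2 * Real.exp θ * ∫ ω, S ω ^ r ∂μ) := by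
  obtain ⟨p0, p1⟩ := p_pos H.mS H.nS H.eS θ hθ
  have hr := H.hr
  have hρ := H.rho_ge
  have hM := fun n => H.mD_moment θ t hθ ht n
  set p := 1 - ∫ ω, Real.exp (-θ * S ω) ∂μ with hp
  set ρ := ∫ ω, S ω ^ r ∂μ
  set c := 2 * Real.exp θ * ρ with hc
  have hc0 : 0 < c := by positivity
  have q0 : 0 < p / t := by positivity
  have q1 : p / t < 1 := by rw [div_lt_one (by linarith)]; linarith
  have hq : 0 < 1 - p / t := by linarith
  set ε := c ^ (2 / r) * (r / (2 * (p / t))) with hε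
  have hε0 : 0 < ε := by positivity
  have h := mart_moment μ r ε hr hε0 (fun n => (c * (1 - p / t) ^ n) ^ (1 / r))
    (fun n => by positivity) (mD x t)
    (fun n => (RowHyp.sD t n).mono (sigOf_le x H.mx _) le_rfl) (fun n => (hM n).1)
    (fun n => by
      refine (hM n).2.trans (le_of_eq ?_)
      rw [← Real.rpow_mul (by positivity), one_div_mul_cancel (by linarith), Real.rpow_one, hc]
      ring) (fun n => H.mart_h0 t n) n
  refine ⟨h.1, h.2.trans ?_⟩
  have hg := geo_bound r (p / t) c hr q0 q1 hc0 n
  calc (ε + 6 * r ^ 2 * ∑ j ∈ Finset.range n, ((c * (1 - p / t) ^ j) ^ (1 / r)) ^ 2) ^ (r / 2)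
      ≤ (ε + 6 * r ^ 2 * ε) ^ (r / 2) := by
        apply Real.rpow_le_rpow _ _ (by linarith)
        · have : 0 ≤ ∑ j ∈ Finset.range n, ((c * (1 - p / t) ^ j) ^ (1 / r)) ^ 2 :=
            Finset.sum_nonneg fun j _ => by positivity
          positivity
        · gcongr
    _ ≤ ((4 * r ^ 3 * t / p) * c ^ (2 / r)) ^ (r / 2) := by
        apply Real.rpow_le_rpow (by positivity) _ (by linarith)
        rw [hε]
        have e1 : c ^ (2 / r) * (r / (2 * (p / t))) + 6 * r ^ 2 * (c ^ (2 / r) * (r / (2 * (p / t))))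
          = ((1 + 6 * r ^ 2) * r / 2 * t / p) * c ^ (2 / r) := by field_simp
        rw [e1]
        gcongr
        nlinarith [mul_self_nonneg r, mul_nonneg (by linarith : 0 ≤ r) (by nlinarith : 0 ≤ 2 * r ^ 2 - 1)]
    _ = _ := by
        rw [Real.mul_rpow (by positivity) (by positivity), ← Real.rpow_mul hc0.le]
        congr 1
        rw [show 2 / r * (r / 2) = 1 by field_simp, Real.rpow_one]

end row4
set_option linter.unusedSectionVars false

lemma sum_mono_of_nonneg (x : ℕ → ℝ) (hx : ∀ j, 0 ≤ x j) :
    Monotone (fun n => ∑ j ∈ Finset.range n, x j) :=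
  monotone_nat_of_le_succ fun n => by
    rw [Finset.sum_range_succ]; linarith [hx n]

lemma count_iff (x : ℕ → ℝ) (hx : ∀ j, 0 ≤ x j) (t : ℝ) (ht : 0 ≤ t)
    (hu : ∃ n, t < ∑ j ∈ Finset.range n, x j) (n : ℕ) :
    ∑ j ∈ Finset.range n, x j ≤ t ↔ n ≤ renewalCount x t := by
  obtain ⟨m, hm⟩ := hu
  have hmono := sum_mono_of_nonneg x hx
  have hb : BddAbove {n : ℕ | ∑ i ∈ Finset.range n, x i ≤ t} := by
    refine ⟨m, fun k hk => ?_⟩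
    have hk : ∑ i ∈ Finset.range k, x i ≤ t := hk
    by_contra h
    have := hmono (le_of_lt (not_le.1 h))
    simp only at this
    linarith
  constructor
  · intro h
    exact le_csSup hb h
  · intro h
    have h1 : renewalCount x t ∈ {n : ℕ | ∑ i ∈ Finset.range n, x i ≤ t} :=
      Nat.sSup_mem ⟨0, by simpa using ht⟩ hb
    exact (hmono h).trans h1

lemma count_tsum (x : ℕ → ℝ) (t : ℝ) (N : ℕ)
    (hN : ∀ n, ∑ j ∈ Finset.range n, x j ≤ t ↔ n ≤ N) :
    ∑' n, (if ∑ j ∈ Finset.range (n + 1), x j ≤ t then (1 : ℝ≥0∞) else 0) = N := by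
  rw [tsum_eq_sum (s := Finset.range N)]
  · rw [Finset.sum_congr rfl (g := fun _ => (1 : ℝ≥0∞))]
    · simp
    · intro n hn
      rw [if_pos ((hN _).2 (Finset.mem_range.1 hn))]
  · intro n hn
    rw [if_neg]
    rw [hN]
    simpa using hn

lemma three_pow (r a b c : ℝ) (hr : 2 ≤ r) (ha : 0 ≤ a) (hb : 0 ≤ b) (hc : 0 ≤ c) :
    (a + b + c) ^ r ≤ 3 ^ r * (a ^ r + b ^ r + c ^ r) := by
  have key : ∀ m : ℝ, 0 ≤ m → a ≤ m → b ≤ m → c ≤ m → (a + b + c) ^ r ≤ 3 ^ r * m ^ r := by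
    intro m h0 h1 h2 h3
    rw [← Real.mul_rpow (by norm_num) h0]
    apply Real.rpow_le_rpow (by positivity) _ (by linarith)
    linarith
  have ha' := Real.rpow_nonneg ha r
  have hb' := Real.rpow_nonneg hb r
  have hc' := Real.rpow_nonneg hc r
  have h3 : (0 : ℝ) ≤ 3 ^ r := by positivity
  rcases le_total a b with h1 | h1 <;> rcases le_total b c with h2 | h2 <;>
    rcases le_total a c with h4 | h4
  · exact (key c hc h4 h2 le_rfl).trans (mul_le_mul_of_nonneg_left (by linarith) h3)
  · exact (key a ha le_rfl (by linarith) (by linarith)).trans (mul_le_mul_of_nonneg_left (by linarith) h3)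
  · exact (key b hb h1 le_rfl h2).trans (mul_le_mul_of_nonneg_left (by linarith) h3)
  · exact (key b hb h1 le_rfl h2).trans (mul_le_mul_of_nonneg_left (by linarith) h3)
  · exact (key c hc h4 h2 le_rfl).trans (mul_le_mul_of_nonneg_left (by linarith) h3)
  · exact (key a ha le_rfl h1 h4).trans (mul_le_mul_of_nonneg_left (by linarith) h3)
  · exact (key a ha le_rfl h1 (by linarith)).trans (mul_le_mul_of_nonneg_left (by linarith) h3)
  · exact (key a ha le_rfl h1 h4).trans (mul_le_mul_of_nonneg_left (by linarith) h3)

lemma path_bound (r : ℝ) (hr : 2 ≤ r) (x : ℕ → ℝ) (hx : ∀ j, 0 ≤ x j) (t : ℝ) (ht : 0 ≤ t) (N : ℕ)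
    (hN : ∀ n, ∑ j ∈ Finset.range n, x j ≤ t ↔ n ≤ N) (n : ℕ) (hn : N ≤ n) :
    ENNReal.ofReal (|(N : ℝ) - t| ^ r) ≤ ENNReal.ofReal (3 ^ r) *
      (ENNReal.ofReal (min (x 0) t ^ r) +
      (∑' n, (if ∑ j ∈ Finset.range (n + 1), x j ≤ t then (1 : ℝ≥0∞) else 0)
        * ENNReal.ofReal (x (n + 1) ^ r)) +
      ENNReal.ofReal (|∑ i ∈ Finset.range n,
        (if ∑ j ∈ Finset.range (i + 1), x j ≤ t then (1 : ℝ) else 0) * (x (i + 1) - 1)| ^ r)) := by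
  set M := ∑ i ∈ Finset.range n,
        (if ∑ j ∈ Finset.range (i + 1), x j ≤ t then (1 : ℝ) else 0) * (x (i + 1) - 1) with hM
  set V := ∑' n, (if ∑ j ∈ Finset.range (n + 1), x j ≤ t then (1 : ℝ≥0∞) else 0)
        * ENNReal.ofReal (x (n + 1) ^ r) with hV
  have hm : 0 ≤ min (x 0) t := le_min (hx 0) ht
  have hMv : M = ∑ j ∈ Finset.range (N + 1), x j - x 0 - N := by
    have : M = ∑ i ∈ Finset.range N, (x (i + 1) - 1) := by
      rw [hM, ← Finset.sum_subset (Finset.range_subset_range.2 hn)]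
      · apply Finset.sum_congr rfl
        intro i hi
        rw [if_pos ((hN _).2 (Finset.mem_range.1 hi)), one_mul]
      · intro i _ hi
        rw [if_neg, zero_mul]
        rw [hN]
        simpa using hi
    rw [this, Finset.sum_range_succ' x, Finset.sum_sub_distrib]
    simp
  have hgt : t < ∑ j ∈ Finset.range (N + 1), x j := by
    by_contra h
    have := (hN _).1 (not_lt.1 h)
    omega
  obtain ⟨b, hb, hbV, hle⟩ : ∃ b : ℝ, 0 ≤ b ∧ ENNReal.ofReal (b ^ r) ≤ V ∧
      |(N : ℝ) - t| ≤ min (x 0) t + b + |M| := by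
    rcases Nat.eq_zero_or_pos N with h | h
    · refine ⟨0, le_rfl, by simp [Real.zero_rpow (show r ≠ 0 by linarith)], ?_⟩
      subst h
      simp at hgt
      rw [min_eq_right hgt.le]
      simp [abs_of_nonneg ht]
    · obtain ⟨m, rfl⟩ : ∃ m, N = m + 1 := ⟨N - 1, by omega⟩
      have hT := (hN (m + 1)).2 le_rfl
      refine ⟨x (m + 1), hx _, ?_, ?_⟩
      · rw [hV]
        refine le_trans ?_ (ENNReal.le_tsum m)
        rw [if_pos hT, one_mul]
      · have h0 : x 0 ≤ t := by
          have := (hN 1).2 h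
          simpa using this
        rw [min_eq_left h0]
        have e := Finset.sum_range_succ x (m + 1)
        have := hx 0
        have := neg_abs_le M
        have := le_abs_self M
        rw [abs_le]
        constructor <;> linarith
  have h1 : |(N : ℝ) - t| ^ r ≤ 3 ^ r * (min (x 0) t ^ r + b ^ r + |M| ^ r) :=
    (Real.rpow_le_rpow (abs_nonneg _) hle (by linarith)).trans
      (three_pow r _ _ _ hr hm hb (abs_nonneg _))
  refine (ENNReal.ofReal_le_ofReal h1).trans ?_
  rw [ENNReal.ofReal_mul (by positivity), ENNReal.ofReal_add (by positivity) (by positivity),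
    ENNReal.ofReal_add (by positivity) (by positivity)]
  gcongr

section row5
variable {Ω : Type*} [MeasurableSpace Ω] {μ : Measure Ω} [IsProbabilityMeasure μ] {S : Ω → ℝ}
  {r : ℝ} {x : ℕ → Ω → ℝ}

lemma RowHyp.count_ae (H : RowHyp μ S r x) (t : ℝ) (ht : 0 ≤ t) :
    ∀ᵐ ω ∂μ, (∀ j, 0 ≤ x j ω) ∧
      ∀ n, ∑ j ∈ Finset.range n, x j ω ≤ t ↔ n ≤ renewalCount (fun j => x j ω) t := by
  filter_upwards [ae_all_iff.2 H.nx, H.unbdd t] with ω h1 h2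
  refine ⟨h1, fun n => count_iff (fun j => x j ω) h1 t ht ?_ n⟩
  obtain ⟨n, hn⟩ := h2
  refine ⟨n + 1, ?_⟩
  rw [Finset.sum_range_succ']
  linarith [h1 0]

noncomputable def rowC (x : ℕ → Ω → ℝ) (t : ℝ) (ω : Ω) : ℝ≥0∞ :=
  ∑' n, (if ∑ j ∈ Finset.range (n + 1), x j ω ≤ t then (1 : ℝ≥0∞) else 0)

lemma RowHyp.rowC_ae (H : RowHyp μ S r x) (t : ℝ) (ht : 0 ≤ t) :
    ∀ᵐ ω ∂μ, rowC x t ω = (renewalCount (fun j => x j ω) t : ℝ≥0∞) := by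
  filter_upwards [H.count_ae t ht] with ω h
  exact count_tsum (fun j => x j ω) t _ h.2

lemma RowHyp.mC (H : RowHyp μ S r x) (t : ℝ) : Measurable (rowC x t) :=
  Measurable.tsum fun n => Measurable.ite (measurableSet_le (H.mT _) measurable_const)
    measurable_const measurable_const

lemma RowHyp.lint_C (H : RowHyp μ S r x) (t : ℝ) : ∫⁻ ω, rowC x t ω ∂μ = ENNReal.ofReal t := by
  unfold rowC
  rw [lintegral_tsum, ← H.renew t]
  · congr 1
    ext n
    exact lint_ite _ (measurableSet_le (H.mT _) measurable_const)
  · exact fun n => (Measurable.ite (measurableSet_le (H.mT _) measurable_const)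
      measurable_const measurable_const).aemeasurable

lemma RowHyp.row_lint (H : RowHyp μ S r x) (θ t : ℝ) (hθ : 0 < θ) (ht : 1 ≤ t) :
    ∫⁻ ω, ENNReal.ofReal (|(rowC x t ω).toReal - t| ^ r) ∂μ ≤
      ENNReal.ofReal (3 ^ r * (4 * (4 * r ^ 3 * t / (1 - ∫ ω, Real.exp (-θ * S ω) ∂μ)) ^ (r / 2) *
        Real.exp θ * ∫ ω, S ω ^ r ∂μ)) := by
  obtain ⟨p0, p1⟩ := p_pos H.mS H.nS H.eS θ hθ
  have hr := H.hr
  have hρ := H.rho_ge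
  have hmart := H.mart θ t hθ ht
  have hov := H.overshoot t ht
  have hmin := H.minR t ht
  set p := 1 - ∫ ω, Real.exp (-θ * S ω) ∂μ with hp
  set ρ := ∫ ω, S ω ^ r ∂μ
  set K := (4 * r ^ 3 * t / p) ^ (r / 2) with hK
  have hKt : t ≤ K := by
    have h1 : t ≤ 4 * r ^ 3 * t / p := by
      rw [le_div_iff₀ p0]
      have : 1 ≤ r ^ 3 := one_le_pow₀ (by linarith)
      nlinarith
    refine h1.trans ?_
    rw [hK]
    exact Real.self_le_rpow_of_one_le (ht.trans h1) (by linarith)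
  set V : Ω → ℝ≥0∞ := fun ω => ∑' n, (if ∑ j ∈ Finset.range (n + 1), x j ω ≤ t then (1 : ℝ≥0∞) else 0)
      * ENNReal.ofReal (x (n + 1) ω ^ r) with hV
  have mV : Measurable V := Measurable.tsum fun n =>
    (Measurable.ite (measurableSet_le (H.mT _) measurable_const)
      measurable_const measurable_const).mul ((H.mx _).pow_const r).ennreal_ofReal
  have mR : Measurable (fun ω => ENNReal.ofReal (min (x 0 ω) t ^ r)) :=
    (((H.mx 0).min measurable_const).pow_const r).ennreal_ofReal
  have mMn : ∀ n, Measurable (fun ω => ENNReal.ofReal (|∑ j ∈ Finset.range n, mD x t j ω| ^ r)) :=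
    fun n => ((((RowHyp.sM t n).mono (sigOf_le x H.mx _) le_rfl).abs).pow_const r).ennreal_ofReal
  set G : ℕ → Ω → ℝ≥0∞ := fun n ω => ENNReal.ofReal (3 ^ r) *
      (ENNReal.ofReal (min (x 0 ω) t ^ r) + V ω +
        ENNReal.ofReal (|∑ j ∈ Finset.range n, mD x t j ω| ^ r)) with hG
  have mG : ∀ n, Measurable (G n) := fun n => (((mR.add mV).add (mMn n)).const_mul _)
  have hGn : ∀ n, ∫⁻ ω, G n ω ∂μ ≤ ENNReal.ofReal (3 ^ r * (4 * K * Real.exp θ * ρ)) := by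
    intro n
    rw [hG]
    simp only
    rw [lintegral_const_mul' _ _ ENNReal.ofReal_ne_top, lintegral_add_right _ (mMn n),
      lintegral_add_right _ mV, ENNReal.ofReal_mul (by positivity)]
    gcongr
    rw [← ofReal_integral_eq_lintegral_ofReal (hmart n).1 (ae_of_all _ fun ω => by positivity)]
    calc _ ≤ ENNReal.ofReal (t * ρ) + ENNReal.ofReal (t * ρ) + ENNReal.ofReal (K * (2 * Real.exp θ * ρ)) :=
          add_le_add (add_le_add hmin hov.le) (ENNReal.ofReal_le_ofReal (hmart n).2)
      _ ≤ _ := by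
          rw [← ENNReal.ofReal_add (by positivity) (by positivity),
            ← ENNReal.ofReal_add (by positivity) (by positivity)]
          apply ENNReal.ofReal_le_ofReal
          have h1 : 1 ≤ Real.exp θ := Real.one_le_exp hθ.le
          have h2 : t * ρ ≤ K * Real.exp θ * ρ := by
            have : t ≤ K * Real.exp θ := by nlinarith
            gcongr
          nlinarith
  have hae : ∀ᵐ ω ∂μ, ENNReal.ofReal (|(rowC x t ω).toReal - t| ^ r) ≤
      Filter.liminf (fun n => G n ω) Filter.atTop := by
    filter_upwards [H.count_ae t (by linarith), H.rowC_ae t (by linarith)] with ω h1 h2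
    rw [h2]
    apply Filter.le_liminf_of_le
    · isBoundedDefault
    · filter_upwards [Filter.eventually_ge_atTop (renewalCount (fun j => x j ω) t)] with n hn
      exact path_bound r hr (fun j => x j ω) h1.1 t (by linarith) _ h1.2 n hn
  refine (lintegral_mono_ae hae).trans ((lintegral_liminf_le mG).trans ?_)
  refine Filter.liminf_le_of_frequently_le' ?_
  exact Filter.Frequently.of_forall hGn

lemma RowHyp.rowY (H : RowHyp μ S r x) (θ t : ℝ) (hθ : 0 < θ) (ht : 1 ≤ t) :
    Measurable (fun ω => (rowC x t ω).toReal - t) ∧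
    Integrable (fun ω => (rowC x t ω).toReal - t) μ ∧
    ∫ ω, ((rowC x t ω).toReal - t) ∂μ = 0 ∧
    Integrable (fun ω => |(rowC x t ω).toReal - t| ^ r) μ ∧
    ∫ ω, |(rowC x t ω).toReal - t| ^ r ∂μ ≤
      3 ^ r * (4 * (4 * r ^ 3 * t / (1 - ∫ ω, Real.exp (-θ * S ω) ∂μ)) ^ (r / 2) *
        Real.exp θ * ∫ ω, S ω ^ r ∂μ) := by
  obtain ⟨p0, p1⟩ := p_pos H.mS H.nS H.eS θ hθ
  have hr := H.hr
  have hρ := H.rho_ge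
  have hl := H.row_lint θ t hθ ht
  have m1 := (H.mC t).ennreal_toReal.sub_const t
  have hC := H.lint_C t
  have iC : Integrable (fun ω => (rowC x t ω).toReal) μ :=
    integrable_toReal_of_lintegral_ne_top (H.mC t).aemeasurable (by rw [hC]; simp)
  have vC : ∫ ω, (rowC x t ω).toReal ∂μ = t := by
    rw [integral_toReal (H.mC t).aemeasurable, hC, ENNReal.toReal_ofReal (by linarith)]
    exact ae_lt_top (H.mC t) (by rw [hC]; simp)
  have mP : Measurable (fun ω => |(rowC x t ω).toReal - t| ^ r) := m1.abs.pow_const r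
  have iP : Integrable (fun ω => |(rowC x t ω).toReal - t| ^ r) μ := by
    refine ⟨mP.aestronglyMeasurable, ?_⟩
    rw [hasFiniteIntegral_iff_ofReal (ae_of_all _ fun ω => by positivity)]
    exact hl.trans_lt ENNReal.ofReal_lt_top
  refine ⟨m1, iC.sub (integrable_const t), ?_, iP, ?_⟩
  · rw [integral_sub iC (integrable_const t), vC]; simp
  · rw [← ofReal_integral_eq_lintegral_ofReal iP (ae_of_all _ fun ω => by positivity)] at hl
    refine (ENNReal.ofReal_le_ofReal_iff ?_).1 hl
    have : 0 ≤ 4 * r ^ 3 * t / (1 - ∫ ω, Real.exp (-θ * S ω) ∂μ) := by positivity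
    positivity

end row5
lemma final_num (r p t k e ρ : ℝ) (hr : 2 ≤ r) (p0 : 0 < p) (p1 : p < 1) (ht : 1 ≤ t) (hk : 1 ≤ k)
    (he : 0 < e) (hρ : 0 < ρ) :
    (7 * r ^ 2 * k) ^ (r / 2) * (3 ^ r * (4 * (4 * r ^ 3 * t / p) ^ (r / 2) * e * ρ)) ≤
      ρ * e * (10 ^ 8 * r ^ 3 / p) ^ (r + 2) * k ^ (r / 2) * t ^ (r / 2) := by
  set Q := 10 ^ 8 * r ^ 3 / p with hQ
  have hr3 : 8 ≤ r ^ 3 := by nlinarith [mul_self_nonneg (r - 2), sq_nonneg r]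
  have hQ1 : 10 ^ 8 * r ^ 3 ≤ Q := by
    rw [hQ, le_div_iff₀ p0]
    have : 0 ≤ 10 ^ 8 * r ^ 3 := by positivity
    nlinarith
  have hQ0 : 0 < Q := by positivity
  have h3 : (3 : ℝ) ^ r = 9 ^ (r / 2) := by
    rw [show (9 : ℝ) = 3 ^ (2 : ℝ) by norm_num, ← Real.rpow_mul (by norm_num)]
    congr 1; ring
  have hQr : Q ^ r = (Q ^ 2) ^ (r / 2) := by
    rw [← Real.rpow_natCast Q 2, ← Real.rpow_mul hQ0.le]
    congr 1; push_cast; ring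
  have hQ2 : Q ^ (r + 2) = (Q ^ 2) ^ (r / 2) * Q ^ 2 := by
    rw [Real.rpow_add hQ0, hQr]
    congr 1
    exact Real.rpow_natCast Q 2
  have hbase : 7 * r ^ 2 * 9 * (4 * r ^ 3 / p) ≤ Q ^ 2 := by
    have e1 : 7 * r ^ 2 * 9 * (4 * r ^ 3 / p) = (252 * r ^ 2 / 10 ^ 8) * Q := by
      rw [hQ]; field_simp; norm_num
    rw [e1, sq Q]
    apply mul_le_mul_of_nonneg_right _ hQ0.le
    refine le_trans ?_ hQ1
    rw [div_le_iff₀ (by norm_num)]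
    nlinarith [sq_nonneg r, mul_nonneg (sq_nonneg r) (by linarith : 0 ≤ r - 2)]
  have h4 : 4 ≤ Q ^ 2 := by nlinarith
  have eL : (7 * r ^ 2 * k) ^ (r / 2) * (3 ^ r * (4 * (4 * r ^ 3 * t / p) ^ (r / 2) * e * ρ))
      = ρ * e * ((7 * r ^ 2 * 9 * (4 * r ^ 3 / p)) ^ (r / 2) * 4) * k ^ (r / 2) * t ^ (r / 2) := by
    rw [h3, show 4 * r ^ 3 * t / p = (4 * r ^ 3 / p) * t by ring,
      Real.mul_rpow (x := 4 * r ^ 3 / p) (y := t) (by positivity) (by positivity),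
      Real.mul_rpow (x := 7 * r ^ 2) (y := k) (by positivity) (by positivity),
      Real.mul_rpow (x := 7 * r ^ 2 * 9) (by positivity) (by positivity),
      Real.mul_rpow (x := 7 * r ^ 2) (y := 9) (by positivity) (by positivity)]
    ring
  rw [eL, hQ2]
  gcongr

theorem pooled_central_moment_large_time
    {Ω : Type*} [MeasurableSpace Ω] (μ : Measure Ω) [IsProbabilityMeasure μ]
    (S : Ω → ℝ) (hSmeas : Measurable S) (hSnn : ∀ᵐ ω ∂μ, 0 ≤ S ω)
    (hES : ∫ ω, S ω ∂μ = 1)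
    (r : ℝ) (hr : 2 ≤ r)
    (hSr : Integrable (fun ω => S ω ^ r) μ)
    (ξ : ℕ → ℕ → Ω → ℝ)
    (hξmeas : ∀ i j, Measurable (ξ i j))
    (hξnn : ∀ i j, ∀ᵐ ω ∂μ, 0 ≤ ξ i j ω)
    (hindep : iIndepFun (fun p : ℕ × ℕ => ξ p.1 p.2) μ)
    (hlaw : ∀ i j, μ.map (ξ i (j + 1)) = μ.map S)
    (heq : ∀ i, ∀ y : ℝ, 0 ≤ y →
      (μ {ω | y < ξ i 0 ω}).toReal = ∫ z in Set.Ioi y, (μ {ω | z < S ω}).toReal) :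
    ∀ k : ℕ, 1 ≤ k → ∀ t : ℝ, 1 ≤ t → ∀ θ : ℝ, 0 < θ →
      ∫⁻ ω, ENNReal.ofReal
          (|(∑ i ∈ Finset.range k, (renewalCount (fun j => ξ i j ω) t : ℝ)) - (k : ℝ) * t| ^ r) ∂μ
        ≤ ENNReal.ofReal ((∫ ω, S ω ^ r ∂μ) * Real.exp θ
            * (10 ^ 8 * r ^ 3 / (1 - ∫ ω, Real.exp (-θ * S ω) ∂μ)) ^ (r + 2)
            * (k : ℝ) ^ (r / 2) * t ^ (r / 2)) := by
  intro k hk t ht θ hθ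
  have H : ∀ i, RowHyp μ S r (ξ i) := fun i =>
    { mS := hSmeas, nS := hSnn, eS := hES, hr := hr, iS := hSr, mx := hξmeas i, nx := hξnn i
      ind := hindep.precomp (g := fun j : ℕ => ((i, j) : ℕ × ℕ)) (fun a b h => by simpa using h)
      law := hlaw i, heq := heq i }
  obtain ⟨p0, p1⟩ := p_pos hSmeas hSnn hES θ hθ
  have hρ := (H 0).rho_ge
  have hY := fun i => (H i).rowY θ t hθ ht
  set p := 1 - ∫ ω, Real.exp (-θ * S ω) ∂μ with hp
  set ρ := ∫ ω, S ω ^ r ∂μ with hρd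
  set B := 3 ^ r * (4 * (4 * r ^ 3 * t / p) ^ (r / 2) * Real.exp θ * ρ) with hB
  have hB0 : 0 < B := by positivity
  set Y : ℕ → Ω → ℝ := fun i ω => (rowC (ξ i) t ω).toReal - t with hYd
  set ζ : ℕ × ℕ → Ω → ℝ := fun p => ξ p.1 p.2 with hζ
  have mζ : ∀ p, Measurable (ζ p) := fun p => hξmeas _ _
  have sY : ∀ (I : Set (ℕ × ℕ)) i, (∀ j, (i, j) ∈ I) → Measurable[sigOf ζ I] (Y i) := by
    intro I i hI
    let _ := sigOf ζ I
    have h1 : ∀ j, Measurable (ξ i j) := fun j => meas_sigOf ζ I (i, j) (hI j)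
    have h2 : Measurable (rowC (ξ i) t) := Measurable.tsum fun n => Measurable.ite
      (measurableSet_le (Finset.measurable_sum _ fun j _ => h1 j) measurable_const)
      measurable_const measurable_const
    exact h2.ennreal_toReal.sub_const t
  have hk1 : (1 : ℝ) ≤ k := by exact_mod_cast hk
  have hm := mart_moment μ r (B ^ (2 / r)) hr (by positivity) (fun _ => B ^ (1 / r))
    (fun _ => by positivity) Y (fun i => (hY i).1) (fun i => (hY i).2.2.2.1)
    (fun i => by
      refine (hY i).2.2.2.2.trans (le_of_eq ?_)
      rw [← Real.rpow_mul hB0.le, one_div_mul_cancel (by linarith), Real.rpow_one])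
    (fun n hi => by
      have h := orth_moment r hr (fun ω => ∑ j ∈ Finset.range n, Y j ω) (fun _ => 1) (Y n)
        (Finset.measurable_sum _ fun j _ => (hY j).1) measurable_const (fun ω => by simp) hi
        (hY n).2.1 (hY n).2.2.1 ?_
      · simpa only [one_mul] using h
      · refine indep_sigOf mζ hindep (I := {q | q.1 < n}) (J := {q | q.1 = n}) ?_ ?_
          (sY _ n fun j => rfl)
        · rw [Set.disjoint_left]
          intro q hq hq'
          exact absurd hq' (ne_of_lt hq)
        · let _ := sigOf ζ {q | q.1 < n}
          have h1 : Measurable (fun ω => ∑ j ∈ Finset.range n, Y j ω) :=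
            Finset.measurable_sum _ fun j hj => sY _ j fun _ => Finset.mem_range.1 hj
          exact ((h1.abs.pow_const _).mul h1).mul measurable_const) k
  have hae : ∀ᵐ ω ∂μ, ENNReal.ofReal
      (|(∑ i ∈ Finset.range k, (renewalCount (fun j => ξ i j ω) t : ℝ)) - (k : ℝ) * t| ^ r)
      = ENNReal.ofReal (|∑ i ∈ Finset.range k, Y i ω| ^ r) := by
    filter_upwards [ae_all_iff.2 fun i => (H i).rowC_ae t (by linarith)] with ω h
    congr 3
    simp only [hYd]
    rw [Finset.sum_sub_distrib]
    simp [h]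
  rw [lintegral_congr_ae hae,
    ← ofReal_integral_eq_lintegral_ofReal hm.1 (ae_of_all _ fun ω => by positivity)]
  apply ENNReal.ofReal_le_ofReal
  refine hm.2.trans (le_trans ?_ (final_num r p t k (Real.exp θ) ρ hr p0 p1 ht hk1
    (Real.exp_pos _) (by linarith)))
  rw [← hB]
  have e1 : (B ^ (1 / r)) ^ 2 = B ^ (2 / r) := by
    rw [← Real.rpow_natCast, ← Real.rpow_mul hB0.le]
    congr 1; push_cast; ring
  have e2 : B = (B ^ (2 / r)) ^ (r / 2) := by
    rw [← Real.rpow_mul hB0.le, show 2 / r * (r / 2) = 1 by field_simp, Real.rpow_one]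
  rw [Finset.sum_const, Finset.card_range, nsmul_eq_mul, e1]
  conv_rhs => rw [e2]
  rw [← Real.mul_rpow (by positivity) (by positivity)]
  apply Real.rpow_le_rpow (by positivity) _ (by linarith)
  have hb : 0 ≤ B ^ (2 / r) := by positivity
  have : 1 + 6 * r ^ 2 * k ≤ 7 * r ^ 2 * k := by nlinarith [mul_self_nonneg r, mul_nonneg (sq_nonneg r) (by linarith : 0 ≤ (k : ℝ) - 1)]
  nlinarith
end

section
/- Suppose E[S] = 1. Then for all integers k ≥ 1, all p ≥ 2, all t ∈ [0,1], and all θ > 0, E[|∑_{i=1}^k N_i(t) − k t|^p] ≤ exp(θ) (10^3 p^3 / (1 − E[exp(−θS)]))^{p+2} max(k t, (k t)^p). -/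
open MeasureTheory ProbabilityTheory
open scoped ENNReal

noncomputable def domF (θ t : ℝ) (j : ℕ) (y : ℝ) : ℝ≥0∞ :=
  if j = 0 then (Set.Iic t).indicator (fun _ => 1) y else ENNReal.ofReal (Real.exp (-θ * y))

noncomputable def domG (z θ t : ℝ) (x : ℕ → ℝ) : ℝ≥0∞ :=
  1 + ∑' m : ℕ, ENNReal.ofReal ((z - 1) * z ^ m * Real.exp (θ * t)) *
    ∏ j ∈ Finset.range (m + 1), domF θ t j (x j)

lemma measurable_domF (θ t : ℝ) (j : ℕ) : Measurable (domF θ t j) := by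
  unfold domF
  by_cases h : j = 0
  · simp only [h, if_true]
    exact measurable_const.indicator measurableSet_Iic
  · simp only [h, if_false]
    fun_prop

lemma measurable_domG (z θ t : ℝ) : Measurable (domG z θ t) := by
  unfold domG
  refine measurable_const.add (Measurable.ennreal_tsum fun m => ?_)
  refine Measurable.const_mul ?_ _
  refine Finset.measurable_fun_prod _ fun j _ => ?_
  exact (measurable_domF θ t j).comp (measurable_pi_apply j)

lemma pow_renewalCount_le (x : ℕ → ℝ) (hx : ∀ j, 0 ≤ x j) (z θ t : ℝ) (hz : 1 ≤ z)
    (hθ : 0 ≤ θ) :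
    ENNReal.ofReal (z ^ (renewalCount x t)) ≤ domG z θ t x := by
  rcases Nat.eq_zero_or_pos (renewalCount x t) with h0 | hpos
  · rw [h0]; simp [domG]
  · set n := renewalCount x t with hn
    have hmem : ∑ i ∈ Finset.range n, x i ≤ t := by
      have hne : {n : ℕ | ∑ i ∈ Finset.range n, x i ≤ t}.Nonempty := by
        by_contra h
        rw [Set.not_nonempty_iff_eq_empty] at h
        rw [hn, renewalCount, h] at hpos
        simp at hpos
      have hb : BddAbove {n : ℕ | ∑ i ∈ Finset.range n, x i ≤ t} := by
        by_contra h
        have : renewalCount x t = 0 := by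
          rw [renewalCount]; exact Nat.sSup_of_not_bddAbove h
        omega
      exact Nat.sSup_mem hne hb
    have hgeo : z ^ n = 1 + ∑ m ∈ Finset.range n, (z - 1) * z ^ m := by
      rw [← Finset.mul_sum, mul_geom_sum]; ring
    have hterm : ∀ m, 0 ≤ (z - 1) * z ^ m := fun m =>
      mul_nonneg (by linarith) (by positivity)
    rw [hgeo, ENNReal.ofReal_add zero_le_one (Finset.sum_nonneg fun m _ => hterm m),
      ENNReal.ofReal_sum_of_nonneg (fun m _ => hterm m), ENNReal.ofReal_one, domG]
    refine add_le_add le_rfl (le_trans (Finset.sum_le_sum fun m hm => ?_)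
      (ENNReal.sum_le_tsum (Finset.range n)))
    have hm' : m + 1 ≤ n := Finset.mem_range.1 hm
    have hsum : ∑ j ∈ Finset.range (m + 1), x j ≤ t :=
      le_trans (Finset.sum_le_sum_of_subset_of_nonneg (Finset.range_mono hm')
        fun j _ _ => hx j) hmem
    rw [Finset.sum_range_succ'] at hsum
    have hs0 : 0 ≤ ∑ j ∈ Finset.range m, x (j + 1) := Finset.sum_nonneg fun j _ => hx _
    have hx0 : x 0 ≤ t := by linarith
    rw [Finset.prod_range_succ']
    have e1 : domF θ t 0 (x 0) = 1 := by simp [domF, hx0]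
    have e2 : ∏ j ∈ Finset.range m, domF θ t (j + 1) (x (j + 1)) =
        ENNReal.ofReal (Real.exp (-θ * ∑ j ∈ Finset.range m, x (j + 1))) := by
      rw [Finset.mul_sum, Real.exp_sum, ENNReal.ofReal_prod_of_nonneg
        (fun _ _ => (Real.exp_pos _).le)]
      simp [domF]
    rw [e1, e2, mul_one, ← ENNReal.ofReal_mul (mul_nonneg (hterm m) (Real.exp_pos _).le)]
    apply ENNReal.ofReal_le_ofReal
    rw [mul_assoc, ← Real.exp_add]
    refine le_mul_of_one_le_right (hterm m) (Real.one_le_exp ?_)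
    have : ∑ j ∈ Finset.range m, x (j + 1) ≤ t := by linarith [hx 0]
    nlinarith

lemma rows_indep {Ω : Type*} [MeasurableSpace Ω] (μ : Measure Ω) [IsProbabilityMeasure μ]
    (ξ : ℕ → ℕ → Ω → ℝ) (hξmeas : ∀ i j, Measurable (ξ i j))
    (hindep : iIndepFun (fun q : ℕ × ℕ => ξ q.1 q.2) μ) :
    iIndepFun (fun i ω => (fun j => ξ i j ω)) μ := by
  have hp : ∀ i j, IsProbabilityMeasure (μ.map (ξ i j)) :=
    fun i j ↦ Measure.isProbabilityMeasure_map (hξmeas i j).aemeasurable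
  have hrow : ∀ i, iIndepFun (fun j => ξ i j) μ := fun i =>
    hindep.precomp (g := fun j => (i, j)) (fun a b h => by simpa using h)
  rw [iIndepFun_iff_map_fun_eq_infinitePi_map (by fun_prop)]
  have h1 := (iIndepFun_iff_map_fun_eq_infinitePi_map (by fun_prop)).1 hindep
  have h2 := Measure.infinitePi_map_curry (fun i j => μ.map (ξ i j))
  rw [← h1, Measure.map_map (by fun_prop) (by fun_prop)] at h2
  have h3 : (fun i => μ.map (fun ω j => ξ i j ω)) =
      fun i => Measure.infinitePi fun j => μ.map (ξ i j) := by
    funext i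
    exact (iIndepFun_iff_map_fun_eq_infinitePi_map (by fun_prop)).1 (hrow i)
  rw [h3, ← h2]
  rfl

lemma first_le {Ω : Type*} [MeasurableSpace Ω] (μ : Measure Ω) [IsProbabilityMeasure μ]
    (S : Ω → ℝ) (hSnn : ∀ᵐ ω ∂μ, 0 ≤ S ω)
    (hES : ∫ ω, S ω ∂μ = 1) (X : Ω → ℝ) (hX : Measurable X)
    (heq : ∀ y : ℝ, 0 ≤ y →
      (μ {ω | y < X ω}).toReal = ∫ z in Set.Ioi y, (μ {ω | z < S ω}).toReal)
    (t : ℝ) (ht : 0 ≤ t) : μ {ω | X ω ≤ t} ≤ ENNReal.ofReal t := by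
  have hlc := (integrable_of_integral_eq_one hES).integral_eq_integral_meas_lt hSnn
  rw [hES] at hlc
  have hint : IntegrableOn (fun z => μ.real {ω | z < S ω}) (Set.Ioi 0) :=
    integrable_of_integral_eq_one hlc.symm
  have hsplit : ∫ z in Set.Ioi (0:ℝ), μ.real {ω | z < S ω} =
      (∫ z in Set.Ioc 0 t, μ.real {ω | z < S ω}) + ∫ z in Set.Ioi t, μ.real {ω | z < S ω} := by
    rw [← Set.Ioc_union_Ioi_eq_Ioi ht]
    exact setIntegral_union (Set.Ioc_disjoint_Ioi le_rfl) measurableSet_Ioi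
      (hint.mono_set Set.Ioc_subset_Ioi_self) (hint.mono_set (Set.Ioi_subset_Ioi ht))
  have hle : ∫ z in Set.Ioc 0 t, μ.real {ω | z < S ω} ≤ t := by
    calc ∫ z in Set.Ioc 0 t, μ.real {ω | z < S ω} ≤ ∫ z in Set.Ioc 0 t, (1:ℝ) := by
          refine integral_mono (hint.mono_set Set.Ioc_subset_Ioi_self) (by simp) fun z => ?_
          exact measureReal_le_one
      _ = t := by simp [ht]
  have hy : μ.real {ω | t < X ω} = ∫ z in Set.Ioi t, μ.real {ω | z < S ω} := heq t ht
  have hc : μ.real {ω | X ω ≤ t} = 1 - μ.real {ω | t < X ω} := by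
    have : {ω | X ω ≤ t} = {ω | t < X ω}ᶜ := by ext; simp
    rw [this, probReal_compl_eq_one_sub (measurableSet_lt measurable_const hX)]
  have : μ.real {ω | X ω ≤ t} ≤ t := by linarith
  rw [← ofReal_measureReal]
  exact ENNReal.ofReal_le_ofReal this

lemma lintegral_domG_le {Ω : Type*} [MeasurableSpace Ω] (μ : Measure Ω) [IsProbabilityMeasure μ]
    (x : ℕ → Ω → ℝ) (hx : ∀ j, Measurable (x j)) (hind : iIndepFun x μ)
    (z θ t r : ℝ) (hz : 1 ≤ z) (ht : 0 ≤ t) (hr : 0 ≤ r) (hzr : z * r < 1)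
    (h0 : μ {ω | x 0 ω ≤ t} ≤ ENNReal.ofReal t)
    (h1 : ∀ j, ∫⁻ ω, ENNReal.ofReal (Real.exp (-θ * x (j + 1) ω)) ∂μ = ENNReal.ofReal r) :
    ∫⁻ ω, domG z θ t (fun j => x j ω) ∂μ ≤
      1 + ENNReal.ofReal (t * Real.exp (θ * t) * (z - 1) / (1 - z * r)) := by
  have hmF : ∀ j, Measurable (fun ω => domF θ t j (x j ω)) := fun j =>
    (measurable_domF θ t j).comp (hx j)
  have hF : iIndepFun (fun j ω => domF θ t j (x j ω)) μ :=
    hind.comp (fun j => domF θ t j) (fun j => measurable_domF θ t j)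
  have hF0 : ∫⁻ ω, domF θ t 0 (x 0 ω) ∂μ ≤ ENNReal.ofReal t := by
    refine le_trans (le_of_eq ?_) h0
    have : (fun ω => domF θ t 0 (x 0 ω)) = {ω | x 0 ω ≤ t}.indicator 1 := by
      funext ω
      simp [domF, Set.indicator]
    rw [this, lintegral_indicator_one (measurableSet_le (hx 0) measurable_const)]
  have hF1 : ∀ j, ∫⁻ ω, domF θ t (j + 1) (x (j + 1) ω) ∂μ = ENNReal.ofReal r := by
    intro j; rw [← h1 j]; simp [domF]
  unfold domG
  rw [lintegral_add_left measurable_const]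
  simp only [lintegral_const, measure_univ, mul_one]
  refine add_le_add le_rfl ?_
  have hmP : ∀ m : ℕ, Measurable (fun ω => ∏ j ∈ Finset.range (m + 1), domF θ t j (x j ω)) :=
    fun m => Finset.measurable_fun_prod _ fun j _ => hmF j
  rw [lintegral_tsum (fun m => ((hmP m).const_mul _).aemeasurable)]
  have hzr0 : 0 ≤ z * r := by positivity
  have hsum : HasSum (fun m : ℕ => (z - 1) * z ^ m * Real.exp (θ * t) * (t * r ^ m))
      (t * Real.exp (θ * t) * (z - 1) / (1 - z * r)) := by
    have := (hasSum_geometric_of_lt_one hzr0 hzr).mul_left (t * Real.exp (θ * t) * (z - 1))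
    rw [div_eq_mul_inv]
    have e : (fun m : ℕ => (z - 1) * z ^ m * Real.exp (θ * t) * (t * r ^ m)) =
        fun m : ℕ => t * Real.exp (θ * t) * (z - 1) * (z * r) ^ m := by
      funext m
      rw [mul_pow]; ring
    rw [e]
    exact this
  have hnn : ∀ m : ℕ, 0 ≤ (z - 1) * z ^ m * Real.exp (θ * t) := fun m =>
    mul_nonneg (mul_nonneg (by linarith) (by positivity)) (Real.exp_pos _).le
  have hnn2 : ∀ m : ℕ, 0 ≤ (z - 1) * z ^ m * Real.exp (θ * t) * (t * r ^ m) := fun m =>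
    mul_nonneg (hnn m) (by positivity)
  rw [← hsum.tsum_eq, ENNReal.ofReal_tsum_of_nonneg hnn2 hsum.summable]
  refine ENNReal.tsum_le_tsum fun m => ?_
  rw [lintegral_const_mul _ (hmP m), ENNReal.ofReal_mul (hnn m)]
  refine mul_le_mul_right ?_ _
  rw [lintegral_prod_eq_prod_lintegral_of_indepFun _ _ hF hmF, Finset.prod_range_succ',
    ENNReal.ofReal_mul ht, ENNReal.ofReal_pow hr, mul_comm]
  refine mul_le_mul' hF0 (le_of_eq ?_)
  rw [Finset.prod_congr rfl (fun j _ => hF1 j)]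
  simp

lemma rpow_le_exp_sub_one (u p : ℝ) (hu : 0 ≤ u) (hp : 1 ≤ p) :
    u ^ p ≤ p ^ p * (Real.exp u - 1) := by
  have hp0 : 0 < p := by linarith
  have hv : 0 ≤ u / p := by positivity
  have h1 : u / p ≤ Real.exp (u / p) - 1 := by linarith [Real.add_one_le_exp (u / p)]
  have h2 : (u / p) ^ p + 1 ^ p ≤ (u / p + 1) ^ p :=
    Real.add_rpow_le_rpow_add hv zero_le_one hp
  have h3 : (u / p + 1) ^ p ≤ (Real.exp (u / p)) ^ p :=
    Real.rpow_le_rpow (by linarith) (by linarith) hp0.le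
  rw [← Real.exp_mul, div_mul_cancel₀ _ hp0.ne'] at h3
  rw [Real.one_rpow] at h2
  have h4 : u ^ p = p ^ p * (u / p) ^ p := by
    rw [← Real.mul_rpow hp0.le hv, mul_div_cancel₀ _ hp0.ne']
  rw [h4]
  exact mul_le_mul_of_nonneg_left (by linarith) (by positivity)

lemma final_real (θ p δ δ' M : ℝ) (hp : 2 ≤ p) (hθ : 0 < θ) (hδ : 0 < δ) (hδ1 : δ ≤ 1)
    (hδ' : δ ≤ p * δ') (hM : 0 ≤ M) :
    (4 * Real.exp (θ / p) * p / δ') ^ p * 2 * M + M ≤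
      Real.exp θ * (10 ^ 3 * p ^ 3 / δ) ^ (p + 2) * M := by
  have hp0 : 0 < p := by linarith
  have hδ'0 : 0 < δ' := by
    by_contra h
    push Not at h
    nlinarith
  set B := 10 ^ 3 * p ^ 3 / δ with hB
  have hB1 : 10 ≤ B := by
    rw [hB, le_div_iff₀ hδ]
    have : 8 ≤ p ^ 3 := by nlinarith [sq_nonneg (p - 2)]
    nlinarith
  have hle : 4 * p / δ' ≤ B := by
    have h1 : 4 * p / δ' ≤ 4 * p ^ 2 / δ := by
      rw [div_le_div_iff₀ hδ'0 hδ]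
      nlinarith
    refine h1.trans ?_
    rw [hB]
    gcongr <;> first | linarith | norm_num
  have e1 : (4 * Real.exp (θ / p) * p / δ') ^ p = Real.exp θ * (4 * p / δ') ^ p := by
    have : 4 * Real.exp (θ / p) * p / δ' = Real.exp (θ / p) * (4 * p / δ') := by ring
    rw [this, Real.mul_rpow (Real.exp_pos _).le (by positivity), ← Real.exp_mul,
      div_mul_cancel₀ _ hp0.ne']
  have h2 : (4 * p / δ') ^ p ≤ B ^ p := Real.rpow_le_rpow (by positivity) hle hp0.le
  have hBp : 1 ≤ B ^ p := Real.one_le_rpow (by linarith) hp0.le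
  have he : 1 ≤ Real.exp θ := Real.one_le_exp hθ.le
  have h3 : B ^ (p + 2) = B ^ p * B ^ 2 := by
    rw [Real.rpow_add (by linarith)]; norm_num
  rw [e1, h3]
  have h4 : Real.exp θ * (4 * p / δ') ^ p * 2 + 1 ≤ Real.exp θ * (B ^ p * B ^ 2) := by
    have h5 : 1 ≤ Real.exp θ * B ^ p := by nlinarith
    have h6 : Real.exp θ * (4 * p / δ') ^ p ≤ Real.exp θ * B ^ p := by gcongr
    have h7 : 3 ≤ B ^ 2 := by nlinarith
    nlinarith
  nlinarith

lemma integral_exp_facts {Ω : Type*} [MeasurableSpace Ω] (μ : Measure Ω) [IsProbabilityMeasure μ]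
    (S : Ω → ℝ) (hSmeas : Measurable S) (hSnn : ∀ᵐ ω ∂μ, 0 ≤ S ω)
    (hES : ∫ ω, S ω ∂μ = 1) (θ p : ℝ) (hθ : 0 < θ) (hp : 2 ≤ p) :
    0 < 1 - ∫ ω, Real.exp (-θ * S ω) ∂μ ∧
    1 - ∫ ω, Real.exp (-θ * S ω) ∂μ ≤ p * (1 - ∫ ω, Real.exp (-(θ / p) * S ω) ∂μ) := by
  have hp0 : 0 < p := by linarith
  have hint : ∀ c : ℝ, 0 ≤ c → Integrable (fun ω => Real.exp (-c * S ω)) μ := by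
    intro c hc
    refine Integrable.of_bound (C := 1) (by fun_prop) ?_
    filter_upwards [hSnn] with ω hω
    rw [Real.norm_eq_abs, abs_of_pos (Real.exp_pos _), Real.exp_le_one_iff]
    nlinarith
  have hsub : ∀ c : ℝ, 0 ≤ c → 1 - ∫ ω, Real.exp (-c * S ω) ∂μ =
      ∫ ω, (1 - Real.exp (-c * S ω)) ∂μ := by
    intro c hc
    rw [integral_sub (integrable_const _) (hint c hc)]
    simp
  have hθp : 0 ≤ θ / p := by positivity
  constructor
  · rw [hsub θ hθ.le]
    have hnn : 0 ≤ᵐ[μ] fun ω => 1 - Real.exp (-θ * S ω) := by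
      filter_upwards [hSnn] with ω hω
      have : Real.exp (-θ * S ω) ≤ 1 := by
        rw [Real.exp_le_one_iff]; nlinarith
      simpa using this
    refine lt_of_le_of_ne (integral_nonneg_of_ae hnn) fun h => ?_
    have h0 := (integral_eq_zero_iff_of_nonneg_ae hnn
      ((integrable_const _).sub (hint θ hθ.le))).1 h.symm
    have hS0 : S =ᵐ[μ] 0 := by
      filter_upwards [h0] with ω hω
      have h1 : Real.exp (-θ * S ω) = 1 := by
        have : 1 - Real.exp (-θ * S ω) = 0 := hω
        linarith
      rw [Real.exp_eq_one_iff] at h1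
      rcases mul_eq_zero.1 h1 with h | h
      · linarith
      · exact h
    rw [integral_congr_ae hS0] at hES
    simp at hES
  · rw [hsub θ hθ.le, hsub _ hθp, ← integral_const_mul]
    refine integral_mono ((integrable_const _).sub (hint θ hθ.le))
      (((integrable_const _).sub (hint _ hθp)).const_mul _) fun ω => ?_
    have hb := one_add_mul_self_le_rpow_one_add
      (s := Real.exp (-(θ / p) * S ω) - 1) (by linarith [Real.exp_pos (-(θ / p) * S ω)])
      (p := p) (by linarith)
    have e : (1 + (Real.exp (-(θ / p) * S ω) - 1)) ^ p = Real.exp (-θ * S ω) := by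
      rw [add_sub_cancel, ← Real.exp_mul]
      congr 1
      field_simp
    rw [e] at hb
    show 1 - Real.exp (-θ * S ω) ≤ p * (1 - Real.exp (-(θ / p) * S ω))
    linarith

/-- Explicit bound on the `p`-th central moment of the pooled process `∑_{i=1}^k N_i(t)`
for `t ∈ [0,1]`, where the `N_i` are counting processes of i.i.d. equilibrium renewal
processes with renewal distribution `S`, `E[S] = 1`.  Here `ξ i 0` is the first
(equilibrium-distributed) interval of the `i`-th process and `ξ i (j+1)` its subsequent
intervals, distributed as `S`, all jointly independent. -/
theorem pooled_central_moment_small_time_weak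
    {Ω : Type*} [MeasurableSpace Ω] (μ : Measure Ω) [IsProbabilityMeasure μ]
    (S : Ω → ℝ) (hSmeas : Measurable S) (hSnn : ∀ᵐ ω ∂μ, 0 ≤ S ω)
    (hES : ∫ ω, S ω ∂μ = 1)
    (ξ : ℕ → ℕ → Ω → ℝ)
    (hξmeas : ∀ i j, Measurable (ξ i j))
    (hξnn : ∀ i j, ∀ᵐ ω ∂μ, 0 ≤ ξ i j ω)
    (hindep : iIndepFun (fun q : ℕ × ℕ => ξ q.1 q.2) μ)
    (hlaw : ∀ i j, μ.map (ξ i (j + 1)) = μ.map S)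
    (heq : ∀ i, ∀ y : ℝ, 0 ≤ y →
      (μ {ω | y < ξ i 0 ω}).toReal = ∫ z in Set.Ioi y, (μ {ω | z < S ω}).toReal) :
    ∀ k : ℕ, 1 ≤ k → ∀ p : ℝ, 2 ≤ p → ∀ t : ℝ, 0 ≤ t → t ≤ 1 → ∀ θ : ℝ, 0 < θ →
      ∫⁻ ω, ENNReal.ofReal
          (|(∑ i ∈ Finset.range k, (renewalCount (fun j => ξ i j ω) t : ℝ)) - (k : ℝ) * t| ^ p) ∂μ
        ≤ ENNReal.ofReal (Real.exp θ
            * (10 ^ 3 * p ^ 3 / (1 - ∫ ω, Real.exp (-θ * S ω) ∂μ)) ^ (p + 2)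
            * max ((k : ℝ) * t) (((k : ℝ) * t) ^ p)) := by
  intro k hk p hp t ht0 ht1 θ hθ
  have hp0 : 0 < p := by linarith
  have hk0 : (0 : ℝ) < k := by exact_mod_cast hk
  obtain ⟨hδ, hδ'⟩ := integral_exp_facts μ S hSmeas hSnn hES θ p hθ hp
  have hφ0 : 0 ≤ ∫ ω, Real.exp (-θ * S ω) ∂μ := integral_nonneg fun ω => (Real.exp_pos _).le
  have hr0 : 0 ≤ ∫ ω, Real.exp (-(θ / p) * S ω) ∂μ :=
    integral_nonneg fun ω => (Real.exp_pos _).le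
  set δ := 1 - ∫ ω, Real.exp (-θ * S ω) ∂μ with hδdef
  set r := ∫ ω, Real.exp (-(θ / p) * S ω) ∂μ with hrdef
  have hδ'0 : 0 < 1 - r := by
    by_contra h
    push Not at h
    nlinarith
  set δ' := 1 - r with hδ'def
  set a := Real.exp (θ / p) with hadef
  have hθp : 0 < θ / p := by positivity
  have ha1 : 1 ≤ a := Real.one_le_exp hθp.le
  set l := max ((k : ℝ) * t) 1 with hl
  have hl1 : 1 ≤ l := le_max_right _ _
  have hlkt : (k : ℝ) * t ≤ l := le_max_left _ _
  have hl0 : 0 < l := by linarith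
  set s := δ' / (4 * a) with hs
  have hs0 : 0 < s := by positivity
  have h4as : 4 * a * s = δ' := by rw [hs]; field_simp
  have hs1 : s ≤ 1 := by nlinarith
  have hsl0 : 0 < s / l := by positivity
  have hsls : s / l ≤ s := div_le_self hs0.le hl1
  set z := Real.exp (s / l) with hz
  have hz1 : 1 ≤ z := Real.one_le_exp hsl0.le
  have hz2 : z - 1 ≤ 2 * (s / l) := by
    have := Real.abs_exp_sub_one_le (x := s / l) (by rw [abs_of_pos hsl0]; linarith)
    rw [abs_of_pos hsl0] at this
    exact (le_abs_self _).trans this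
  have hz3 : z - 1 ≤ δ' / 2 := by nlinarith
  have hzr : δ' / 2 ≤ 1 - z * r := by
    have : r = 1 - δ' := by rw [hδ'def]; ring
    have hr1 : r ≤ 1 := by linarith
    nlinarith
  have hkt0 : 0 ≤ (k : ℝ) * t := by positivity
  -- bound on the generating function of one process
  have hone : ∀ i, ∫⁻ ω, domG z (θ / p) t (fun j => ξ i j ω) ∂μ ≤
      ENNReal.ofReal (1 + t / l) := by
    intro i
    have hrow : iIndepFun (fun j => ξ i j) μ :=
      hindep.precomp (g := fun j => (i, j)) (fun a b h => by simpa using h)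
    have h1 : ∀ j, ∫⁻ ω, ENNReal.ofReal (Real.exp (-(θ / p) * ξ i (j + 1) ω)) ∂μ
        = ENNReal.ofReal r := by
      intro j
      have hm : Measurable fun y : ℝ => ENNReal.ofReal (Real.exp (-(θ / p) * y)) := by fun_prop
      rw [← lintegral_map (μ := μ) hm (hξmeas i (j + 1)), hlaw, lintegral_map hm hSmeas, hrdef,
        ofReal_integral_eq_lintegral_ofReal _ (Filter.Eventually.of_forall
          fun ω => (Real.exp_pos _).le)]
      refine Integrable.of_bound (C := 1) (by fun_prop) ?_
      filter_upwards [hSnn] with ω hω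
      rw [Real.norm_eq_abs, abs_of_pos (Real.exp_pos _), Real.exp_le_one_iff]
      nlinarith
    refine (lintegral_domG_le μ (ξ i) (hξmeas i) hrow z (θ / p) t r hz1 ht0 hr0
      (by linarith) (first_le μ S hSnn hES (ξ i 0) (hξmeas i 0) (heq i) t ht0) h1).trans ?_
    rw [ENNReal.ofReal_add zero_le_one (by positivity), ENNReal.ofReal_one]
    refine add_le_add le_rfl (ENNReal.ofReal_le_ofReal ?_)
    have hexp : Real.exp (θ / p * t) ≤ a := Real.exp_le_exp.2 (by nlinarith)
    have hd : 0 < 1 - z * r := by linarith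
    rw [div_le_iff₀ hd]
    calc t * Real.exp (θ / p * t) * (z - 1) ≤ t * a * (2 * (s / l)) := by
          gcongr
      _ = t / l * (δ' / 2) := by rw [← h4as]; ring
      _ ≤ t / l * (1 - z * r) := by gcongr
  set X : Ω → ℕ := fun ω => ∑ i ∈ Finset.range k, renewalCount (fun j => ξ i j ω) t with hX
  have hnnall : ∀ᵐ ω ∂μ, ∀ i j, 0 ≤ ξ i j ω := by
    rw [ae_all_iff]; intro i; rw [ae_all_iff]; exact hξnn i
  have hMGF : ∫⁻ ω, ENNReal.ofReal (z ^ X ω) ∂μ ≤ ENNReal.ofReal (1 + 2 * ((k : ℝ) * t / l)) := by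
    have hG : iIndepFun (fun i ω => domG z (θ / p) t (fun j => ξ i j ω)) μ :=
      (rows_indep μ ξ hξmeas hindep).comp (fun _ => domG z (θ / p) t)
        (fun _ => measurable_domG _ _ _)
    have hGm : ∀ i, Measurable (fun ω => domG z (θ / p) t (fun j => ξ i j ω)) := fun i =>
      (measurable_domG _ _ _).comp (measurable_pi_lambda _ fun j => hξmeas i j)
    calc ∫⁻ ω, ENNReal.ofReal (z ^ X ω) ∂μ
        ≤ ∫⁻ ω, ∏ i ∈ Finset.range k, domG z (θ / p) t (fun j => ξ i j ω) ∂μ := by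
          refine lintegral_mono_ae ?_
          filter_upwards [hnnall] with ω hω
          rw [hX, ← Finset.prod_pow_eq_pow_sum, ENNReal.ofReal_prod_of_nonneg
            (fun _ _ => by positivity)]
          exact Finset.prod_le_prod' fun i _ =>
            pow_renewalCount_le _ (hω i) z (θ / p) t hz1 hθp.le
      _ = ∏ i ∈ Finset.range k, ∫⁻ ω, domG z (θ / p) t (fun j => ξ i j ω) ∂μ :=
          lintegral_prod_eq_prod_lintegral_of_indepFun _ _ hG hGm
      _ ≤ ∏ i ∈ Finset.range k, ENNReal.ofReal (1 + t / l) :=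
          Finset.prod_le_prod' fun i _ => hone i
      _ = ENNReal.ofReal ((1 + t / l) ^ k) := by
          rw [Finset.prod_const, Finset.card_range, ENNReal.ofReal_pow (by positivity)]
      _ ≤ ENNReal.ofReal (1 + 2 * ((k : ℝ) * t / l)) := by
          apply ENNReal.ofReal_le_ofReal
          have h1 : (1 + t / l) ^ k ≤ Real.exp ((k : ℝ) * t / l) := by
            rw [mul_div_assoc, Real.exp_nat_mul]
            have := Real.add_one_le_exp (t / l)
            gcongr
            linarith
          have h2 : |(k : ℝ) * t / l| ≤ 1 := by
            rw [abs_of_nonneg (by positivity), div_le_one hl0]; exact hlkt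
          have h3 := (le_abs_self _).trans (Real.abs_exp_sub_one_le h2)
          rw [abs_of_nonneg (by positivity : 0 ≤ (k : ℝ) * t / l)] at h3
          linarith
  set C := l ^ p * (4 * a * p / δ') ^ p with hC
  have hC0 : 0 ≤ C := by positivity
  have hpt : ∀ n : ℕ, (n : ℝ) ^ p + C ≤ C * z ^ n := by
    intro n
    have h := rpow_le_exp_sub_one (n * (s / l)) p (by positivity) (by linarith)
    rw [Real.exp_nat_mul, ← hz] at h
    have e : (n : ℝ) ^ p = (l / s) ^ p * (n * (s / l)) ^ p := by
      rw [← Real.mul_rpow (by positivity) (by positivity)]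
      congr 1
      field_simp
    have e2 : C = (l / s) ^ p * p ^ p := by
      rw [hC, ← Real.mul_rpow (by positivity) (by positivity),
        ← Real.mul_rpow (by positivity) (by positivity)]
      congr 1
      rw [← h4as]
      field_simp
    have h5 : (l / s) ^ p * (n * (s / l)) ^ p ≤ (l / s) ^ p * (p ^ p * (z ^ n - 1)) := by
      gcongr
    rw [e, e2]
    linarith
  have hmom : ∫⁻ ω, ENNReal.ofReal ((X ω : ℝ) ^ p) ∂μ ≤
      ENNReal.ofReal (C * (2 * ((k : ℝ) * t / l))) := by
    have hq : 0 ≤ (k : ℝ) * t / l := by positivity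
    have h1 : ∫⁻ ω, ENNReal.ofReal ((X ω : ℝ) ^ p) ∂μ + ENNReal.ofReal C ≤
        ENNReal.ofReal (C * (2 * ((k : ℝ) * t / l))) + ENNReal.ofReal C := by
      calc ∫⁻ ω, ENNReal.ofReal ((X ω : ℝ) ^ p) ∂μ + ENNReal.ofReal C
          = ∫⁻ ω, (ENNReal.ofReal ((X ω : ℝ) ^ p) + ENNReal.ofReal C) ∂μ := by
            rw [lintegral_add_right _ measurable_const]; simp
        _ ≤ ∫⁻ ω, ENNReal.ofReal C * ENNReal.ofReal (z ^ X ω) ∂μ := by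
            refine lintegral_mono fun ω => ?_
            rw [← ENNReal.ofReal_add (by positivity) hC0, ← ENNReal.ofReal_mul hC0]
            exact ENNReal.ofReal_le_ofReal (hpt _)
        _ = ENNReal.ofReal C * ∫⁻ ω, ENNReal.ofReal (z ^ X ω) ∂μ :=
            lintegral_const_mul' _ _ ENNReal.ofReal_ne_top
        _ ≤ ENNReal.ofReal C * ENNReal.ofReal (1 + 2 * ((k : ℝ) * t / l)) := by gcongr
        _ = _ := by
            rw [← ENNReal.ofReal_mul hC0, ← ENNReal.ofReal_add (by positivity) hC0]
            congr 1; ring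
    exact (ENNReal.add_le_add_iff_right ENNReal.ofReal_ne_top).1 h1
  set M := max ((k : ℝ) * t) (((k : ℝ) * t) ^ p) with hM
  have hM0 : 0 ≤ M := le_max_of_le_left hkt0
  have hlM : l ^ p * ((k : ℝ) * t / l) ≤ M := by
    rcases le_total ((k : ℝ) * t) 1 with h | h
    · have : l = 1 := max_eq_right h
      rw [this]; simp [hM]
    · have : l = (k : ℝ) * t := max_eq_left h
      rw [this, div_self (by linarith), mul_one]
      exact le_max_right _ _
  calc ∫⁻ ω, ENNReal.ofReal
          (|(∑ i ∈ Finset.range k, (renewalCount (fun j => ξ i j ω) t : ℝ)) - (k : ℝ) * t| ^ p) ∂μ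
      ≤ ∫⁻ ω, (ENNReal.ofReal ((X ω : ℝ) ^ p) + ENNReal.ofReal M) ∂μ := by
        refine lintegral_mono fun ω => ?_
        rw [← ENNReal.ofReal_add (by positivity) hM0]
        apply ENNReal.ofReal_le_ofReal
        have hXc : (∑ i ∈ Finset.range k, (renewalCount (fun j => ξ i j ω) t : ℝ)) = (X ω : ℝ) := by
          simp [hX]
        rw [hXc]
        have hx0 : (0 : ℝ) ≤ X ω := by positivity
        have hpM : ((k : ℝ) * t) ^ p ≤ M := le_max_right _ _
        have hpn : 0 ≤ (X ω : ℝ) ^ p := by positivity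
        rcases le_total ((k : ℝ) * t) (X ω : ℝ) with h | h
        · have : |(X ω : ℝ) - (k : ℝ) * t| ^ p ≤ (X ω : ℝ) ^ p :=
            Real.rpow_le_rpow (abs_nonneg _) (by rw [abs_of_nonneg (by linarith)]; linarith) hp0.le
          linarith
        · have : |(X ω : ℝ) - (k : ℝ) * t| ^ p ≤ ((k : ℝ) * t) ^ p :=
            Real.rpow_le_rpow (abs_nonneg _) (by rw [abs_of_nonpos (by linarith)]; linarith) hp0.le
          linarith
    _ = ∫⁻ ω, ENNReal.ofReal ((X ω : ℝ) ^ p) ∂μ + ENNReal.ofReal M := by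
        rw [lintegral_add_right _ measurable_const]; simp
    _ ≤ ENNReal.ofReal (C * (2 * ((k : ℝ) * t / l))) + ENNReal.ofReal M := by gcongr
    _ = ENNReal.ofReal (C * (2 * ((k : ℝ) * t / l)) + M) :=
        (ENNReal.ofReal_add (by positivity) hM0).symm
    _ ≤ _ := by
        apply ENNReal.ofReal_le_ofReal
        refine le_trans ?_ (final_real θ p δ δ' M hp hθ hδ (by linarith) hδ' hM0)
        have : C * (2 * ((k : ℝ) * t / l)) =
            (4 * a * p / δ') ^ p * 2 * (l ^ p * ((k : ℝ) * t / l)) := by rw [hC]; ring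
        rw [this]
        gcongr
end
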